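/- Let q be a fixed odd prime power. Then lim_{n→∞} S_n / q^{2n²+2n} = ∏_{i ≥ 1} (1 + q^{-i}) (1 - q^{-i})^{-⌊(i+1)/2⌋}, where the infinite product converges. -/

import Mathlib

open Matrix

/-- The `2n × 2n` matrix `J = [[0, I],[-I, 0]]` defining the symplectic group. -/
noncomputable def sympJ (F : Type) [Field F] (n : ℕ) :
    Matrix (Fin n ⊕ Fin n) (Fin n ⊕ Fin n) F :=
  Matrix.fromBlocks 0 1 (-1) 0

/-- `S_n`: the number of ordered pairs of commuting elements of the Lie algebra
`sp(2n,q) = {A : A·J = (A·J)ᵀ}`. -/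
noncomputable def spCommPairs (F : Type) [Field F] [Fintype F] (n : ℕ) : ℕ :=
  Nat.card {P : Matrix (Fin n ⊕ Fin n) (Fin n ⊕ Fin n) F ×
      Matrix (Fin n ⊕ Fin n) (Fin n ⊕ Fin n) F //
    P.1 * sympJ F n = (P.1 * sympJ F n)ᵀ ∧ P.2 * sympJ F n = (P.2 * sympJ F n)ᵀ ∧
    P.1 * P.2 = P.2 * P.1}

open Matrix

set_option linter.all false

namespace FF

section util

theorem card_avg {G X Y : Type*} [Finite G] [Finite X] [Finite Y] (act : G → X ≃ Y) (P : Y → Prop) (c : ℕ)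
    (h : ∀ x, Nat.card {g : G // P (act g x)} = c) :
    Nat.card X * c = Nat.card G * Nat.card {y : Y // P y} := by
  have e : {p : X × G // P (act p.2 p.1)} ≃ {p : G × Y // P p.2} :=
    { toFun := fun s => ⟨(s.1.2, act s.1.2 s.1.1), s.2⟩
      invFun := fun p => ⟨((act p.1.1).symm p.1.2, p.1.1), by simpa using p.2⟩
      left_inv := by rintro ⟨⟨x, g⟩, hg⟩; simp
      right_inv := by rintro ⟨⟨g, y⟩, hy⟩; simp }
  have e1 : {p : X × G // P (act p.2 p.1)} ≃ (Σ x : X, {g : G // P (act g x)}) :=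
    Equiv.subtypeProdEquivSigmaSubtype (fun x g => P (act g x))
  have e2 : {p : G × Y // P p.2} ≃ G × {y : Y // P y} :=
    { toFun := fun s => (s.1.1, ⟨s.1.2, s.2⟩)
      invFun := fun p => ⟨(p.1, p.2.1), p.2.2⟩
      left_inv := by rintro ⟨⟨x, g⟩, hg⟩; simp
      right_inv := by rintro ⟨g, y, hy⟩; simp }
  have e := (e1.symm.trans e).trans e2
  have h1 := Nat.card_congr e
  have := Fintype.ofFinite X
  rw [Nat.card_sigma, Nat.card_prod] at h1
  rw [← h1]
  simp [h, Nat.card_eq_fintype_card]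

theorem card_fiber_const {X Y : Type*} [Finite X] [Finite Y] (f : X → Y) (c : ℕ)
    (h : ∀ y, Nat.card {x : X // f x = y} = c) : Nat.card X = Nat.card Y * c := by
  have h1 := Nat.card_congr (Equiv.sigmaFiberEquiv f)
  have := Fintype.ofFinite Y
  rw [← h1, Nat.card_sigma]
  simp [h, Nat.card_eq_fintype_card]

theorem card_fiber_range {X : Type*} [Finite X] (f : X → ℕ) (k : ℕ) (h : ∀ x, f x ≤ k) :
    Nat.card X = ∑ j ∈ Finset.range (k+1), Nat.card {x : X // f x = j} := by
  have := Fintype.ofFinite X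
  classical
  rw [Nat.card_eq_fintype_card, ← Finset.card_univ,
    Finset.card_eq_sum_card_fiberwise (f := f) (t := Finset.range (k+1))]
  · refine Finset.sum_congr rfl fun j _ => ?_
    rw [Nat.card_eq_fintype_card, Fintype.card_subtype]
  · intro x _; simp [h x]

end util

variable {F : Type} [Field F]

section adapt
variable {r k : ℕ} {ι : Type} [Fintype ι] [DecidableEq ι]

theorem inj_of_rank_fromCols (Y : Matrix ι (Fin r) F) (h : (fromCols Y (0 : Matrix ι (Fin k) F)).rank = r) :
    Function.Injective Y.mulVec := by
  have e : fromCols Y (0 : Matrix ι (Fin k) F) = Y * fromCols (1 : Matrix (Fin r) (Fin r) F) 0 := by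
    rw [mul_fromCols]; simp
  have h1 : r ≤ Y.rank := by
    calc r = _ := h.symm
      _ ≤ _ := by rw [e]; exact rank_mul_le_left _ _
  have h2 := LinearMap.finrank_range_add_finrank_ker Y.mulVecLin
  rw [Matrix.rank] at h1
  simp only [Module.finrank_fintype_fun_eq_card, Fintype.card_fin] at h2
  have h3 : Module.finrank F (LinearMap.ker Y.mulVecLin) = 0 := by omega
  have h4 := Submodule.finrank_eq_zero.1 h3
  exact LinearMap.ker_eq_bot.1 h4

/-- column-adapted basis -/
theorem exists_adapt (A : Matrix ι (Fin r ⊕ Fin k) F) (h : A.rank = r) :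
    ∃ (g : GL (Fin r ⊕ Fin k) F) (Y : Matrix ι (Fin r) F), A * (g : Matrix (Fin r ⊕ Fin k) (Fin r ⊕ Fin k) F) = fromCols Y 0 ∧
      Function.Injective Y.mulVec := by
  classical
  set K := LinearMap.ker A.mulVecLin with hK
  have hrk : Module.finrank F K = k := by
    have : A.rank + Module.finrank F K = _ := LinearMap.finrank_range_add_finrank_ker A.mulVecLin
    simp only [Module.finrank_fintype_fun_eq_card, Fintype.card_sum, Fintype.card_fin] at this
    omega
  obtain ⟨U, hU⟩ := Submodule.exists_isCompl K
  have hUr : Module.finrank F U = r := by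
    have := Submodule.finrank_add_eq_of_isCompl hU
    simp at this
    omega
  let bU := Module.finBasisOfFinrankEq F U hUr
  let bK := Module.finBasisOfFinrankEq F K hrk
  let b : Module.Basis (Fin r ⊕ Fin k) F ((Fin r ⊕ Fin k) → F) :=
    (bU.prod bK).map (Submodule.prodEquivOfIsCompl U K hU.symm)
  let g : Matrix (Fin r ⊕ Fin k) (Fin r ⊕ Fin k) F := (Pi.basisFun F _).toMatrix b
  have hg : ∀ v, g *ᵥ v = b.equivFun.symm v := by
    intro v
    rw [Module.Basis.equivFun_symm_apply]
    ext i
    simp [g, mulVec, dotProduct, Module.Basis.toMatrix, mul_comm]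
  have hgu : IsUnit g := by
    rw [← Matrix.mulVec_injective_iff_isUnit]
    intro v w hvw
    simp only [hg] at hvw
    exact b.equivFun.symm.injective hvw
  obtain ⟨g', hg'⟩ := hgu
  have key : A * g = fromCols (A * g).toCols₁ 0 := by
    ext i (j|j)
    · simp [toCols₁]
    · have : A *ᵥ (b (Sum.inr j)) = 0 := by
        have h0 : b (Sum.inr j) = (bK j : _ → F) := by simp [b]
        rw [h0]
        exact (bK j).2
      have h2 : g *ᵥ (Pi.single (Sum.inr j) 1) = b (Sum.inr j) := by
        rw [hg]; simp
      have h3 := congrFun this i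
      rw [← h2, Matrix.mulVec_mulVec, Matrix.mulVec_single_one] at h3
      simpa using h3
  refine ⟨g', (A * g).toCols₁, ?_, ?_⟩
  · rw [hg']; exact key
  · have hAg : A * g = fromCols (A * g).toCols₁ 0 := key
    have h1 : (A * g).rank = r := by
      rw [rank_mul_eq_left_of_isUnit_det _ _ ((Matrix.isUnit_iff_isUnit_det _).1 ⟨g', hg'⟩), h]
    generalize (A * g).toCols₁ = Y at hAg
    rw [hAg] at h1
    exact inj_of_rank_fromCols Y h1

end adapt

end FF

open Matrix
set_option linter.all false

namespace FF
variable {F : Type} [Field F] [Fintype F]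

/-- the order of GL -/
noncomputable def gl (F : Type) [Field F] (n : ℕ) : ℕ := Nat.card (GL (Fin n) F)

theorem gl_pos (n : ℕ) : 0 < gl F n := by
  classical
  exact Nat.card_pos

noncomputable def glEquiv (n : Type) [Fintype n] [DecidableEq n] :
    GL n F ≃ {M : Matrix n n F // IsUnit M} :=
  Equiv.ofBijective (fun u => ⟨u.1, u.isUnit⟩) ⟨fun u v h => Units.ext (by simpa using h),
    fun ⟨M, u, hu⟩ => ⟨u, by simp [hu]⟩⟩

@[simp] theorem glEquiv_coe (n : Type) [Fintype n] [DecidableEq n] (u : GL n F) : ((glEquiv n u) : Matrix n n F) = u.1 := rfl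

theorem card_mat (a b : Type) [Fintype a] [Fintype b] : Nat.card (Matrix a b F) = Fintype.card F ^ (Fintype.card a * Fintype.card b) := by
  classical
  rw [Nat.card_congr (Matrix.of (m := a) (n := b) (α := F)).symm, Nat.card_eq_fintype_card, Fintype.card_fun, Fintype.card_fun, ← pow_mul, mul_comm]

theorem card_gl_equiv {n m : Type} [Fintype n] [DecidableEq n] [Fintype m] [DecidableEq m] (e : n ≃ m) :
    Nat.card (GL n F) = Nat.card (GL m F) := by
  exact Nat.card_congr (Units.mapEquiv (Matrix.reindexAlgEquiv F F e).toMulEquiv).toEquiv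

theorem card_gl_sum (r k : ℕ) : Nat.card (GL (Fin r ⊕ Fin k) F) = gl F (r+k) :=
  card_gl_equiv finSumFinEquiv

theorem card_lower (r k : ℕ) :
    Nat.card {h : GL (Fin r ⊕ Fin k) F // h.1.toBlocks₁₂ = 0} = gl F r * gl F k * Fintype.card F ^ (r*k) := by
  have e1 : {h : GL (Fin r ⊕ Fin k) F // h.1.toBlocks₁₂ = 0} ≃
      ({M : Matrix (Fin r) (Fin r) F // IsUnit M} × {M : Matrix (Fin k) (Fin k) F // IsUnit M}) × Matrix (Fin k) (Fin r) F :=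
    { toFun := fun h => 
        have hh : IsUnit (fromBlocks h.1.1.toBlocks₁₁ 0 h.1.1.toBlocks₂₁ h.1.1.toBlocks₂₂) := by
          have h1 := h.1.isUnit
          rwa [← fromBlocks_toBlocks h.1.1, h.2] at h1
        ((⟨h.1.1.toBlocks₁₁, (isUnit_fromBlocks_zero₁₂.1 hh).1⟩, ⟨h.1.1.toBlocks₂₂, (isUnit_fromBlocks_zero₁₂.1 hh).2⟩), h.1.1.toBlocks₂₁)
      invFun := fun p => ⟨(glEquiv _).symm ⟨fromBlocks p.1.1.1 0 p.2 p.1.2.1, isUnit_fromBlocks_zero₁₂.2 ⟨p.1.1.2, p.1.2.2⟩⟩, by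
        rw [← glEquiv_coe]; simp⟩
      left_inv := by
        rintro ⟨h, hh⟩
        apply Subtype.ext
        apply (glEquiv _).injective
        apply Subtype.ext
        simp only [Equiv.apply_symm_apply, glEquiv_coe]
        conv_rhs => rw [← fromBlocks_toBlocks h.1, hh]
      right_inv := by
        rintro ⟨⟨⟨a, ha⟩, ⟨b, hb⟩⟩, c⟩
        simp [← glEquiv_coe] }
  rw [Nat.card_congr e1, Nat.card_prod, Nat.card_prod, ← Nat.card_congr (glEquiv (F := F) (Fin r)),
    ← Nat.card_congr (glEquiv (F := F) (Fin k)), card_mat]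
  simp [gl, mul_comm k r]

theorem card_stab (j l : ℕ) :
    Nat.card {h : GL (Fin j ⊕ Fin l) F // fromCols (1 : Matrix (Fin j) (Fin j) F) (0 : Matrix (Fin j) (Fin l) F) * (h : Matrix (Fin j ⊕ Fin l) (Fin j ⊕ Fin l) F) = fromCols 1 0} = gl F l * Fintype.card F ^ (j*l) := by
  have hc : ∀ M : Matrix (Fin j ⊕ Fin l) (Fin j ⊕ Fin l) F,
      fromCols (1 : Matrix (Fin j) (Fin j) F) (0 : Matrix (Fin j) (Fin l) F) * M = fromCols 1 0 ↔
        M.toBlocks₁₁ = 1 ∧ M.toBlocks₁₂ = 0 := by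
    intro M
    conv_lhs => rw [← fromBlocks_toBlocks M]
    rw [fromCols_mul_fromBlocks, fromCols_ext_iff]
    simp
  have e1 : {h : GL (Fin j ⊕ Fin l) F // fromCols (1 : Matrix (Fin j) (Fin j) F) (0 : Matrix (Fin j) (Fin l) F) * (h : Matrix (Fin j ⊕ Fin l) (Fin j ⊕ Fin l) F) = fromCols 1 0} ≃
      ({M : Matrix (Fin l) (Fin l) F // IsUnit M}) × Matrix (Fin l) (Fin j) F :=
    { toFun := fun h => 
        have hh : IsUnit (fromBlocks 1 0 h.1.1.toBlocks₂₁ h.1.1.toBlocks₂₂) := by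
          have h1 := h.1.isUnit
          rwa [← fromBlocks_toBlocks h.1.1, ((hc _).1 h.2).1, ((hc _).1 h.2).2] at h1
        (⟨h.1.1.toBlocks₂₂, (isUnit_fromBlocks_zero₁₂.1 hh).2⟩, h.1.1.toBlocks₂₁)
      invFun := fun p => ⟨(glEquiv _).symm ⟨fromBlocks 1 0 p.2 p.1.1, isUnit_fromBlocks_zero₁₂.2 ⟨isUnit_one, p.1.2⟩⟩, by
        rw [hc, ← glEquiv_coe]; simp⟩
      left_inv := by
        rintro ⟨h, hh⟩
        apply Subtype.ext
        apply (glEquiv _).injective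
        apply Subtype.ext
        simp only [Equiv.apply_symm_apply, glEquiv_coe]
        conv_rhs => rw [← fromBlocks_toBlocks h.1, ((hc _).1 hh).1, ((hc _).1 hh).2]
      right_inv := by
        rintro ⟨⟨b, hb⟩, c⟩
        simp [← glEquiv_coe] }
  rw [Nat.card_congr e1, Nat.card_prod, ← Nat.card_congr (glEquiv (F := F) (Fin l)), card_mat]
  simp [gl, mul_comm l j]

theorem card_adapt {r k : ℕ} {ι : Type} [Fintype ι] [DecidableEq ι]
    (A : Matrix ι (Fin r ⊕ Fin k) F) (h : A.rank = r) :
    Nat.card {g : GL (Fin r ⊕ Fin k) F // (A * (g : Matrix (Fin r ⊕ Fin k) (Fin r ⊕ Fin k) F)).toCols₂ = 0} = gl F r * gl F k * Fintype.card F ^ (r*k) := by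
  obtain ⟨g, Y, hg, hY⟩ := exists_adapt A h
  rw [← card_lower]
  refine Nat.card_congr (Equiv.subtypeEquiv (Equiv.mulLeft g⁻¹) ?_)
  intro a
  have : A * (a : Matrix (Fin r ⊕ Fin k) (Fin r ⊕ Fin k) F) = fromCols Y (0 : Matrix ι (Fin k) F) * ((g⁻¹ * a : GL (Fin r ⊕ Fin k) F) : Matrix (Fin r ⊕ Fin k) (Fin r ⊕ Fin k) F) := by
    rw [← hg, Matrix.mul_assoc]; congr 1
    rw [← Units.val_mul]; simp
  simp only [Equiv.coe_mulLeft]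
  rw [this]
  generalize ((g⁻¹ * a : GL (Fin r ⊕ Fin k) F) : Matrix (Fin r ⊕ Fin k) (Fin r ⊕ Fin k) F) = h
  conv_lhs => rw [← fromBlocks_toBlocks h, fromCols_mul_fromBlocks]
  simp only [toCols₂_fromCols, Matrix.zero_mul, add_zero]
  constructor
  · intro h0
    ext i c
    have h1 : Y *ᵥ (fun i => h.toBlocks₁₂ i c) = Y *ᵥ 0 := by
      rw [mulVec_zero]; ext i'
      exact congrFun (congrFun h0 i') c
    exact congrFun (hY h1) i
  · intro h0; rw [h0]; simp

/-- number of ε-symmetric matrices -/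
noncomputable def NS (ε : F) (l : ℕ) : ℕ := Nat.card {M : Matrix (Fin l) (Fin l) F // Mᵀ = ε • M}
noncomputable def NSn (ε : F) (l : ℕ) : ℕ := Nat.card {M : Matrix (Fin l) (Fin l) F // Mᵀ = ε • M ∧ IsUnit M}

theorem card_sym_equiv (ε : F) (P : Prop) {n m : Type} [Fintype n] [DecidableEq n] [Fintype m] [DecidableEq m] (e : n ≃ m) :
    Nat.card {M : Matrix n n F // Mᵀ = ε • M} = Nat.card {M : Matrix m m F // Mᵀ = ε • M} := by
  refine Nat.card_congr (Equiv.subtypeEquiv (Matrix.reindex e e) ?_)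
  intro M
  rw [transpose_reindex, ← (Matrix.reindex e e).injective.eq_iff]
  rfl

theorem sym_blocks {ε : F} (hε : ε * ε = 1) {a b : Type} (M : Matrix (a ⊕ b) (a ⊕ b) F) :
    Mᵀ = ε • M ↔ M.toBlocks₁₁ᵀ = ε • M.toBlocks₁₁ ∧ M.toBlocks₂₂ᵀ = ε • M.toBlocks₂₂ ∧
      M.toBlocks₂₁ = ε • M.toBlocks₁₂ᵀ := by
  conv_lhs => rw [← fromBlocks_toBlocks M, fromBlocks_transpose, fromBlocks_smul, fromBlocks_inj]
  constructor
  · rintro ⟨h1, h2, h3, h4⟩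
    exact ⟨h1, h4, by rw [h3, smul_smul, hε, one_smul]⟩
  · rintro ⟨h1, h2, h3⟩
    refine ⟨h1, ?_, ?_, h2⟩
    · rw [h3]; simp
    · rw [h3, smul_smul, hε, one_smul]

theorem NS_add {ε : F} (hε : ε * ε = 1) (j l : ℕ) : NS ε (j+l) = NS ε j * NS ε l * Fintype.card F ^ (j*l) := by
  rw [NS, ← card_sym_equiv ε True (finSumFinEquiv (m := j) (n := l))]
  have e : {M : Matrix (Fin j ⊕ Fin l) (Fin j ⊕ Fin l) F // Mᵀ = ε • M} ≃
    ({M : Matrix (Fin j) (Fin j) F // Mᵀ = ε • M} × {M : Matrix (Fin l) (Fin l) F // Mᵀ = ε • M}) × Matrix (Fin j) (Fin l) F :=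
    { toFun := fun M => ((⟨_, ((sym_blocks hε M.1).1 M.2).1⟩, ⟨_, ((sym_blocks hε M.1).1 M.2).2.1⟩), M.1.toBlocks₁₂)
      invFun := fun p => ⟨fromBlocks p.1.1.1 p.2 (ε • p.2ᵀ) p.1.2.1, by
        rw [sym_blocks hε]; simp [p.1.1.2, p.1.2.2]⟩
      left_inv := by
        rintro ⟨M, hM⟩
        apply Subtype.ext
        simp only
        rw [← ((sym_blocks hε M).1 hM).2.2, fromBlocks_toBlocks]
      right_inv := by
        rintro ⟨⟨⟨a, ha⟩, ⟨b, hb⟩⟩, c⟩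
        simp }
  rw [Nat.card_congr e, Nat.card_prod, Nat.card_prod, card_mat]
  simp [NS]

end FF

open Matrix
set_option linter.all false

namespace FF
variable {F : Type} [Field F] [Fintype F]

section lem2
variable {n m κ κ' : Type} [Fintype n] [DecidableEq n] [Fintype m] [DecidableEq m] [Fintype κ] [DecidableEq κ] [Fintype κ'] [DecidableEq κ']

noncomputable def cnt2 (ε : F) (κ : Type) [Fintype κ] [DecidableEq κ] (Θ : Matrix n n F) : ℕ :=
  Nat.card {P : Matrix n κ F × Matrix κ κ F // P.2ᵀ = ε • P.2 ∧ IsUnit (fromBlocks Θ P.1 (ε • P.1ᵀ) P.2)}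

theorem cnt2_reindex (ε : F) (Θ : Matrix n n F) (e : n ≃ m) (f : κ ≃ κ') :
    cnt2 ε κ Θ = cnt2 ε κ' (Matrix.reindex e e Θ) := by
  refine Nat.card_congr (Equiv.subtypeEquiv ((Matrix.reindex e f).prodCongr (Matrix.reindex f f)) ?_)
  rintro ⟨x, z⟩
  simp only [Equiv.prodCongr_apply, Prod.map]
  refine and_congr ?_ ?_
  · rw [transpose_reindex, ← (Matrix.reindex f f).injective.eq_iff]
    rfl
  · rw [← Matrix.isUnit_submatrix_equiv (Equiv.sumCongr e.symm f.symm) (Equiv.sumCongr e.symm f.symm)]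
    apply iff_of_eq; congr 1
    ext (i|i) (j|j) <;> simp

theorem cnt2_congr (ε : F) (Θ : Matrix n n F) (g : GL n F) :
    cnt2 ε κ ((g : Matrix n n F)ᵀ * Θ * (g : Matrix n n F)) = cnt2 ε κ Θ := by
  symm
  have hgt : IsUnit ((g : Matrix n n F)ᵀ) := by rw [Matrix.isUnit_transpose]; exact g.isUnit
  let e1 : Matrix n κ F ≃ Matrix n κ F :=
    { toFun := fun x => (g : Matrix n n F)ᵀ * x
      invFun := fun x => ((g⁻¹ : GL n F) : Matrix n n F)ᵀ * x
      left_inv := fun x => by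
        simp only; rw [← Matrix.mul_assoc, ← transpose_mul, ← Units.val_mul]; simp
      right_inv := fun x => by
        simp only; rw [← Matrix.mul_assoc, ← transpose_mul, ← Units.val_mul]; simp }
  refine Nat.card_congr (Equiv.subtypeEquiv (e1.prodCongr (Equiv.refl _)) ?_)
  rintro ⟨x, z⟩
  simp only [Equiv.prodCongr_apply, Prod.map, Equiv.refl_apply]
  refine and_congr Iff.rfl ?_
  have hD : IsUnit (fromBlocks (g : Matrix n n F) 0 0 (1 : Matrix κ κ F)) :=
    isUnit_fromBlocks_zero₁₂.2 ⟨g.isUnit, isUnit_one⟩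
  have hDt : IsUnit (fromBlocks (g : Matrix n n F)ᵀ 0 0 (1 : Matrix κ κ F)) :=
    isUnit_fromBlocks_zero₁₂.2 ⟨hgt, isUnit_one⟩
  have : fromBlocks ((g : Matrix n n F)ᵀ * Θ * (g : Matrix n n F)) (e1 x) (ε • (e1 x)ᵀ) z =
     fromBlocks (g : Matrix n n F)ᵀ 0 0 (1 : Matrix κ κ F) * fromBlocks Θ x (ε • xᵀ) z * fromBlocks (g : Matrix n n F) 0 0 (1 : Matrix κ κ F) := by
    simp [fromBlocks_multiply, e1, transpose_mul]
  rw [this]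
  constructor
  · intro h; exact (hDt.mul h).mul hD
  · intro h
    obtain ⟨u, hu⟩ := hD
    obtain ⟨v, hv⟩ := hDt
    rw [← hu, ← hv, Units.isUnit_mul_units, Units.isUnit_units_mul] at h
    exact h

theorem inj_isUnit {M : Matrix n n F} (h : Function.Injective M.mulVec) : IsUnit M := Matrix.mulVec_injective_iff_isUnit.1 h

/-- normal form under congruence -/
theorem exists_congr_nf {ε : F} (hε : ε * ε = 1) {p j : ℕ} (Θ : Matrix (Fin p ⊕ Fin j) (Fin p ⊕ Fin j) F)
    (hs : Θᵀ = ε • Θ) (h : Θ.rank = p) : ∃ (g : GL (Fin p ⊕ Fin j) F) (t : Matrix (Fin p) (Fin p) F),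
      IsUnit t ∧ tᵀ = ε • t ∧ (g : Matrix (Fin p ⊕ Fin j) (Fin p ⊕ Fin j) F)ᵀ * Θ * (g : Matrix (Fin p ⊕ Fin j) (Fin p ⊕ Fin j) F) = fromBlocks t 0 0 0 := by
  obtain ⟨g, Y, hg, hY⟩ := exists_adapt Θ h
  set G := (g : Matrix (Fin p ⊕ Fin j) (Fin p ⊕ Fin j) F) with hG
  set N := Gᵀ * Θ * G with hN
  have hNs : Nᵀ = ε • N := by
    simp [hN, transpose_mul, hs, Matrix.mul_assoc]
  have h1 : N = fromCols (Gᵀ * Y) 0 := by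
    rw [hN, Matrix.mul_assoc, hg, mul_fromCols]; simp
  have h12 : N.toBlocks₁₂ = 0 := by rw [h1]; ext; simp [toBlocks₁₂]
  have h22 : N.toBlocks₂₂ = 0 := by rw [h1]; ext; simp [toBlocks₂₂]
  obtain ⟨ha, hb, hc⟩ := (sym_blocks hε N).1 hNs
  have h21 : N.toBlocks₂₁ = 0 := by rw [hc, h12]; simp
  have hfin : N = fromBlocks N.toBlocks₁₁ 0 0 0 := by
    conv_lhs => rw [← fromBlocks_toBlocks N, h12, h21, h22]
  refine ⟨g, N.toBlocks₁₁, ?_, ha, hfin⟩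
  apply inj_isUnit
  have hr : N.rank = p := by
    have hgd := (Matrix.isUnit_iff_isUnit_det _).1 g.isUnit
    rw [hN, rank_mul_eq_left_of_isUnit_det _ _ hgd, rank_mul_eq_right_of_isUnit_det _ _ (by rw [det_transpose]; exact hgd), h]
  have h3 : N = fromRows (1 : Matrix (Fin p) (Fin p) F) (0 : Matrix (Fin j) (Fin p) F) * fromCols N.toBlocks₁₁ (0 : Matrix (Fin p) (Fin j) F) := by
    rw [fromRows_mul_fromCols]; simpa using hfin
  apply inj_of_rank_fromCols (k := j)
  apply le_antisymm
  · exact (rank_le_card_height _).trans (by simp)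
  · calc p = _ := hr.symm
      _ ≤ _ := by conv_lhs => rw [h3]
                  exact rank_mul_le_right _ _

theorem cnt2_diag {ε : F} (hε : ε * ε = 1) {p j : ℕ} (t : Matrix (Fin p) (Fin p) F) (ht : IsUnit t) (hts : tᵀ = ε • t) :
    cnt2 ε κ (fromBlocks t 0 0 (0 : Matrix (Fin j) (Fin j) F)) =
      Fintype.card F ^ (p * Fintype.card κ) * cnt2 ε κ (0 : Matrix (Fin j) (Fin j) F) := by
  have htd := (Matrix.isUnit_iff_isUnit_det _).1 ht
  let _i := Matrix.invertibleOfIsUnitDet t htd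
  have htis : (t⁻¹)ᵀ = ε • t⁻¹ := by
    rw [transpose_nonsing_inv, hts]
    apply inv_eq_right_inv
    rw [smul_mul_smul_comm, hε, one_smul, mul_nonsing_inv _ htd]
  have h0 : ∀ x : Matrix (Fin p) κ F, (ε • (xᵀ * t⁻¹ * x))ᵀ = ε • (ε • (xᵀ * t⁻¹ * x)) := by
    intro x; simp [transpose_mul, htis, Matrix.mul_assoc]
  let e : (Matrix (Fin p ⊕ Fin j) κ F × Matrix κ κ F) ≃ Matrix (Fin p) κ F × (Matrix (Fin j) κ F × Matrix κ κ F) :=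
    { toFun := fun P => (P.1.toRows₁, (P.1.toRows₂, P.2 - ε • (P.1.toRows₁ᵀ * t⁻¹ * P.1.toRows₁)))
      invFun := fun P => (fromRows P.1 P.2.1, P.2.2 + ε • (P.1ᵀ * t⁻¹ * P.1))
      left_inv := by rintro ⟨x, z⟩; simp
      right_inv := by rintro ⟨x, y, z⟩; simp }
  let X : Type := {P : Matrix (Fin p) κ F × (Matrix (Fin j) κ F × Matrix κ κ F) // P.2.2ᵀ = ε • P.2.2 ∧ IsUnit (fromBlocks (0 : Matrix (Fin j) (Fin j) F) P.2.1 (ε • P.2.1ᵀ) P.2.2)}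
  have e2 : X ≃ Matrix (Fin p) κ F × {P : Matrix (Fin j) κ F × Matrix κ κ F // P.2ᵀ = ε • P.2 ∧ IsUnit (fromBlocks (0 : Matrix (Fin j) (Fin j) F) P.1 (ε • P.1ᵀ) P.2)} :=
    { toFun := fun s => (s.1.1, ⟨s.1.2, s.2⟩)
      invFun := fun p => ⟨(p.1, p.2.1), p.2.2⟩
      left_inv := by rintro ⟨⟨x, g⟩, hg⟩; simp
      right_inv := by rintro ⟨g, y, hy⟩; simp }
  have h3 : cnt2 ε κ (fromBlocks t 0 0 (0 : Matrix (Fin j) (Fin j) F)) = Nat.card X := by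
    refine Nat.card_congr (Equiv.subtypeEquiv e ?_)
    rintro ⟨w, z⟩
    simp only [e, Equiv.coe_fn_mk]
    refine and_congr ?_ ?_
    · rw [transpose_sub, smul_sub, h0]; simp
    · obtain ⟨x, y, rfl⟩ : ∃ x y, w = fromRows x y := ⟨_, _, (fromRows_toRows w).symm⟩
      simp only [toRows₁_fromRows, toRows₂_fromRows]
      rw [← Matrix.isUnit_submatrix_equiv (Equiv.sumAssoc (Fin p) (Fin j) κ).symm]
      have : (fromBlocks (fromBlocks t 0 0 (0 : Matrix (Fin j) (Fin j) F)) (fromRows x y) (ε • (fromRows x y)ᵀ) z).submatrix (Equiv.sumAssoc (Fin p) (Fin j) κ).symm (Equiv.sumAssoc (Fin p) (Fin j) κ).symm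
        = fromBlocks t (fromCols 0 x) (fromRows 0 (ε • xᵀ)) (fromBlocks 0 y (ε • yᵀ) z) := by
        ext (i|i|i) (k|k|k) <;> simp
      rw [this, isUnit_fromBlocks_iff_of_invertible₁₁]
      apply iff_of_eq; congr 1
      rw [fromRows_mul, fromRows_mul_fromCols, invOf_eq_nonsing_inv, sub_eq_add_neg, fromBlocks_neg, fromBlocks_add]
      simp [sub_eq_add_neg]
  rw [h3, Nat.card_congr e2, Nat.card_prod, card_mat]
  simp [cnt2]

end lem2
end FF

open Matrix
set_option linter.all false

namespace FF
variable {F : Type} [Field F] [Fintype F]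

section lem2
variable {κ : Type} [Fintype κ] [DecidableEq κ]

theorem congr_sym {m n : Type} [Fintype m] {ε : F} {z : Matrix m m F} (h : zᵀ = ε • z) (A : Matrix m n F) :
    (Aᵀ * z * A)ᵀ = ε • (Aᵀ * z * A) := by
  simp [transpose_mul, h, Matrix.mul_assoc]

theorem zero_rank {ε : F} {j : ℕ} (y : Matrix (Fin j) κ F) (z : Matrix κ κ F)
    (h : IsUnit (fromBlocks (0 : Matrix (Fin j) (Fin j) F) y (ε • yᵀ) z)) : y.rank = j := by
  have h1 := Matrix.mulVec_injective_iff_isUnit.2 h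
  have h2 : Function.Injective yᵀ.mulVec := by
    intro v w hvw
    have : fromBlocks (0 : Matrix (Fin j) (Fin j) F) y (ε • yᵀ) z *ᵥ (Sum.elim v 0) = fromBlocks (0 : Matrix (Fin j) (Fin j) F) y (ε • yᵀ) z *ᵥ (Sum.elim w 0) := by
      have hvw' : yᵀ *ᵥ v = yᵀ *ᵥ w := hvw
      rw [fromBlocks_mulVec, fromBlocks_mulVec]
      simp [smul_mulVec, hvw']
    have := h1 this
    funext i
    exact congrFun this (Sum.inl i)
  rw [← rank_transpose, Matrix.rank]
  have h3 := LinearMap.finrank_range_of_inj (f := yᵀ.mulVecLin) h2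
  rw [h3]; simp

theorem cnt2_zero_lt {ε : F} {j k : ℕ} (h : k < j) : cnt2 ε (Fin k) (0 : Matrix (Fin j) (Fin j) F) = 0 := by
  rw [cnt2, Nat.card_eq_zero]
  left
  refine ⟨fun ⟨⟨y, z⟩, _, h2⟩ => ?_⟩
  have h3 : y.rank = j := zero_rank _ _ h2
  have := rank_le_card_width y
  simp at this; omega

theorem exists_cols {j l : ℕ} (y : Matrix (Fin j) (Fin j ⊕ Fin l) F) (h : y.rank = j) :
    ∃ g : GL (Fin j ⊕ Fin l) F, y * (g : Matrix (Fin j ⊕ Fin l) (Fin j ⊕ Fin l) F) = fromCols 1 0 := by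
  obtain ⟨g, Y, hg, hY⟩ := exists_adapt y h
  have hu := inj_isUnit hY
  have hd := (Matrix.isUnit_iff_isUnit_det _).1 hu
  have hui : IsUnit (Y⁻¹) := Matrix.isUnit_nonsing_inv_iff.2 hu
  have hb : IsUnit (fromBlocks Y⁻¹ 0 0 (1 : Matrix (Fin l) (Fin l) F)) := isUnit_fromBlocks_zero₁₂.2 ⟨hui, isUnit_one⟩
  obtain ⟨b, hb⟩ := hb
  refine ⟨g * b, ?_⟩
  rw [Units.val_mul, ← Matrix.mul_assoc, hg, hb, fromCols_mul_fromBlocks]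
  simp [mul_nonsing_inv _ hd]

theorem isUnit_zero_id {ε : F} (hε : ε * ε = 1) {j l : ℕ} (z : Matrix (Fin j ⊕ Fin l) (Fin j ⊕ Fin l) F) :
    IsUnit (fromBlocks (0 : Matrix (Fin j) (Fin j) F) (fromCols 1 0) (ε • (fromCols 1 (0 : Matrix (Fin j) (Fin l) F))ᵀ) z) ↔ IsUnit z.toBlocks₂₂ := by
  rw [← Matrix.isUnit_submatrix_equiv (Equiv.sumAssoc (Fin j) (Fin j) (Fin l)) (Equiv.sumAssoc (Fin j) (Fin j) (Fin l))]
  have : (fromBlocks (0 : Matrix (Fin j) (Fin j) F) (fromCols 1 0) (ε • (fromCols 1 (0 : Matrix (Fin j) (Fin l) F))ᵀ) z).submatrix (Equiv.sumAssoc (Fin j) (Fin j) (Fin l)) (Equiv.sumAssoc (Fin j) (Fin j) (Fin l)) = 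
    fromBlocks (fromBlocks 0 1 (ε • 1) z.toBlocks₁₁) (fromRows 0 z.toBlocks₁₂) (fromCols 0 z.toBlocks₂₁) z.toBlocks₂₂ := by
    ext ((i|i)|i) ((k|k)|k) <;> simp [toBlocks₁₁, toBlocks₁₂, toBlocks₂₁, toBlocks₂₂, Matrix.one_apply, eq_comm]
  rw [this]
  let A : Matrix (Fin j ⊕ Fin j) (Fin j ⊕ Fin j) F := fromBlocks 0 1 (ε • 1) z.toBlocks₁₁
  let B : Matrix (Fin j ⊕ Fin j) (Fin j ⊕ Fin j) F := fromBlocks (-ε • z.toBlocks₁₁) (ε • 1) 1 0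
  have hAB : A * B = 1 := by
    simp only [A, B, fromBlocks_multiply]
    simp [smul_smul, hε]
  have hBA : B * A = 1 := mul_eq_one_comm.1 hAB
  let _i : Invertible A := ⟨B, hBA, hAB⟩
  have hinv : ⅟A = B := rfl
  change IsUnit (fromBlocks A _ _ _) ↔ _
  rw [isUnit_fromBlocks_iff_of_invertible₁₁, hinv]
  simp only [B, fromCols_mul_fromBlocks, fromCols_mul_fromRows]
  simp

theorem cnt2_zero_add {ε : F} (hε : ε * ε = 1) (j l : ℕ) :
    cnt2 ε (Fin (j+l)) (0 : Matrix (Fin j) (Fin j) F) * gl F l = gl F (j+l) * NS ε j * NSn ε l := by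
  rw [cnt2_reindex ε _ (Equiv.refl (Fin j)) (finSumFinEquiv (m := j) (n := l)).symm]
  have hz : (Matrix.reindex (Equiv.refl (Fin j)) (Equiv.refl (Fin j))) (0 : Matrix (Fin j) (Fin j) F) = 0 := by ext; simp
  rw [hz]
  let X : Type := {P : Matrix (Fin j) (Fin j ⊕ Fin l) F × Matrix (Fin j ⊕ Fin l) (Fin j ⊕ Fin l) F // P.2ᵀ = ε • P.2 ∧ IsUnit (fromBlocks (0 : Matrix (Fin j) (Fin j) F) P.1 (ε • P.1ᵀ) P.2)}
  let G := GL (Fin j ⊕ Fin l) F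
  let M := Matrix (Fin j ⊕ Fin l) (Fin j ⊕ Fin l) F
  have hX : cnt2 ε (Fin j ⊕ Fin l) (0 : Matrix (Fin j) (Fin j) F) = Nat.card X := rfl
  have hact : ∀ (g : G) (P : Matrix (Fin j) (Fin j ⊕ Fin l) F × M), (P.2ᵀ = ε • P.2 ∧ IsUnit (fromBlocks (0 : Matrix (Fin j) (Fin j) F) P.1 (ε • P.1ᵀ) P.2)) → 
      ((g : M)ᵀ * P.2 * (g : M))ᵀ = ε • ((g : M)ᵀ * P.2 * (g : M)) ∧ IsUnit (fromBlocks (0 : Matrix (Fin j) (Fin j) F) (P.1 * (g : M)) (ε • (P.1 * (g : M))ᵀ) ((g : M)ᵀ * P.2 * (g : M))) := by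
    rintro g ⟨y, z⟩ ⟨h1, h2⟩
    simp only at h1 h2 ⊢
    refine ⟨congr_sym h1 _, ?_⟩
    have hgt : IsUnit ((g : M)ᵀ) := by rw [Matrix.isUnit_transpose]; exact g.isUnit
    have hD : IsUnit (fromBlocks (1 : Matrix (Fin j) (Fin j) F) 0 0 (g : M)) :=
      isUnit_fromBlocks_zero₁₂.2 ⟨isUnit_one, g.isUnit⟩
    have hDt : IsUnit (fromBlocks (1 : Matrix (Fin j) (Fin j) F) 0 0 (g : M)ᵀ) :=
      isUnit_fromBlocks_zero₁₂.2 ⟨isUnit_one, hgt⟩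
    have h3 := (hDt.mul h2).mul hD
    simpa [fromBlocks_multiply, transpose_mul] using h3
  have hgi : ∀ g : G, (g : M) * ((g⁻¹ : G) : M) = 1 := fun g => by rw [← Units.val_mul]; simp
  have hig : ∀ g : G, ((g⁻¹ : G) : M) * (g : M) = 1 := fun g => by rw [← Units.val_mul]; simp
  have hgit : ∀ g : G, ((g⁻¹ : G) : M)ᵀ * (g : M)ᵀ = 1 := fun g => by rw [← transpose_mul, hgi]; simp
  have higt : ∀ g : G, (g : M)ᵀ * ((g⁻¹ : G) : M)ᵀ = 1 := fun g => by rw [← transpose_mul, hig]; simp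
  let act : G → X ≃ X := fun g =>
    { toFun := fun P => ⟨(P.1.1 * (g : M), (g : M)ᵀ * P.1.2 * (g : M)), hact g P.1 P.2⟩
      invFun := fun P => ⟨(P.1.1 * ((g⁻¹ : G) : M), ((g⁻¹ : G) : M)ᵀ * P.1.2 * ((g⁻¹ : G) : M)), hact g⁻¹ P.1 P.2⟩
      left_inv := by
        rintro ⟨⟨y, z⟩, h⟩
        refine Subtype.ext (Prod.ext ?_ ?_)
        · simp only [Matrix.mul_assoc, hgi, Matrix.mul_one]
        · simp only [Matrix.mul_assoc, hgi, Matrix.mul_one]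
          rw [← Matrix.mul_assoc, hgit, Matrix.one_mul]
      right_inv := by
        rintro ⟨⟨y, z⟩, h⟩
        refine Subtype.ext (Prod.ext ?_ ?_)
        · simp only [Matrix.mul_assoc, hig, Matrix.mul_one]
        · simp only [Matrix.mul_assoc, hig, Matrix.mul_one]
          rw [← Matrix.mul_assoc, higt, Matrix.one_mul] }
  have key := card_avg act (fun P => P.1.1 = fromCols 1 0) (gl F l * Fintype.card F ^ (j*l)) (by
    rintro ⟨⟨y, z⟩, h1, h2⟩
    obtain ⟨g, hg⟩ := exists_cols y (zero_rank y z h2)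
    rw [← card_stab]
    refine Nat.card_congr (Equiv.subtypeEquiv (Equiv.mulLeft g⁻¹) ?_)
    intro a
    simp only [act, Equiv.coe_fn_mk, Equiv.coe_mulLeft]
    rw [← hg, Matrix.mul_assoc, ← Units.val_mul, mul_inv_cancel_left])
  let Y : Type := {P : X // P.1.1 = fromCols 1 0}
  have e : Y ≃ {z : M // zᵀ = ε • z ∧ IsUnit z.toBlocks₂₂} :=
    { toFun := fun P => ⟨P.1.1.2, P.1.2.1, by
        have := P.1.2.2
        rw [P.2] at this
        exact (isUnit_zero_id hε _).1 this⟩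
      invFun := fun z => ⟨⟨(fromCols 1 0, z.1), z.2.1, (isUnit_zero_id hε _).2 z.2.2⟩, rfl⟩
      left_inv := by
        rintro ⟨⟨⟨y, z⟩, h⟩, h2⟩
        simp only at h2
        subst h2
        rfl
      right_inv := by
        rintro ⟨z, hz⟩; rfl }
  have e2 : {z : M // zᵀ = ε • z ∧ IsUnit z.toBlocks₂₂} ≃ ({M : Matrix (Fin j) (Fin j) F // Mᵀ = ε • M} × {M : Matrix (Fin l) (Fin l) F // Mᵀ = ε • M ∧ IsUnit M}) × Matrix (Fin j) (Fin l) F :=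
    { toFun := fun M => ((⟨_, ((sym_blocks hε M.1).1 M.2.1).1⟩, ⟨_, ((sym_blocks hε M.1).1 M.2.1).2.1, M.2.2⟩), M.1.toBlocks₁₂)
      invFun := fun p => ⟨fromBlocks p.1.1.1 p.2 (ε • p.2ᵀ) p.1.2.1, by
        rw [sym_blocks hε]; simp [p.1.1.2, p.1.2.2]⟩
      left_inv := by
        rintro ⟨M, hM⟩
        apply Subtype.ext
        simp only
        rw [← ((sym_blocks hε M).1 hM.1).2.2, fromBlocks_toBlocks]
      right_inv := by
        rintro ⟨⟨⟨a, ha⟩, ⟨b, hb⟩⟩, c⟩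
        simp }
  change _ = _ * Nat.card Y at key
  rw [Nat.card_congr e, Nat.card_congr e2, Nat.card_prod, Nat.card_prod, card_mat, card_gl_sum, ← hX] at key
  simp only [Fintype.card_fin] at key
  have hq : 0 < Fintype.card F ^ (j*l) := pow_pos Fintype.card_pos _
  apply Nat.eq_of_mul_eq_mul_right hq
  rw [mul_assoc, key]
  simp only [NS, NSn]
  ring

/-- Lemma 2 -/
theorem cnt2_rank {ε : F} (hε : ε * ε = 1) {p j k : ℕ} (Θ : Matrix (Fin (p+j)) (Fin (p+j)) F) (hs : Θᵀ = ε • Θ) (h : Θ.rank = p) :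
    cnt2 ε (Fin k) Θ = Fintype.card F ^ (p * k) * cnt2 ε (Fin k) (0 : Matrix (Fin j) (Fin j) F) := by
  rw [cnt2_reindex ε Θ (finSumFinEquiv (m := p) (n := j)).symm (Equiv.refl (Fin k))]
  set Θ' := (Matrix.reindex (finSumFinEquiv (m := p) (n := j)).symm (finSumFinEquiv (m := p) (n := j)).symm) Θ with hΘ'
  have hs' : Θ'ᵀ = ε • Θ' := by rw [hΘ', transpose_reindex, hs]; rfl
  have h' : Θ'.rank = p := by rw [hΘ', rank_reindex, h]
  obtain ⟨g, t, ht, hts, hg⟩ := exists_congr_nf hε Θ' hs' h'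
  rw [← cnt2_congr ε Θ' g, hg, cnt2_diag hε t ht hts, Fintype.card_fin]

end lem2
end FF

open Matrix
set_option linter.all false

namespace FF
variable {F : Type} [Field F] [Fintype F]

section lem3
variable {n κ : Type} [Fintype n] [DecidableEq n] [Fintype κ] [DecidableEq κ]

theorem fromRows_smul' {a b c : Type} (s : F) (A : Matrix a c F) (B : Matrix b c F) : s • fromRows A B = fromRows (s • A) (s • B) := by
  ext (i|i) j <;> simp

theorem nilp_comm {A B : Matrix n n F} (h : IsNilpotent (A * B)) : IsNilpotent (B * A) := by
  obtain ⟨k, hk⟩ := h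
  refine ⟨k+1, ?_⟩
  have : ∀ k, (B * A)^(k+1) = B * (A * B)^k * A := by
    intro k
    induction k with
    | zero => simp
    | succ k ih => rw [pow_succ, ih, pow_succ]; simp only [mul_assoc]
  rw [this, hk]; simp

theorem nilp_blocks (A : Matrix n n F) (C : Matrix κ n F) : IsNilpotent (fromBlocks A 0 C (0 : Matrix κ κ F)) ↔ IsNilpotent A := by
  have : ∀ k, (fromBlocks A 0 C (0 : Matrix κ κ F))^(k+1) = fromBlocks (A^(k+1)) 0 (C * A^k) 0 := by
    intro k
    induction k with
    | zero => simp
    | succ k ih => rw [pow_succ, ih, fromBlocks_multiply]; simp [pow_succ, Matrix.mul_assoc]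
  constructor
  · rintro ⟨k, hk⟩
    have h1 : (fromBlocks A 0 C (0 : Matrix κ κ F))^(k+1) = 0 := by rw [pow_succ, hk]; simp
    rw [this, ← fromBlocks_zero, fromBlocks_inj] at h1
    exact ⟨_, h1.1⟩
  · rintro ⟨k, hk⟩
    refine ⟨k+1, ?_⟩
    have h1 : (fromBlocks A 0 C (0 : Matrix κ κ F))^(k+1) * (fromBlocks A 0 C (0 : Matrix κ κ F))  = 0 := by
      rw [this, fromBlocks_multiply, pow_succ]; simp [hk]
    rw [this, pow_succ, hk]; simp

def isT (ε ε' η : F) (nil : Prop) (Θ α β : Matrix n n F) : Prop :=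
  Θᵀ = ε • Θ ∧ IsUnit Θ ∧ αᵀ = ε' • α ∧ βᵀ = η • β ∧ α * Θ * β = β * Θ * α ∧ (nil → IsNilpotent (Θ * α))

/-- the shape of `Θ β Θᵀ` -/
def Gam (ε : F) (a t b : Matrix n n F) (x : Matrix n κ F) (z : Matrix κ κ F) : Matrix (n ⊕ κ) (n ⊕ κ) F :=
  fromBlocks (ε • (b * a * t)) (ε • (b * a * x)) (xᵀ * a * b) z

theorem gam_ok {ε ε' η : F} (hε : ε * ε = 1) (hε' : ε' * ε' = 1) (hη : η * η = 1) (a t b : Matrix n n F) (x : Matrix n κ F) (w z : Matrix κ κ F)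
    (hat : aᵀ = ε' • a) (ht : tᵀ = ε • t) (hb : bᵀ = (ε * ε' * η) • b) (hc : t * a * b = b * a * t) (hz : zᵀ = η • z) :
    (Gam ε a t b x z)ᵀ = η • (Gam ε a t b x z) ∧ 
    (fromBlocks t x (ε • xᵀ) w) * (fromBlocks a 0 0 0) * (Gam ε a t b x z) = (Gam ε a t b x z) * (fromBlocks a 0 0 0) * (fromBlocks t x (ε • xᵀ) w) := by
  have h1 : ε' * (ε * ε' * η) = ε * η := by linear_combination (ε * η) * hε'
  constructor
  · rw [Gam, sym_blocks hη]
    simp only [toBlocks_fromBlocks₁₁, toBlocks_fromBlocks₁₂, toBlocks_fromBlocks₂₁, toBlocks_fromBlocks₂₂]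
    refine ⟨?_, hz, ?_⟩
    · simp only [transpose_smul, transpose_mul, ht, hat, hb, Matrix.smul_mul, Matrix.mul_smul, smul_smul, ← Matrix.mul_assoc, hc]
      congr 1; linear_combination ε^3*η*hε' + ε*η*hε
    · simp only [transpose_smul, transpose_mul, ht, hat, hb, Matrix.smul_mul, Matrix.mul_smul, smul_smul, ← Matrix.mul_assoc]
      have : η * (ε * (ε * ε' * η * ε')) = 1 := by
        linear_combination (η * ε * ε * η) * hε' + η * η * hε + hη
      rw [this, one_smul]
  · simp only [Gam, fromBlocks_multiply]
    simp only [Matrix.mul_zero, Matrix.zero_mul, add_zero, zero_add, fromBlocks_inj]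
    simp only [Matrix.smul_mul, Matrix.mul_smul, ← Matrix.mul_assoc, hc]
    simp [smul_smul, hε]

theorem gam_ex {ε ε' η : F} (hε : ε * ε = 1) (hε' : ε' * ε' = 1) (hη : η * η = 1) (a t : Matrix n n F) (x : Matrix n κ F) (w : Matrix κ κ F)
    (hat : aᵀ = ε' • a) (ha : IsUnit a) (ht : tᵀ = ε • t) (hu : IsUnit (fromBlocks t x (ε • xᵀ) w)) (γ : Matrix (n ⊕ κ) (n ⊕ κ) F) (hγ : γᵀ = η • γ)
    (hcom : (fromBlocks t x (ε • xᵀ) w) * (fromBlocks a 0 0 0) * γ = γ * (fromBlocks a 0 0 0) * (fromBlocks t x (ε • xᵀ) w)) :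
    ∃ b z, bᵀ = (ε * ε' * η) • b ∧ t * a * b = b * a * t ∧ zᵀ = η • z ∧ γ = Gam ε a t b x z := by
  have had := (Matrix.isUnit_iff_isUnit_det _).1 ha
  have hud := (Matrix.isUnit_iff_isUnit_det _).1 hu
  set Θi := (fromBlocks t x (ε • xᵀ) w)⁻¹ with hΘi
  have h1 : fromBlocks t x (ε • xᵀ) w * Θi = 1 := mul_nonsing_inv _ hud
  have h2 : Θi * fromBlocks t x (ε • xᵀ) w = 1 := nonsing_inv_mul _ hud
  -- C, Θr, L, R
  have hL : fromCols Θi.toBlocks₁₁ Θi.toBlocks₁₂ * fromRows t (ε • xᵀ) = 1 := by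
    rw [← fromBlocks_toBlocks Θi, fromBlocks_multiply, ← fromBlocks_one, fromBlocks_inj] at h2
    rw [fromCols_mul_fromRows]; exact h2.1
  have hR : fromCols t x * fromRows Θi.toBlocks₁₁ Θi.toBlocks₂₁ = 1 := by
    rw [← fromBlocks_toBlocks Θi, fromBlocks_multiply, ← fromBlocks_one, fromBlocks_inj] at h1
    rw [fromCols_mul_fromRows]; exact h1.1
  obtain ⟨s11, s22, s21⟩ := (sym_blocks hη γ).1 hγ
  set C := fromRows t (ε • xᵀ) with hC
  set Θr := fromCols t x with hΘr
  set L := fromCols Θi.toBlocks₁₁ Θi.toBlocks₁₂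
  set R := fromRows Θi.toBlocks₁₁ Θi.toBlocks₂₁
  set γr := fromCols γ.toBlocks₁₁ γ.toBlocks₁₂ with hγr
  set γc := fromRows γ.toBlocks₁₁ γ.toBlocks₂₁ with hγc
  have hcom' : C * (a * γr) = γc * (a * Θr) := by
    rw [← fromBlocks_toBlocks γ] at hcom
    simp only [fromBlocks_multiply, Matrix.mul_zero, Matrix.zero_mul, add_zero, zero_add] at hcom
    rw [hC, hγr, hγc, hΘr, mul_fromCols a, mul_fromCols a, fromRows_mul_fromCols, fromRows_mul_fromCols]
    simpa only [Matrix.mul_assoc] using hcom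
  have hCt : Θrᵀ = ε • C := by
    rw [hΘr, hC, transpose_fromCols, fromRows_smul', ht, smul_smul, hε, one_smul]
  have hγt : γrᵀ = η • γc := by
    rw [hγr, hγc, transpose_fromCols, fromRows_smul', s11, s21, smul_smul, hη, one_smul]
  set b := ε • (a⁻¹ * (L * γc)) with hb
  have e1 : a * γr = L * γc * (a * Θr) := by
    calc a * γr = (L * C) * (a * γr) := by rw [hL, Matrix.one_mul]
      _ = _ := by rw [Matrix.mul_assoc, hcom', Matrix.mul_assoc]
  have e2 : γr = ε • (b * a * Θr) := by
    calc γr = a⁻¹ * (a * γr) := by rw [← Matrix.mul_assoc, nonsing_inv_mul _ had, Matrix.one_mul]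
      _ = _ := by rw [e1, hb]; simp only [Matrix.smul_mul, smul_smul, hε, one_smul, Matrix.mul_assoc]
  have e3 : γc = (η * ε') • (C * a * bᵀ) := by
    have : γrᵀ = _ := congrArg transpose e2
    rw [hγt] at this
    have h3 : γc = η • (η • γc) := by rw [smul_smul, hη, one_smul]
    rw [h3, this]
    simp only [transpose_smul, transpose_mul, hCt, hat, Matrix.smul_mul, Matrix.mul_smul, smul_smul, Matrix.mul_assoc]
    congr 1; linear_combination η * ε' * hε
  have e4 : bᵀ = (ε * ε' * η) • b := by
    rw [e2, e3] at hcom'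
    have h4 := congrArg (fun Z => a⁻¹ * (L * Z * R) * a⁻¹) hcom'
    simp only [Matrix.smul_mul, Matrix.mul_smul] at h4
    have h5 : a⁻¹ * (L * (C * (a * (b * a * Θr))) * R) * a⁻¹ = b := by
      calc _ = a⁻¹ * ((L * C) * a * b * a * (Θr * R)) * a⁻¹ := by simp only [Matrix.mul_assoc]
        _ = (a⁻¹ * a) * b * (a * a⁻¹) := by rw [hL, hR]; simp only [Matrix.mul_assoc, Matrix.one_mul, Matrix.mul_one]
        _ = b := by rw [nonsing_inv_mul _ had, mul_nonsing_inv _ had]; simp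
    have h6 : a⁻¹ * (L * ((C * a * bᵀ) * (a * Θr)) * R) * a⁻¹ = bᵀ := by
      calc _ = a⁻¹ * ((L * C) * a * bᵀ * a * (Θr * R)) * a⁻¹ := by simp only [Matrix.mul_assoc]
        _ = (a⁻¹ * a) * bᵀ * (a * a⁻¹) := by rw [hL, hR]; simp only [Matrix.mul_assoc, Matrix.one_mul, Matrix.mul_one]
        _ = bᵀ := by rw [nonsing_inv_mul _ had, mul_nonsing_inv _ had]; simp
    rw [h5, h6] at h4
    rw [mul_assoc, mul_comm, mul_smul, h4, smul_smul]
    have : ε' * η * (η * ε') = 1 := by linear_combination ε' * ε' * hη + hε'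
    rw [this, one_smul]
  have f1 : γ.toBlocks₁₁ = ε • (b * a * t) ∧ γ.toBlocks₁₂ = ε • (b * a * x) := by
    rw [hγr, hΘr, mul_fromCols] at e2
    have h5 := congrArg toCols₁ e2
    have h6 := congrArg toCols₂ e2
    simp only [toCols₁_fromCols, toCols₂_fromCols] at h5 h6
    exact ⟨h5, h6⟩
  have hsc : η * ε' * (ε * ε' * η) = ε := by linear_combination ε * η * η * hε' + ε * hη
  have f2 : γ.toBlocks₁₁ = ε • (t * a * b) ∧ γ.toBlocks₂₁ = xᵀ * a * b := by
    rw [hγc, hC, fromRows_mul, fromRows_mul, e4] at e3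
    have h5 := congrArg toRows₁ e3
    have h6 := congrArg toRows₂ e3
    simp only [toRows₁_fromRows, toRows₂_fromRows, fromRows_smul'] at h5 h6
    rw [h5, h6]
    simp only [Matrix.smul_mul, Matrix.mul_smul, smul_smul]
    rw [← mul_assoc (η * ε') _ ε, hsc, hε, one_smul]
    exact ⟨rfl, rfl⟩
  refine ⟨b, γ.toBlocks₂₂, e4, ?_, s22, ?_⟩
  · have := f2.1.symm.trans f1.1
    have := congrArg (fun Z => ε • Z) this
    simpa only [smul_smul, hε, one_smul] using this
  · conv_lhs => rw [← fromBlocks_toBlocks γ, f1.1, f1.2, f2.2]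
    rfl

theorem gam_inj {ε : F} (hε : ε * ε = 1) (a t : Matrix n n F) (x : Matrix n κ F) (w : Matrix κ κ F)
    (ha : IsUnit a) (hu : IsUnit (fromBlocks t x (ε • xᵀ) w)) {b b' : Matrix n n F} {z z' : Matrix κ κ F}
    (h : Gam ε a t b x z = Gam ε a t b' x z') : b = b' ∧ z = z' := by
  have had := (Matrix.isUnit_iff_isUnit_det _).1 ha
  have hud := (Matrix.isUnit_iff_isUnit_det _).1 hu
  set Θi := (fromBlocks t x (ε • xᵀ) w)⁻¹ with hΘi
  have h1 : fromBlocks t x (ε • xᵀ) w * Θi = 1 := mul_nonsing_inv _ hud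
  have hR : t * Θi.toBlocks₁₁ + x *  Θi.toBlocks₂₁ = 1 := by
    rw [← fromBlocks_toBlocks Θi, fromBlocks_multiply, ← fromBlocks_one, fromBlocks_inj] at h1
    exact h1.1
  simp only [Gam, fromBlocks_inj] at h
  obtain ⟨g1, g2, g3, g4⟩ := h
  have key : ∀ b : Matrix n n F, b = (ε • ((ε • (b * a * t)) * Θi.toBlocks₁₁ + (ε • (b * a * x)) * Θi.toBlocks₂₁)) * a⁻¹ := by
    intro b
    rw [Matrix.smul_mul (M := b * a * t), Matrix.smul_mul (M := b * a * x), ← smul_add, smul_smul, hε, one_smul, Matrix.mul_assoc, Matrix.mul_assoc (b*a), ← Matrix.mul_add, hR, Matrix.mul_one,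
      Matrix.mul_assoc, mul_nonsing_inv _ had, Matrix.mul_one]
  refine ⟨?_, g4⟩
  rw [key b, key b', g1, g2]

end lem3
end FF

open Matrix
set_option linter.all false

namespace FF
variable {F : Type} [Field F] [Fintype F]

section rec
variable {n m κ : Type} [Fintype n] [DecidableEq n] [Fintype m] [DecidableEq m] [Fintype κ] [DecidableEq κ]

noncomputable def nT (ε ε' η : F) (nil : Prop) (n : Type) [Fintype n] [DecidableEq n] (k : ℕ) : ℕ :=
  Nat.card {P : Matrix n n F × Matrix n n F × Matrix n n F // isT ε ε' η nil P.1 P.2.1 P.2.2 ∧ P.2.1.rank + k = Fintype.card n}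

theorem isT_reindex (ε ε' η : F) (nil : Prop) (e : n ≃ m) (Θ α β : Matrix n n F) :
    isT ε ε' η nil Θ α β ↔ isT ε ε' η nil (Matrix.reindex e e Θ) (Matrix.reindex e e α) (Matrix.reindex e e β) := by
  have hm : ∀ A B : Matrix n n F, Matrix.reindex e e (A * B) = Matrix.reindex e e A * Matrix.reindex e e B := by
    intro A B; exact (Matrix.reindexAlgEquiv F F e).map_mul A B
  have hs : ∀ (s : F) (A : Matrix n n F), (Matrix.reindex e e A)ᵀ = s • Matrix.reindex e e A ↔ Aᵀ = s • A := by
    intro s A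
    rw [transpose_reindex, ← (Matrix.reindex e e).injective.eq_iff]; rfl
  simp only [isT, ← hm, hs]
  have hn : ∀ A : Matrix n n F, IsNilpotent (Matrix.reindex e e A) ↔ IsNilpotent A := by
    intro A
    exact IsNilpotent.map_iff (f := (Matrix.reindexAlgEquiv F F e)) (Matrix.reindexAlgEquiv F F e).injective
  have hu : IsUnit (Matrix.reindex e e Θ) ↔ IsUnit Θ := Matrix.isUnit_submatrix_equiv _ _
  rw [hn, hu, (Matrix.reindex e e).injective.eq_iff]

theorem nT_reindex (ε ε' η : F) (nil : Prop) (e : n ≃ m) (k : ℕ) : nT ε ε' η nil n k = nT ε ε' η nil m k := by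
  refine Nat.card_congr (Equiv.subtypeEquiv ((Matrix.reindex e e).prodCongr ((Matrix.reindex e e).prodCongr (Matrix.reindex e e))) ?_)
  rintro ⟨Θ, α, β⟩
  simp only [Equiv.prodCongr_apply, Prod.map]
  rw [isT_reindex ε ε' η nil e, rank_reindex, Fintype.card_congr e]

/-- the group action preserves `isT` -/
theorem isT_act {ε ε' η : F} {nil : Prop} (g : GL n F) {Θ α β : Matrix n n F} (h : isT ε ε' η nil Θ α β) :
    isT ε ε' η nil (((g⁻¹ : GL n F) : Matrix n n F) * Θ * ((g⁻¹ : GL n F) : Matrix n n F)ᵀ) ((g : Matrix n n F)ᵀ * α * (g : Matrix n n F)) ((g : Matrix n n F)ᵀ * β * (g : Matrix n n F)) := by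
  obtain ⟨h1, h2, h3, h4, h5, h6⟩ := h
  have hgi : (g : Matrix n n F) * ((g⁻¹ : GL n F) : Matrix n n F) = 1 := by rw [← Units.val_mul]; simp
  have hig : ((g⁻¹ : GL n F) : Matrix n n F) * (g : Matrix n n F) = 1 := by rw [← Units.val_mul]; simp
  set G := (g : Matrix n n F)
  set H := ((g⁻¹ : GL n F) : Matrix n n F) with hH
  have hHu : IsUnit H := (g⁻¹ : GL n F).isUnit
  have hgit : Hᵀ * Gᵀ = 1 := by rw [← transpose_mul, hgi]; simp
  have hc : ∀ A B : Matrix n n F, Gᵀ * A * G * (H * Θ * Hᵀ) * (Gᵀ * B * G) = Gᵀ * (A * Θ * B) * G := by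
    intro A B
    calc _ = Gᵀ * A * (G * H) * Θ * (Hᵀ * Gᵀ) * B * G := by simp only [Matrix.mul_assoc]
      _ = _ := by rw [hgi, hgit]; simp only [Matrix.mul_assoc, Matrix.mul_one, Matrix.one_mul]
  refine ⟨?_, ?_, congr_sym h3 _, congr_sym h4 _, ?_, ?_⟩
  · have := congr_sym h1 Hᵀ
    simpa using this
  · exact (hHu.mul h2).mul ((Matrix.isUnit_transpose _).2 hHu)
  · rw [hc, hc, h5]
  · intro hn
    have h7 : H * Θ * Hᵀ * (Gᵀ * α * G) = H * (Θ * α * G) := by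
      calc _ = H * Θ * (Hᵀ * Gᵀ) * α * G := by simp only [Matrix.mul_assoc]
        _ = _ := by rw [hgit]; simp only [Matrix.mul_assoc, Matrix.mul_one, Matrix.one_mul]
    rw [h7]
    apply nilp_comm
    rw [Matrix.mul_assoc, hgi, Matrix.mul_one]
    exact h6 hn

abbrev TT (ε ε' η : F) (nil : Prop) (n : Type) [Fintype n] [DecidableEq n] : Type :=
  {P : Matrix n n F × Matrix n n F × Matrix n n F // isT ε ε' η nil P.1 P.2.1 P.2.2}

abbrev TK (ε ε' η : F) (nil : Prop) (n : Type) [Fintype n] [DecidableEq n] (k : ℕ) : Type :=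
  {P : Matrix n n F × Matrix n n F × Matrix n n F // isT ε ε' η nil P.1 P.2.1 P.2.2 ∧ P.2.1.rank + k = Fintype.card n}

noncomputable def actT (ε ε' η : F) (nil : Prop) (k : ℕ) (g : GL n F) : TK ε ε' η nil n k ≃ TK ε ε' η nil n k :=
  have hgi : ∀ g : GL n F, (g : Matrix n n F) * ((g⁻¹ : GL n F) : Matrix n n F) = 1 := fun g => by rw [← Units.val_mul]; simp
  have hig : ∀ g : GL n F, ((g⁻¹ : GL n F) : Matrix n n F) * (g : Matrix n n F) = 1 := fun g => by rw [← Units.val_mul]; simp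
  have hgit : ∀ g : GL n F, ((g⁻¹ : GL n F) : Matrix n n F)ᵀ * (g : Matrix n n F)ᵀ = 1 := fun g => by rw [← transpose_mul, hgi]; simp
  have higt : ∀ g : GL n F, (g : Matrix n n F)ᵀ * ((g⁻¹ : GL n F) : Matrix n n F)ᵀ = 1 := fun g => by rw [← transpose_mul, hig]; simp
  have hr : ∀ (g : GL n F) (A : Matrix n n F), ((g : Matrix n n F)ᵀ * A * (g : Matrix n n F)).rank = A.rank := by
    intro g A
    have hgd := (Matrix.isUnit_iff_isUnit_det _).1 g.isUnit
    rw [rank_mul_eq_left_of_isUnit_det _ _ hgd, rank_mul_eq_right_of_isUnit_det _ _ (by rw [det_transpose]; exact hgd)]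
  { toFun := fun P => ⟨(((g⁻¹ : GL n F) : Matrix n n F) * P.1.1 * ((g⁻¹ : GL n F) : Matrix n n F)ᵀ,
      (g : Matrix n n F)ᵀ * P.1.2.1 * (g : Matrix n n F), (g : Matrix n n F)ᵀ * P.1.2.2 * (g : Matrix n n F)), isT_act g P.2.1, by rw [hr]; exact P.2.2⟩
    invFun := fun P => ⟨((g : Matrix n n F) * P.1.1 * (g : Matrix n n F)ᵀ,
      ((g⁻¹ : GL n F) : Matrix n n F)ᵀ * P.1.2.1 * ((g⁻¹ : GL n F) : Matrix n n F), ((g⁻¹ : GL n F) : Matrix n n F)ᵀ * P.1.2.2 * ((g⁻¹ : GL n F) : Matrix n n F)), by simpa using isT_act g⁻¹ P.2.1, by rw [hr]; exact P.2.2⟩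
    left_inv := by
      rintro ⟨⟨Θ, α, β⟩, h⟩
      refine Subtype.ext (Prod.ext ?_ (Prod.ext ?_ ?_))
      · simp only [Matrix.mul_assoc, hgit, Matrix.mul_one]
        rw [← Matrix.mul_assoc, hgi, Matrix.one_mul]
      · simp only [Matrix.mul_assoc, hgi, Matrix.mul_one]
        rw [← Matrix.mul_assoc, hgit, Matrix.one_mul]
      · simp only [Matrix.mul_assoc, hgi, Matrix.mul_one]
        rw [← Matrix.mul_assoc, hgit, Matrix.one_mul]
    right_inv := by
      rintro ⟨⟨Θ, α, β⟩, h⟩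
      refine Subtype.ext (Prod.ext ?_ (Prod.ext ?_ ?_))
      · simp only [Matrix.mul_assoc, higt, Matrix.mul_one]
        rw [← Matrix.mul_assoc, hig, Matrix.one_mul]
      · simp only [Matrix.mul_assoc, hig, Matrix.mul_one]
        rw [← Matrix.mul_assoc, higt, Matrix.one_mul]
      · simp only [Matrix.mul_assoc, hig, Matrix.mul_one]
        rw [← Matrix.mul_assoc, higt, Matrix.one_mul] }

theorem toCols2_mul {r k : ℕ} (G A : Matrix (Fin r ⊕ Fin k) (Fin r ⊕ Fin k) F) : (G * A).toCols₂ = G * A.toCols₂ := by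
  conv_lhs => rw [← fromCols_toCols A, mul_fromCols, toCols₂_fromCols]

theorem nT_step1 {ε ε' η : F} {nil : Prop} (r k : ℕ) :
    nT ε ε' η nil (Fin (r+k)) k * (gl F r * gl F k * Fintype.card F ^ (r*k)) =
      gl F (r+k) * Nat.card {y : TK ε ε' η nil (Fin r ⊕ Fin k) k // y.1.2.1.toCols₂ = 0} := by
  rw [← nT_reindex ε ε' η nil (finSumFinEquiv (m := r) (n := k)), ← card_gl_sum]
  refine card_avg (actT ε ε' η nil k) (fun y => y.1.2.1.toCols₂ = 0) _ ?_
  rintro ⟨⟨Θ, α, β⟩, h, hr⟩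
  have hr' : α.rank = r := by simp at hr; exact hr
  rw [← card_adapt α hr']
  refine Nat.card_congr (Equiv.subtypeEquiv (Equiv.refl _) ?_)
  intro g
  have hgt : IsUnit ((g : Matrix (Fin r ⊕ Fin k) (Fin r ⊕ Fin k) F)ᵀ) := by rw [Matrix.isUnit_transpose]; exact g.isUnit
  simp only [actT, Equiv.coe_fn_mk, Equiv.refl_apply]
  rw [Matrix.mul_assoc, toCols2_mul]
  constructor
  · intro h
    have hd := (Matrix.isUnit_iff_isUnit_det _).1 hgt
    have := congrArg (fun Z => ((g : Matrix (Fin r ⊕ Fin k) (Fin r ⊕ Fin k) F)ᵀ)⁻¹ * Z) h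
    simpa only [← Matrix.mul_assoc, nonsing_inv_mul _ hd, Matrix.one_mul, Matrix.mul_zero] using this
  · intro h; rw [h]; simp

end rec
end FF

open Matrix
set_option linter.all false

namespace FF
variable {F : Type} [Field F] [Fintype F]

section rec
variable {n m κ : Type} [Fintype n] [DecidableEq n] [Fintype m] [DecidableEq m] [Fintype κ] [DecidableEq κ]

theorem card_beta {ε ε' η : F} (hε : ε * ε = 1) (hε' : ε' * ε' = 1) (hη : η * η = 1) {k : ℕ} (a t : Matrix n n F) (x : Matrix n (Fin k) F) (w : Matrix (Fin k) (Fin k) F)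
    (hat : aᵀ = ε' • a) (ha : IsUnit a) (ht : tᵀ = ε • t) (hw : wᵀ = ε • w) (hu : IsUnit (fromBlocks t x (ε • xᵀ) w)) :
    Nat.card {β : Matrix (n ⊕ Fin k) (n ⊕ Fin k) F // βᵀ = η • β ∧ (fromBlocks a 0 0 0) * (fromBlocks t x (ε • xᵀ) w) * β = β * (fromBlocks t x (ε • xᵀ) w) * (fromBlocks a 0 0 0)} =
    Nat.card {b : Matrix n n F // bᵀ = (ε * ε' * η) • b ∧ t * a * b = b * a * t} * NS η k := by
  set Θ := fromBlocks t x (ε • xᵀ) w with hΘ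
  set A : Matrix (n ⊕ Fin k) (n ⊕ Fin k) F := fromBlocks a 0 0 0 with hA
  have hΘs : Θᵀ = ε • Θ := by
    rw [sym_blocks hε, hΘ]; simp [ht, hw]
  have hd := (Matrix.isUnit_iff_isUnit_det _).1 hu
  have hdt : IsUnit (Θᵀ).det := by rw [det_transpose]; exact hd
  let e1 : Matrix (n ⊕ Fin k) (n ⊕ Fin k) F ≃ Matrix (n ⊕ Fin k) (n ⊕ Fin k) F :=
    { toFun := fun β => Θ * β * Θᵀ
      invFun := fun γ => Θ⁻¹ * γ * (Θᵀ)⁻¹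
      left_inv := fun β => by
        simp only [← Matrix.mul_assoc, nonsing_inv_mul _ hd, Matrix.one_mul]
        rw [Matrix.mul_assoc, mul_nonsing_inv _ hdt, Matrix.mul_one]
      right_inv := fun β => by
        simp only [← Matrix.mul_assoc, mul_nonsing_inv _ hd, Matrix.one_mul]
        rw [Matrix.mul_assoc, nonsing_inv_mul _ hdt, Matrix.mul_one] }
  have hc : ∀ β, (A * Θ * β = β * Θ * A ↔ Θ * A * (e1 β) = (e1 β) * A * Θ) := by
    intro β
    have l1 : Θ * A * (e1 β) = Θ * (A * Θ * β) * Θᵀ := by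
      simp only [e1, Equiv.coe_fn_mk, Matrix.mul_assoc]
    have l2 : (e1 β) * A * Θ = Θ * (β * Θ * A) * Θᵀ := by
      simp only [e1, Equiv.coe_fn_mk, Matrix.mul_assoc]
      rw [hΘs]
      simp only [Matrix.smul_mul, Matrix.mul_smul]
    rw [l1, l2]
    exact e1.injective.eq_iff.symm
  have hs : ∀ β, (βᵀ = η • β ↔ (e1 β)ᵀ = η • (e1 β)) := by
    intro β
    have l1 : (e1 β)ᵀ = e1 (βᵀ) := by simp [e1, transpose_mul, Matrix.mul_assoc]
    have l2 : η • e1 β = e1 (η • β) := by simp [e1]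
    rw [l1, l2]
    exact e1.injective.eq_iff.symm
  rw [NS, ← Nat.card_prod]
  have step : Nat.card {β : Matrix (n ⊕ Fin k) (n ⊕ Fin k) F // βᵀ = η • β ∧ A * Θ * β = β * Θ * A} = Nat.card {γ : Matrix (n ⊕ Fin k) (n ⊕ Fin k) F // γᵀ = η • γ ∧ Θ * A * γ = γ * A * Θ} :=
    Nat.card_congr (Equiv.subtypeEquiv e1 fun β => and_congr (hs β) (hc β))
  rw [step]
  symm
  refine Nat.card_congr (Equiv.ofBijective (fun p => ⟨Gam ε a t p.1.1 x p.2.1, gam_ok hε hε' hη a t p.1.1 x w p.2.1 hat ht p.1.2.1 p.1.2.2 p.2.2⟩) ⟨?_, ?_⟩)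
  · rintro ⟨⟨b, hb⟩, ⟨z, hz⟩⟩ ⟨⟨b', hb'⟩, ⟨z', hz'⟩⟩ h
    have h := congrArg Subtype.val h
    simp only at h
    obtain ⟨rfl, rfl⟩ := gam_inj hε a t x w ha hu h
    rfl
  · rintro ⟨γ, h1, h2⟩
    obtain ⟨b, z, q1, q2, q3, q4⟩ := gam_ex hε hε' hη a t x w hat ha ht hu γ h1 h2
    exact ⟨(⟨b, q1, q2⟩, ⟨z, q3⟩), Subtype.ext q4.symm⟩

theorem rank_block_iff {r k : ℕ} (a : Matrix (Fin r) (Fin r) F) :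
    (fromBlocks a 0 0 (0 : Matrix (Fin k) (Fin k) F)).rank = r ↔ IsUnit a := by
  have h3 : fromBlocks a 0 0 (0 : Matrix (Fin k) (Fin k) F) = fromRows (1 : Matrix (Fin r) (Fin r) F) (0 : Matrix (Fin k) (Fin r) F) * fromCols a (0 : Matrix (Fin r) (Fin k) F) := by
    rw [fromRows_mul_fromCols]; simp
  constructor
  · intro h
    apply inj_isUnit
    apply inj_of_rank_fromCols (k := k)
    apply le_antisymm
    · exact (rank_le_card_height _).trans (by simp)
    · calc r = _ := h.symm
        _ ≤ _ := by conv_lhs => rw [h3]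
                    exact rank_mul_le_right _ _
  · intro h
    apply le_antisymm
    · rw [h3]
      exact (rank_mul_le_left _ _).trans ((rank_le_card_width _).trans (by simp))
    · have h4 : a = fromCols (1 : Matrix (Fin r) (Fin r) F) (0 : Matrix (Fin r) (Fin k) F) * (fromBlocks a 0 0 (0 : Matrix (Fin k) (Fin k) F) * fromRows (1 : Matrix (Fin r) (Fin r) F) (0 : Matrix (Fin k) (Fin r) F)) := by
        rw [fromBlocks_mul_fromRows, fromCols_mul_fromRows]; simp
      have h5 : a.rank = r := by rw [rank_of_isUnit a h]; simp
      calc r = a.rank := h5.symm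
        _ ≤ _ := by conv_lhs => rw [h4]
                    exact (rank_mul_le_right _ _).trans (rank_mul_le_left _ _)

abbrev M4 (F : Type) (r k : ℕ) := (Matrix (Fin r) (Fin r) F × Matrix (Fin r) (Fin r) F) × (Matrix (Fin r) (Fin k) F × Matrix (Fin k) (Fin k) F)

def isS (ε ε' : F) (nil : Prop) {r k : ℕ} (p : M4 F r k) : Prop :=
  (p.1.1ᵀ = ε' • p.1.1 ∧ IsUnit p.1.1 ∧ p.1.2ᵀ = ε • p.1.2 ∧ (nil → IsNilpotent (p.1.1 * p.1.2))) ∧ (p.2.2ᵀ = ε • p.2.2 ∧ IsUnit (fromBlocks p.1.2 p.2.1 (ε • p.2.1ᵀ) p.2.2))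

def bigΘ (ε : F) {r k : ℕ} (p : M4 F r k) : Matrix (Fin r ⊕ Fin k) (Fin r ⊕ Fin k) F := fromBlocks p.1.2 p.2.1 (ε • p.2.1ᵀ) p.2.2
def bigA {r k : ℕ} (p : M4 F r k) : Matrix (Fin r ⊕ Fin k) (Fin r ⊕ Fin k) F := fromBlocks p.1.1 0 0 0

theorem nil_big (ε : F) {r k : ℕ} (p : M4 F r k) : IsNilpotent (bigΘ ε p * bigA p) ↔ IsNilpotent (p.1.1 * p.1.2) := by
  simp only [bigΘ, bigA, fromBlocks_multiply, Matrix.mul_zero, add_zero]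
  rw [nilp_blocks]
  exact ⟨nilp_comm, nilp_comm⟩

set_option maxHeartbeats 2000000 in
theorem card_Y {ε ε' η : F} (hε : ε * ε = 1) (hε' : ε' * ε' = 1) (hη : η * η = 1) {nil : Prop} (r k : ℕ) :
    Nat.card {y : TK ε ε' η nil (Fin r ⊕ Fin k) k // y.1.2.1.toCols₂ = 0} =
      (∑ j ∈ Finset.range (r+1), nT ε' ε (ε * ε' * η) nil (Fin r) j * (Fintype.card F ^ ((r-j)*k) * cnt2 ε (Fin k) (0 : Matrix (Fin j) (Fin j) F))) * NS η k := by
  let S : Type := {p : M4 F r k // isS ε ε' nil p}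
  let Mb := Matrix (Fin r ⊕ Fin k) (Fin r ⊕ Fin k) F
  have eY : {y : TK ε ε' η nil (Fin r ⊕ Fin k) k // y.1.2.1.toCols₂ = 0} ≃ Σ s : S, {β : Mb // βᵀ = η • β ∧ bigA s.1 * bigΘ ε s.1 * β = β * bigΘ ε s.1 * bigA s.1} := by
    symm
    refine Equiv.ofBijective (fun s => ⟨⟨(bigΘ ε s.1.1, bigA s.1.1, s.2.1), ?_, ?_⟩, ?_⟩) ⟨?_, ?_⟩
    · obtain ⟨⟨s, h1, h2⟩, ⟨β, h3, h4⟩⟩ := s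
      refine ⟨?_, h2.2, ?_, h3, h4, fun hn => (nil_big ε s).2 (h1.2.2.2 hn)⟩
      · simp only [bigΘ]; rw [sym_blocks hε]; simp [h1.2.2.1, h2.1]
      · simp only [bigA]; rw [sym_blocks hε']; simp [h1.1]
    · obtain ⟨⟨s, h1, h2⟩, ⟨β, h3, h4⟩⟩ := s
      have := (rank_block_iff (k := k) s.1.1).2 h1.2.1
      simp only [bigA, this]; simp
    · ext i j; obtain ⟨⟨s, h1, h2⟩, ⟨β, h3, h4⟩⟩ := s
      rcases i with i|i <;> simp [bigA, toCols₂]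
    · rintro ⟨⟨⟨⟨a, t⟩, ⟨x, w⟩⟩, h1⟩, ⟨β, h3⟩⟩ ⟨⟨⟨⟨a', t'⟩, ⟨x', w'⟩⟩, h1'⟩, ⟨β', h3'⟩⟩ h
      have h := congrArg (fun z => z.1.1) h
      simp only [bigΘ, bigA, Prod.mk.injEq, fromBlocks_inj] at h
      obtain ⟨⟨rfl, rfl, -, rfl⟩, ⟨rfl, -⟩, rfl⟩ := h
      rfl
    · rintro ⟨⟨⟨Θ, α, β⟩, ⟨g1, g2, g3, g4, g5, g6⟩, hr⟩, h0⟩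
      simp only at g1 g2 g3 g4 g5 g6 hr h0
      obtain ⟨s1, s2, s3⟩ := (sym_blocks hε Θ).1 g1
      obtain ⟨a1, a2, a3⟩ := (sym_blocks hε' α).1 g3
      have z12 : α.toBlocks₁₂ = 0 := by ext i j; exact congrFun (congrFun h0 (Sum.inl i)) j
      have z22 : α.toBlocks₂₂ = 0 := by ext i j; exact congrFun (congrFun h0 (Sum.inr i)) j
      have z21 : α.toBlocks₂₁ = 0 := by rw [a3, z12]; simp
      have hα : fromBlocks α.toBlocks₁₁ 0 0 0 = α := by
        conv_rhs => rw [← fromBlocks_toBlocks α, z12, z21, z22]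
      have hΘ : fromBlocks Θ.toBlocks₁₁ Θ.toBlocks₁₂ (ε • Θ.toBlocks₁₂ᵀ) Θ.toBlocks₂₂ = Θ := by
        rw [← s3, fromBlocks_toBlocks]
      have hu : IsUnit α.toBlocks₁₁ := by
        rw [← rank_block_iff (k := k), hα]; simpa using hr
      let p : M4 F r k := ((α.toBlocks₁₁, Θ.toBlocks₁₁), (Θ.toBlocks₁₂, Θ.toBlocks₂₂))
      have hp1 : bigΘ ε p = Θ := hΘ
      have hp2 : bigA p = α := hα
      refine ⟨⟨⟨p, ⟨a1, hu, s1, fun hn => (nil_big ε p).1 (by rw [hp1, hp2]; exact g6 hn)⟩, s2, ?_⟩, ⟨β, g4, ?_⟩⟩, ?_⟩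
      · change IsUnit (bigΘ ε p); rw [hp1]; exact g2
      · change bigA p * bigΘ ε p * β = β * bigΘ ε p * bigA p; rw [hp1, hp2]; exact g5
      · apply Subtype.ext; apply Subtype.ext; simp only [hp1, hp2]
  have : Fintype S := Fintype.ofFinite S
  rw [Nat.card_congr eY, Nat.card_sigma]
  have h1 : ∀ s : S, Nat.card {β : Mb // βᵀ = η • β ∧ bigA s.1 * bigΘ ε s.1 * β = β * bigΘ ε s.1 * bigA s.1} = Nat.card {b : Matrix (Fin r) (Fin r) F // bᵀ = (ε * ε' * η) • b ∧ s.1.1.2 * s.1.1.1 * b = b * s.1.1.1 * s.1.1.2} * NS η k := by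
    rintro ⟨⟨⟨a, t⟩, ⟨x, w⟩⟩, ⟨g1, g2, g3, g4⟩, g5, g6⟩
    exact card_beta hε hε' hη a t x w g1 g2 g3 g5 g6
  simp only [h1]
  rw [← Finset.sum_mul, ← Nat.card_sigma]
  congr 1
  have eE : (Σ s : S, {b : Matrix (Fin r) (Fin r) F // bᵀ = (ε * ε' * η) • b ∧ s.1.1.2 * s.1.1.1 * b = b * s.1.1.1 * s.1.1.2}) ≃
     Σ τ : TT ε' ε (ε * ε' * η) nil (Fin r), {P : Matrix (Fin r) (Fin k) F × Matrix (Fin k) (Fin k) F // P.2ᵀ = ε • P.2 ∧ IsUnit (fromBlocks τ.1.2.1 P.1 (ε • P.1ᵀ) P.2)} :=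
    { toFun := fun s => ⟨⟨(s.1.1.1.1, s.1.1.1.2, s.2.1), s.1.2.1.1, s.1.2.1.2.1, s.1.2.1.2.2.1, s.2.2.1, s.2.2.2, s.1.2.1.2.2.2⟩, ⟨s.1.1.2, s.1.2.2⟩⟩
      invFun := fun τ => ⟨⟨((τ.1.1.1, τ.1.1.2.1), τ.2.1), ⟨τ.1.2.1, τ.1.2.2.1, τ.1.2.2.2.1, τ.1.2.2.2.2.2.2⟩, τ.2.2⟩, ⟨τ.1.1.2.2, τ.1.2.2.2.2.1, τ.1.2.2.2.2.2.1⟩⟩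
      left_inv := fun s => rfl
      right_inv := fun τ => rfl }
  have : Fintype (TT ε' ε (ε * ε' * η) nil (Fin r)) := Fintype.ofFinite _
  rw [Nat.card_congr eE, Nat.card_sigma]
  have hle : ∀ τ : TT ε' ε (ε * ε' * η) nil (Fin r), τ.1.2.1.rank ≤ r := fun τ => (rank_le_card_width _).trans (by simp)
  have h2 : ∀ τ : TT ε' ε (ε * ε' * η) nil (Fin r), Nat.card {P : Matrix (Fin r) (Fin k) F × Matrix (Fin k) (Fin k) F // P.2ᵀ = ε • P.2 ∧ IsUnit (fromBlocks τ.1.2.1 P.1 (ε • P.1ᵀ) P.2)} = (fun j => (Fintype.card F ^ ((r-j)*k) * cnt2 ε (Fin k) (0 : Matrix (Fin j) (Fin j) F))) (r - τ.1.2.1.rank) := by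
    intro τ
    have hl := hle τ
    change cnt2 ε (Fin k) τ.1.2.1 = _
    have hs := τ.2.2.2.1
    generalize τ.1.2.1 = t at hl hs ⊢
    obtain ⟨j, hj⟩ := Nat.exists_eq_add_of_le hl
    have h3 : r - t.rank = j := by omega
    beta_reduce
    rw [h3]
    have h4 : r - j = t.rank := by omega
    rw [h4]
    generalize hp : t.rank = p at *
    subst hj
    exact cnt2_rank hε t hs hp
  simp only [h2]
  rw [← Finset.sum_fiberwise_of_maps_to (s := Finset.univ) (t := Finset.range (r+1)) (g := fun τ : TT ε' ε (ε * ε' * η) nil (Fin r) => r - τ.1.2.1.rank) (by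
    intro τ _; simp)]
  refine Finset.sum_congr rfl fun j hj => ?_
  rw [Finset.sum_congr rfl (g := fun _ => (Fintype.card F ^ ((r-j)*k) * cnt2 ε (Fin k) (0 : Matrix (Fin j) (Fin j) F)))]
  · rw [Finset.sum_const, smul_eq_mul]
    congr 1
    rw [← Fintype.card_subtype, ← Nat.card_eq_fintype_card]
    have hj' : j ≤ r := by simp at hj; omega
    refine Nat.card_congr ((Equiv.subtypeSubtypeEquivSubtypeInter _ (fun P : Matrix (Fin r) (Fin r) F × Matrix (Fin r) (Fin r) F × Matrix (Fin r) (Fin r) F => r - P.2.1.rank = j)).trans (Equiv.subtypeEquivRight ?_))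
    intro P
    refine and_congr Iff.rfl ?_
    have : P.2.1.rank ≤ r := (rank_le_card_width _).trans (by simp)
    simp; omega
  · intro τ hτ
    simp only [Finset.mem_filter] at hτ
    rw [hτ.2]

theorem nT_rec {ε ε' η : F} (hε : ε * ε = 1) (hε' : ε' * ε' = 1) (hη : η * η = 1) {nil : Prop} (r k : ℕ) :
    nT ε ε' η nil (Fin (r+k)) k * (gl F r * gl F k * Fintype.card F ^ (r*k)) =
      gl F (r+k) * ((∑ j ∈ Finset.range (r+1), nT ε' ε (ε * ε' * η) nil (Fin r) j * (Fintype.card F ^ ((r-j)*k) * cnt2 ε (Fin k) (0 : Matrix (Fin j) (Fin j) F))) * NS η k) := by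
  rw [nT_step1, card_Y hε hε' hη]

end rec
end FF

open Matrix
set_option linter.all false

namespace FF
variable {F : Type} [Field F] [Fintype F]

section vals

local notation "qq" => ((Fintype.card F : ℕ) : ℝ)

theorem q_pos : (0:ℝ) < (Fintype.card F : ℝ) := by exact_mod_cast Fintype.card_pos
theorem q_gt_one : (1:ℝ) < (Fintype.card F : ℝ) := by exact_mod_cast Fintype.one_lt_card

theorem gl_succ (l : ℕ) : gl F (l+1) = (Fintype.card F ^ (l+1) - 1) * Fintype.card F ^ l * gl F l := by
  unfold gl
  have hm : Nat.card (GL (Fin l) F) = ∏ i : Fin l, (Fintype.card F ^ l - Fintype.card F ^ (i : ℕ)) := by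
    rw [Matrix.card_GL_field]
  have hm1 : Nat.card (GL (Fin (l+1)) F) = ∏ i : Fin (l+1), (Fintype.card F ^ (l+1) - Fintype.card F ^ (i : ℕ)) := by
    rw [Matrix.card_GL_field]
  rw [hm, hm1, Fin.prod_univ_succ]
  simp only [Fin.val_zero, pow_zero, Fin.val_succ, pow_succ', ← Nat.mul_sub]
  rw [Finset.prod_mul_distrib]
  simp [mul_assoc]

theorem gl_succ_real (l : ℕ) : (gl F (l+1) : ℝ) = (qq ^ (l+1) - 1) * qq ^ l * gl F l := by
  rw [gl_succ]
  push_cast [Nat.cast_sub (Nat.one_le_pow (l+1) (Fintype.card F) Fintype.card_pos)]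
  ring

theorem gl_zero : gl F 0 = 1 := by
  unfold gl
  rw [Nat.card_eq_one_iff_unique]
  refine ⟨⟨fun a b => Units.ext (Subsingleton.elim _ _)⟩, ⟨1⟩⟩

theorem NS_one_one : NS (1 : F) 1 = Fintype.card F := by
  have : {M : Matrix (Fin 1) (Fin 1) F // Mᵀ = (1:F) • M} ≃ Matrix (Fin 1) (Fin 1) F :=
    Equiv.subtypeUnivEquiv (fun M => by ext i j; rw [Subsingleton.elim i j]; simp)
  rw [NS, Nat.card_congr this, card_mat]; simp

theorem skew_one (h2 : (2:F) ≠ 0) (M : Matrix (Fin 1) (Fin 1) F) (h : Mᵀ = (-1:F) • M) : M = 0 := by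
  ext i j
  have := congrFun (congrFun h j) i
  rw [Subsingleton.elim i j] at *
  simp at this
  have h3 : (2:F) * M j j = 0 := by linear_combination this
  simpa [h2] using h3

theorem NS_neg_one (h2 : (2:F) ≠ 0) : NS (-1 : F) 1 = 1 := by
  rw [NS, Nat.card_eq_one_iff_unique]
  refine ⟨⟨fun a b => Subtype.ext ?_⟩, ⟨0, by simp⟩⟩
  rw [skew_one h2 _ a.2, skew_one h2 _ b.2]

theorem NS_zero (ε : F) : NS ε 0 = 1 := by
  rw [NS, Nat.card_eq_one_iff_unique]
  exact ⟨⟨fun a b => Subtype.ext (Subsingleton.elim _ _)⟩, ⟨0, by simp⟩⟩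

theorem NS_succ {ε : F} (hε : ε * ε = 1) (l : ℕ) : NS ε (l+1) = NS ε l * NS ε 1 * Fintype.card F ^ l := by
  rw [NS_add hε]; simp

theorem NS_pos (ε : F) (l : ℕ) : 0 < NS ε l := by
  rw [NS]
  have : Nonempty {M : Matrix (Fin l) (Fin l) F // Mᵀ = ε • M} := ⟨0, by simp⟩
  exact Nat.card_pos

theorem NSn_zero (ε : F) : NSn ε 0 = 1 := by
  rw [NSn, Nat.card_eq_one_iff_unique]
  exact ⟨⟨fun a b => Subtype.ext (Subsingleton.elim _ _)⟩, ⟨1, Subsingleton.elim _ _, isUnit_one⟩⟩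

theorem NSn_succ_cnt (h2 : (2:F) ≠ 0) (k : ℕ) : NSn (-1 : F) (1+k) = cnt2 (-1 : F) (Fin k) (0 : Matrix (Fin 1) (Fin 1) F) := by
  have hε : (-1:F) * (-1) = 1 := by ring
  rw [NSn, cnt2]
  have e0 : {M : Matrix (Fin (1+k)) (Fin (1+k)) F // Mᵀ = (-1:F) • M ∧ IsUnit M} ≃ {M : Matrix (Fin 1 ⊕ Fin k) (Fin 1 ⊕ Fin k) F // Mᵀ = (-1:F) • M ∧ IsUnit M} := by
    refine Equiv.subtypeEquiv (Matrix.reindex finSumFinEquiv.symm finSumFinEquiv.symm) ?_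
    intro M
    refine and_congr ?_ ?_
    · rw [transpose_reindex, ← (Matrix.reindex finSumFinEquiv.symm finSumFinEquiv.symm).injective.eq_iff]; rfl
    · exact (Matrix.isUnit_submatrix_equiv _ _).symm
  rw [Nat.card_congr e0]
  symm
  refine Nat.card_congr (Equiv.ofBijective (fun P => ⟨fromBlocks 0 P.1.1 ((-1:F) • P.1.1ᵀ) P.1.2, ?_, P.2.2⟩) ⟨?_, ?_⟩)
  · rw [sym_blocks hε]; simp
    have := P.2.1; simpa using this
  · rintro ⟨⟨x, z⟩, h⟩ ⟨⟨x', z'⟩, h'⟩ he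
    have he := congrArg Subtype.val he
    simp only [fromBlocks_inj] at he
    obtain ⟨-, rfl, -, rfl⟩ := he
    rfl
  · rintro ⟨M, h1, h3⟩
    obtain ⟨s1, s2, s3⟩ := (sym_blocks hε M).1 h1
    have hM : fromBlocks 0 M.toBlocks₁₂ ((-1:F) • M.toBlocks₁₂ᵀ) M.toBlocks₂₂ = M := by
      rw [← s3, ← skew_one h2 _ s1, fromBlocks_toBlocks]
    exact ⟨⟨(M.toBlocks₁₂, M.toBlocks₂₂), s2, by rw [hM]; exact h3⟩, Subtype.ext hM⟩

theorem NSn_one (h2 : (2:F) ≠ 0) : NSn (-1 : F) 1 = 0 := by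
  have := NSn_succ_cnt h2 0
  rw [cnt2_zero_lt (by norm_num)] at this
  exact this

theorem NSn_succ_succ (h2 : (2:F) ≠ 0) (l : ℕ) : NSn (-1 : F) (l+2) * gl F l = gl F (l+1) * NSn (-1:F) l := by
  have h := cnt2_zero_add (F := F) (ε := -1) (by ring) 1 l
  have h3 := NSn_succ_cnt h2 (1+l)
  rw [← h3, NS_neg_one h2] at h
  rw [show l + 2 = 1 + (1+l) by ring, show l+1 = 1+l by ring, h]; simp

/-- the weights -/
noncomputable def wt (ε η : F) (l : ℕ) : ℝ := NSn ε l * NS η l / gl F l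
noncomputable def kap (ε η : F) : ℝ := NS ε 1 * NS η 1 / (Fintype.card F : ℝ)

/-- model weights -/
noncomputable def Wc (Q : ℝ) : ℕ → ℝ
  | 0 => 1
  | 1 => 0
  | (l+2) => Wc Q l / (1 - (Q⁻¹)^(l+2))

theorem wt_Wc (h2 : (2:F) ≠ 0) : ∀ l, wt (-1 : F) 1 l = Wc (Fintype.card F) l
  | 0 => by simp [wt, Wc, NSn_zero, NS_zero, gl_zero]
  | 1 => by simp [wt, Wc, NSn_one h2]
  | (l+2) => by
    rw [Wc, ← wt_Wc h2 l, wt, wt]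
    have g0 : (gl F l : ℝ) ≠ 0 := by exact_mod_cast (gl_pos l).ne'
    have g1 : (gl F (l+1) : ℝ) ≠ 0 := by exact_mod_cast (gl_pos (l+1)).ne'
    have h := NSn_succ_succ h2 l
    have h' : (NSn (-1 : F) (l+2) : ℝ) = gl F (l+1) * NSn (-1:F) l / gl F l := by
      rw [eq_div_iff g0]; exact_mod_cast h
    rw [h', NS_succ (by ring), NS_succ (by ring), NS_one_one, gl_succ_real (l+1)]
    have hq := q_pos (F := F)
    have hq1 := q_gt_one (F := F)
    have h3 : (1:ℝ) < qq ^ (l+2) := one_lt_pow₀ hq1 (by omega)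
    have h4 : qq ^ (l+2) - 1 ≠ 0 := by linarith
    have h5 : 1 - (qq⁻¹)^(l+2) ≠ 0 := by
      rw [inv_pow]
      intro h
      have h6 : (qq^(l+2))⁻¹ = 1 := by linarith
      rw [inv_eq_one] at h6; linarith
    push_cast
    rw [div_div, div_eq_div_iff]
    · rw [show l + 1 + 1 = l + 2 from rfl]
      rw [inv_pow]
      field_simp
      ring
    · refine mul_ne_zero (mul_ne_zero ?_ ?_) g1
      · exact h4
      · positivity
    · exact mul_ne_zero g0 h5

theorem NS_neg_real (h2 : (2:F) ≠ 0) (l : ℕ) : (NS (-1:F) l : ℝ) = (qq⁻¹)^l * NS (1:F) l := by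
  induction l with
  | zero => simp [NS_zero]
  | succ l ih =>
    rw [NS_succ (ε := (-1:F)) (by ring) l, NS_succ (ε := (1:F)) (by ring) l, NS_neg_one h2, NS_one_one]
    push_cast
    rw [ih]
    have hq := (q_pos (F := F)).ne'
    rw [pow_succ]
    generalize ((Fintype.card F : ℝ)⁻¹)^l = z
    field_simp

theorem wt_neg (h2 : (2:F) ≠ 0) (ε : F) (l : ℕ) : wt ε (-1) l = (qq⁻¹)^l * wt ε 1 l := by
  rw [wt, wt, NS_neg_real h2]; ring

theorem wt_zero (ε η : F) : wt ε η 0 = 1 := by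
  simp [wt, NSn_zero, NS_zero, gl_zero]

theorem kap_pm (h2 : (2:F) ≠ 0) : kap (1:F) (-1) = 1 := by
  rw [kap, NS_one_one, NS_neg_one h2]; simp
theorem kap_mp (h2 : (2:F) ≠ 0) : kap (-1:F) 1 = 1 := by
  rw [kap, NS_one_one, NS_neg_one h2]; simp
theorem kap_mm (h2 : (2:F) ≠ 0) : kap (-1:F) (-1) = qq⁻¹ := by
  rw [kap, NS_neg_one h2]; simp
theorem kap_pp : kap (1:F) 1 = qq := by
  rw [kap, NS_one_one]; simp

theorem cj_eq {ε η : F} (hε : ε * ε = 1) (hη : η * η = 1) (j : ℕ) : (NS ε j * NS η j : ℝ) = kap ε η ^ j * qq^(j*j) := by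
  have hq := (q_pos (F := F)).ne'
  induction j with
  | zero => simp [NS_zero]
  | succ j ih =>
    rw [NS_succ hε, NS_succ hη]
    push_cast
    calc _ = (NS ε j * NS η j : ℝ) * (NS ε 1 * NS η 1) * qq^j*qq^j := by ring
      _ = _ := by
        rw [ih]
        have : (NS ε 1 * NS η 1 : ℝ) = kap ε η * qq := by rw [kap]; field_simp
        rw [this]; ring

/-- normalized counts -/
noncomputable def Fm (ε ε' η : F) (nil : Prop) (m k : ℕ) : ℝ := nT ε ε' η nil (Fin m) k / gl F m

theorem nT_lt (ε ε' η : F) (nil : Prop) {m k : ℕ} (h : m < k) : nT ε ε' η nil (Fin m) k = 0 := by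
  rw [nT, Nat.card_eq_zero]
  left
  refine ⟨fun ⟨P, _, h2⟩ => ?_⟩
  simp at h2; omega

theorem Fm_lt (ε ε' η : F) (nil : Prop) {m k : ℕ} (h : m < k) : Fm ε ε' η nil m k = 0 := by
  rw [Fm, nT_lt _ _ _ _ h]; simp

theorem Fm_nonneg (ε ε' η : F) (nil : Prop) (m k : ℕ) : 0 ≤ Fm ε ε' η nil m k := by
  rw [Fm]; positivity

theorem Fm_rec {ε ε' η : F} (hε : ε * ε = 1) (hε' : ε' * ε' = 1) (hη : η * η = 1) {nil : Prop} (r k : ℕ) :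
    Fm ε ε' η nil (r+k) k = ∑ p ∈ Finset.HasAntidiagonal.antidiagonal k, Fm ε' ε (ε * ε' * η) nil r p.1 * (kap ε η ^ p.1 * wt ε η p.2) := by
  have h := nT_rec hε hε' hη (nil := nil) r k
  have hq := (q_pos (F := F)).ne'
  have g (i : ℕ) : (gl F i : ℝ) ≠ 0 := by exact_mod_cast (gl_pos i).ne'
  have h' : (nT ε ε' η nil (Fin (r+k)) k : ℝ) * (gl F r * gl F k * qq ^ (r*k)) =
      gl F (r+k) * ((∑ j ∈ Finset.range (r+1), nT ε' ε (ε * ε' * η) nil (Fin r) j * (qq ^ ((r-j)*k) * cnt2 ε (Fin k) (0 : Matrix (Fin j) (Fin j) F))) * NS η k) := by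
    exact_mod_cast h
  have h1 : Fm ε ε' η nil (r+k) k = ∑ j ∈ Finset.range (r+1), Fm ε' ε (ε * ε' * η) nil r j * ((qq ^ (j*k))⁻¹ * cnt2 ε (Fin k) (0 : Matrix (Fin j) (Fin j) F) * NS η k / gl F k) := by
    rw [Fm, div_eq_iff (g _)]
    have h3 : (gl F r * gl F k * qq ^ (r*k) : ℝ) ≠ 0 := mul_ne_zero (mul_ne_zero (g _) (g _)) (pow_ne_zero _ hq)
    apply mul_right_cancel₀ h3
    rw [h']
    rw [Finset.sum_mul, Finset.mul_sum, Finset.sum_mul, Finset.sum_mul]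
    refine Finset.sum_congr rfl fun j hj => ?_
    have hj' : j ≤ r := by simp at hj; omega
    obtain ⟨i, rfl⟩ := Nat.exists_eq_add_of_le hj'
    rw [Fm, show j + i - j = i by omega, add_mul, pow_add]
    have := g (j+i); have := g k
    field_simp
  have h2 : ∀ j, Fm ε' ε (ε * ε' * η) nil r j * ((qq ^ (j*k))⁻¹ * cnt2 ε (Fin k) (0 : Matrix (Fin j) (Fin j) F) * NS η k / gl F k) =
      if j ≤ k then Fm ε' ε (ε * ε' * η) nil r j * (kap ε η ^ j * wt ε η (k - j)) else 0 := by
    intro j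
    split_ifs with hjk
    · obtain ⟨l, rfl⟩ := Nat.exists_eq_add_of_le hjk
      have h4 := cnt2_zero_add hε j l
      have h5 : (cnt2 ε (Fin (j+l)) (0 : Matrix (Fin j) (Fin j) F) : ℝ) = gl F (j+l) * NS ε j * NSn ε l / gl F l := by
        rw [eq_div_iff (g l)]; exact_mod_cast h4
      rw [h5, NS_add hη, show j + l - j = l by omega, wt, mul_add, pow_add]
      push_cast
      have h6 := cj_eq hε hη j
      have h7 : kap ε η ^ j = (NS ε j * NS η j : ℝ) * (qq^(j*j))⁻¹ := by rw [h6]; field_simp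
      rw [h7]
      have := g (j+l); have := g l
      field_simp
    · rw [cnt2_zero_lt (by omega)]; simp
  rw [h1, Finset.Nat.sum_antidiagonal_eq_sum_range_succ (fun i j => Fm ε' ε (ε * ε' * η) nil r i * (kap ε η ^ i * wt ε η j))]
  simp only [h2]
  have e1 : ∑ j ∈ Finset.range (r+1), (if j ≤ k then Fm ε' ε (ε * ε' * η) nil r j * (kap ε η ^ j * wt ε η (k - j)) else 0) =
      ∑ j ∈ Finset.range (r+k+1), (if j ≤ k then Fm ε' ε (ε * ε' * η) nil r j * (kap ε η ^ j * wt ε η (k - j)) else 0) := by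
    apply Finset.sum_subset (by intro x; simp; omega)
    intro x _ hx
    rw [Fm_lt _ _ _ _ (by simpa using hx)]; simp
  rw [e1]
  symm
  have e2 : ∑ j ∈ Finset.range (k+1), Fm ε' ε (ε * ε' * η) nil r j * (kap ε η ^ j * wt ε η (k - j)) = ∑ j ∈ Finset.range (k+1), (if j ≤ k then Fm ε' ε (ε * ε' * η) nil r j * (kap ε η ^ j * wt ε η (k - j)) else 0) := by
    refine Finset.sum_congr rfl fun j hj => ?_
    rw [if_pos (by simp at hj; omega)]
  rw [e2]
  apply Finset.sum_subset (by intro x; simp; omega)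
  intro x _ hx
  rw [if_neg (by simp at hx; omega)]

end vals
end FF

open Matrix
set_option linter.all false

namespace FF

section ring
variable {R : Type} [CommRing R] [Algebra ℝ R]

noncomputable def ev (N : ℕ) (w : ℕ → ℝ) (y : R) : R := ∑ l ∈ Finset.range (N+1), w l • y^l

noncomputable def GG (N : ℕ) (x : R) (a : ℕ → ℕ → ℝ) (y : R) : R :=
  ∑ k ∈ Finset.range (N+1), y^k * ∑ m ∈ Finset.range (N+1), a m k • x^m

theorem pow_zero_of_lt {N : ℕ} {x : R} (hx : x^(N+1) = 0) {k : ℕ} (hk : N < k) : x^k = 0 :=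
  pow_eq_zero_of_le hk hx

theorem conv_trunc {N : ℕ} {z : R} (hz : z^(N+1) = 0) (u v : ℕ → R) :
    ∑ k ∈ Finset.range (N+1), z^k * ∑ p ∈ Finset.HasAntidiagonal.antidiagonal k, u p.1 * v p.2 =
      (∑ l ∈ Finset.range (N+1), v l * z^l) * (∑ j ∈ Finset.range (N+1), u j * z^j) := by
  rw [Finset.sum_mul_sum, ← Finset.sum_product']
  have h1 : ∀ k, z^k * ∑ p ∈ Finset.HasAntidiagonal.antidiagonal k, u p.1 * v p.2 =
      ∑ p ∈ Finset.HasAntidiagonal.antidiagonal k, (u p.1 * z^p.1) * (v p.2 * z^p.2) := by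
    intro k
    rw [Finset.mul_sum]
    refine Finset.sum_congr rfl fun p hp => ?_
    rw [← Finset.HasAntidiagonal.mem_antidiagonal.1 hp, pow_add]; ring
  simp only [h1]
  rw [Finset.sum_sigma']
  have h2 : ∑ p ∈ (Finset.range (N+1) ×ˢ Finset.range (N+1)), v p.1 * z^p.1 * (u p.2 * z^p.2) =
      ∑ p ∈ (Finset.range (N+1) ×ˢ Finset.range (N+1)).filter (fun p => p.1 + p.2 < N+1), v p.1 * z^p.1 * (u p.2 * z^p.2) := by
    symm
    apply Finset.sum_subset (Finset.filter_subset _ _)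
    intro p hp hp2
    have h3 : N < p.1 + p.2 := by
      by_contra h
      exact hp2 (Finset.mem_filter.2 ⟨hp, by omega⟩)
    calc _ = v p.1 * u p.2 * z^(p.1+p.2) := by rw [pow_add]; ring
      _ = 0 := by rw [pow_zero_of_lt hz h3, mul_zero]
  rw [h2]
  refine Finset.sum_bij' (fun s _ => (s.2.2, s.2.1)) (fun p _ => ⟨p.2 + p.1, (p.2, p.1)⟩) ?_ ?_ ?_ ?_ ?_
  · rintro ⟨k, i, j⟩ h
    simp at h ⊢; omega
  · rintro ⟨i, j⟩ h
    simp at h ⊢; omega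
  · rintro ⟨k, i, j⟩ h
    simp at h ⊢
    exact h.2
  · rintro ⟨i, j⟩ h; rfl
  · rintro ⟨k, i, j⟩ h
    simp; ring

theorem GG_rec {N : ℕ} {x : R} (hx : x^(N+1) = 0) {a a' : ℕ → ℕ → ℝ} {κ : ℝ} {w : ℕ → ℝ}
    (h0 : ∀ m k, m < k → a m k = 0)
    (hr : ∀ r k, a (r+k) k = ∑ p ∈ Finset.HasAntidiagonal.antidiagonal k, a' r p.1 * (κ^p.1 * w p.2)) (y : R) :
    GG N x a y = ev N w (y * x) * GG N x a' (κ • (y*x)) := by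
  have hz : (y*x)^(N+1) = 0 := by rw [mul_pow, hx, mul_zero]
  have hA : ∀ k ∈ Finset.range (N+1), ∑ m ∈ Finset.range (N+1), a m k • x^m = x^k * ∑ p ∈ Finset.HasAntidiagonal.antidiagonal k,
      (κ^p.1 • ∑ m ∈ Finset.range (N+1), a' m p.1 • x^m) * (w p.2 • (1:R)) := by
    intro k hk
    have e1 : ∑ m ∈ Finset.range (N+1), a m k • x^m = x^k * ∑ r ∈ Finset.range (N+1), a (r+k) k • x^r := by
      have e2 : ∑ m ∈ Finset.range (N+1+k), a m k • x^m = ∑ m ∈ Finset.range (N+1), a m k • x^m := by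
        symm
        apply Finset.sum_subset (by intro i; simp; omega)
        intro m _ hm
        rw [pow_zero_of_lt hx (by simpa using hm), smul_zero]
      rw [← e2, add_comm (N+1) k, Finset.sum_range_add, Finset.sum_eq_zero, zero_add, Finset.mul_sum]
      · refine Finset.sum_congr rfl fun r _ => ?_
        rw [add_comm k r, pow_add, mul_smul_comm, mul_comm (x^r)]
      · intro m hm
        rw [h0 _ _ (by simpa using hm), zero_smul]
    rw [e1]
    congr 1
    simp only [hr, Finset.sum_smul]
    rw [Finset.sum_comm]
    refine Finset.sum_congr rfl fun p _ => ?_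
    rw [Finset.smul_sum, Finset.sum_mul]
    refine Finset.sum_congr rfl fun m _ => ?_
    simp only [Algebra.smul_def, map_mul]; ring
  rw [GG, Finset.sum_congr rfl fun k hk => by rw [hA k hk, ← mul_assoc, ← mul_pow]]
  rw [conv_trunc hz (fun i => κ^i • ∑ m ∈ Finset.range (N+1), a' m i • x^m) (fun l => w l • (1:R))]
  rw [ev, GG]
  congr 1
  · refine Finset.sum_congr rfl fun l _ => ?_
    simp
  · refine Finset.sum_congr rfl fun l _ => ?_
    simp only [Algebra.smul_def, map_mul, mul_pow, map_pow]; ring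

theorem GG_zero {N : ℕ} (x : R) (a : ℕ → ℕ → ℝ) : GG N x a 0 = ∑ m ∈ Finset.range (N+1), a m 0 • x^m := by
  rw [GG, Finset.sum_range_succ', Finset.sum_eq_zero, zero_add]
  · simp
  · intro k _; simp

theorem GG_one {N : ℕ} (x : R) (a : ℕ → ℕ → ℝ) (h0 : ∀ m k, m < k → a m k = 0) :
    GG N x a 1 = ∑ m ∈ Finset.range (N+1), (∑ k ∈ Finset.range (m+1), a m k) • x^m := by
  rw [GG]
  simp only [one_pow, one_mul]
  rw [Finset.sum_comm]
  refine Finset.sum_congr rfl fun m hm => ?_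
  rw [Finset.sum_smul]
  symm
  apply Finset.sum_subset
  · intro i; simp at *; omega
  · intro k _ hk
    rw [h0 _ _ (by simpa using hk), zero_smul]

theorem ev_smul (N : ℕ) (w : ℕ → ℝ) (c : ℝ) (y : R) : ev N w (c • y) = ev N (fun l => c^l * w l) y := by
  rw [ev, ev]
  refine Finset.sum_congr rfl fun l _ => ?_
  rw [smul_pow, smul_smul, mul_comm]

theorem ev_fun {N : ℕ} {w w' : ℕ → ℝ} {y : R} (hy : y^(N+1) = 0) {c : ℝ} (h0 : w' 0 = w 0) (h1 : w' 1 = w 1)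
    (h : ∀ l, w' (l+2) = w (l+2) - c * w l) : ev N w' y = ev N w y * (1 - c • y^2) := by
  have e : ∀ w : ℕ → ℝ, ev N w y = ev (N+2) w y := by
    intro w
    rw [ev, ev, Finset.sum_range_succ, Finset.sum_range_succ _ (N+1+1), Finset.sum_range_succ _ (N+1), pow_zero_of_lt hy (show N < N+1 by omega),  pow_zero_of_lt hy (show N < N+2 by omega), Finset.sum_range_succ]
    simp
  rw [e w', mul_sub, mul_one]
  nth_rewrite 1 [e w]
  rw [ev, ev, ev, Finset.sum_range_succ', Finset.sum_range_succ', Finset.sum_range_succ' _ (N+2), Finset.sum_range_succ' _ (N+1), Finset.sum_mul]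
  simp only [zero_add, h0, h1, h, sub_smul, Finset.sum_sub_distrib, show ∀ l, l + 1 + 1 = l + 2 from fun _ => rfl]
  have : ∑ l ∈ Finset.range (N+1), (c * w l) • y^(l+2) = ∑ l ∈ Finset.range (N+1), w l • y^l * c • y^2 := by
    refine Finset.sum_congr rfl fun l _ => ?_
    rw [pow_add]
    simp only [Algebra.smul_def, map_mul]; ring
  rw [this]; ring

end ring

theorem Wc_fun {R : Type} [CommRing R] [Algebra ℝ R] {N : ℕ} {y : R} (hy : y^(N+1) = 0) {Q : ℝ} (hQ : 1 < Q) :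
    ev N (Wc Q) (Q⁻¹ • y) = ev N (Wc Q) y * (1 - y^2) := by
  rw [ev_smul]
  have := ev_fun hy (w := Wc Q) (w' := fun l => Q⁻¹^l * Wc Q l) (c := 1) (by simp) (by simp [Wc]) ?_
  · rw [this, one_smul]
  · intro l
    have h5 : 1 - (Q⁻¹)^(l+2) ≠ 0 := by
      have := pow_lt_one₀ (by positivity) (inv_lt_one_of_one_lt₀ hQ) (show l + 2 ≠ 0 by omega)
      linarith
    simp only [Wc]
    generalize Q⁻¹^(l+2) = z at *
    field_simp
    ring

variable {F : Type} [Field F] [Fintype F]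
section
variable {R : Type} [CommRing R] [Algebra ℝ R]

theorem GS_rec (h2 : (2:F) ≠ 0) {N : ℕ} {x : R} (hx : x^(N+1) = 0) (nil : Prop) (y : R) :
    GG N x (Fm (-1:F) 1 1 nil) y = ev N (Wc (Fintype.card F)) (y*x) * ev N (wt (1:F) (-1)) (y*x*x) * GG N x (Fm (-1:F) 1 1 nil) (y*x*x) := by
  rw [GG_rec hx (a' := Fm (1:F) (-1) (-1) nil) (κ := 1) (w := wt (-1:F) 1) (fun m k h => Fm_lt _ _ _ _ h),
    GG_rec hx (a := Fm (1:F) (-1) (-1) nil) (a' := Fm (-1:F) 1 1 nil) (κ := 1) (w := wt (1:F) (-1)) (fun m k h => Fm_lt _ _ _ _ h)]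
  · simp only [one_smul, mul_assoc]
    rw [show wt (-1:F) 1 = Wc (Fintype.card F) from funext (wt_Wc h2)]
  · intro r k
    rw [Fm_rec (by ring) (by ring) (by ring), kap_pm h2, show (1:F) * -1 * -1 = 1 by ring]
  · intro r k
    rw [Fm_rec (by ring) (by ring) (by ring), kap_mp h2, show (-1:F) * 1 * 1 = -1 by ring]

theorem GS'_rec (h2 : (2:F) ≠ 0) {N : ℕ} {x : R} (hx : x^(N+1) = 0) (nil : Prop) (y : R) :
    GG N x (Fm (-1:F) 1 (-1) nil) y = ev N (Wc (Fintype.card F)) (y*x) * (1 - (y*x)^2) * ev N (wt (1:F) (-1)) (y*x*x) * GG N x (Fm (-1:F) 1 (-1) nil) (y*x*x) := by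
  have hq := (q_pos (F := F)).ne'
  rw [GG_rec hx (a' := Fm (1:F) (-1) (1) nil) (κ := ((Fintype.card F : ℕ):ℝ)⁻¹) (w := wt (-1:F) (-1)) (fun m k h => Fm_lt _ _ _ _ h),
    GG_rec hx (a := Fm (1:F) (-1) (1) nil) (a' := Fm (-1:F) 1 (-1) nil) (κ := ((Fintype.card F : ℕ):ℝ)) (w := wt (1:F) 1) (fun m k h => Fm_lt _ _ _ _ h)]
  · rw [← Wc_fun (by rw [mul_pow, hx, mul_zero]) (q_gt_one (F := F))]
    rw [show wt (1:F) (-1) = fun l => ((Fintype.card F : ℕ):ℝ)⁻¹^l * wt (1:F) 1 l from funext (wt_neg h2 1), ← ev_smul]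
    rw [show wt (-1:F) (-1) = fun l => ((Fintype.card F : ℕ):ℝ)⁻¹^l * wt (-1:F) 1 l from funext (wt_neg h2 (-1)), ← ev_smul]
    rw [show wt (-1:F) 1 = Wc (Fintype.card F) from funext (wt_Wc h2)]
    rw [smul_mul_assoc, smul_smul, mul_inv_cancel₀ hq, one_smul]; ring
  · intro r k
    rw [Fm_rec (by ring) (by ring) (by ring), kap_pp, show (1:F) * -1 * 1 = -1 by ring]
  · intro r k
    rw [Fm_rec (by ring) (by ring) (by ring), kap_mm h2, show (-1:F) * 1 * -1 = 1 by ring]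

theorem GP_rec (h2 : (2:F) ≠ 0) {N : ℕ} {x : R} (hx : x^(N+1) = 0) (nil : Prop) (y : R) :
    GG N x (Fm (-1:F) (-1) 1 nil) y = ev N (Wc (Fintype.card F)) (y*x) * GG N x (Fm (-1:F) (-1) 1 nil) (y*x) := by
  rw [GG_rec hx (a' := Fm (-1:F) (-1) 1 nil) (κ := 1) (w := wt (-1:F) 1) (fun m k h => Fm_lt _ _ _ _ h)]
  · rw [show wt (-1:F) 1 = Wc (Fintype.card F) from funext (wt_Wc h2), one_smul]
  · intro r k
    rw [Fm_rec (by ring) (by ring) (by ring), kap_mp h2, show (-1:F) * -1 * 1 = 1 by ring]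

end

theorem isUnit_of_rank_add {n : Type} [Fintype n] [DecidableEq n] {α : Matrix n n F} (h : α.rank + 0 = Fintype.card n) : IsUnit α := by
  rw [← Matrix.linearIndependent_rows_iff_isUnit, linearIndependent_iff_card_eq_finrank_span, Set.finrank, ← Matrix.rank_eq_finrank_span_row]
  omega

theorem Fm_SS' (m : ℕ) : Fm (-1:F) 1 1 False m 0 = Fm (-1:F) 1 (-1) False m 0 := by
  rw [Fm, Fm]
  congr 2
  rw [nT, nT]
  refine Nat.card_congr (Equiv.ofBijective (fun P => ⟨(P.1.1, P.1.2.1, P.1.2.1 * P.1.1 * P.1.2.2), ?_, P.2.2⟩) ⟨?_, ?_⟩)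
  · obtain ⟨⟨Θ, α, γ⟩, ⟨h1, h2, h3, h4, h5, h6⟩, h7⟩ := P
    simp only [neg_smul, one_smul] at h1 h3 h4 h5
    refine ⟨by simpa using h1, h2, by simpa using h3, ?_, ?_, fun h => h.elim⟩
    · simp only [neg_smul, one_smul, transpose_mul, h1, h3, h4, h5]
      simp only [neg_mul, mul_neg, ← mul_assoc]
      rw [h5]
    · simp only [← mul_assoc]
      calc α * Θ * α * Θ * γ = α * Θ * (α * Θ * γ) := by simp only [mul_assoc]
        _ = α * Θ * (γ * Θ * α) := by rw [h5]
        _ = _ := by simp only [mul_assoc]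
  · rintro ⟨⟨Θ, α, γ⟩, h, h'⟩ ⟨⟨Θ', α', γ'⟩, k, k'⟩ he
    simp only [Subtype.mk.injEq, Prod.mk.injEq] at he
    obtain ⟨rfl, rfl, e⟩ := he
    have hu : IsUnit (α * Θ) := (isUnit_of_rank_add h').mul h.2.1
    simp only [Subtype.mk.injEq, Prod.mk.injEq, true_and]
    exact hu.mul_left_cancel e
  · rintro ⟨⟨Θ, α, β⟩, ⟨h1, h2, h3, h4, h5, h6⟩, h7⟩
    have hα := isUnit_of_rank_add h7
    have hu : IsUnit (α * Θ) := hα.mul h2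
    have hu' : IsUnit (Θ * α) := h2.mul hα
    simp only [neg_smul, one_smul] at h1 h3 h4
    have d := (Matrix.isUnit_iff_isUnit_det _).1 hu
    have d' := (Matrix.isUnit_iff_isUnit_det _).1 hu'
    have hs : (α*Θ)⁻¹ * β = β * (Θ * α)⁻¹ := by
      apply hu.mul_left_cancel
      apply hu'.mul_right_cancel
      rw [← mul_assoc (α*Θ), mul_nonsing_inv _ d, one_mul, mul_assoc (α * Θ), mul_assoc β, nonsing_inv_mul _ d', mul_one, h5, mul_assoc]
    have hα2 : α * Θ * ((α*Θ)⁻¹ * β) = β := by rw [← mul_assoc, mul_nonsing_inv _ d, one_mul]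
    refine ⟨⟨(Θ, α, (α*Θ)⁻¹ * β), ⟨by simpa using h1, h2, by simpa using h3, ?_, ?_, fun h => h.elim⟩, h7⟩, ?_⟩
    · rw [transpose_mul, transpose_nonsing_inv, transpose_mul, h1, h3, h4, one_smul, hs]
      have : (-Θ * α)⁻¹ = -(Θ*α)⁻¹ := by
        rw [neg_mul]
        apply Matrix.inv_eq_left_inv
        rw [neg_mul_neg, nonsing_inv_mul _ d']
      rw [this, neg_mul_neg]
    · rw [hα2, hs, mul_assoc, mul_assoc, nonsing_inv_mul _ d', mul_one]
    · apply Subtype.ext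
      simp [hα2]

theorem Fm_nil_zero (m : ℕ) : Fm (-1:F) (-1) 1 True m 0 = if m = 0 then 1 else 0 := by
  split_ifs with h
  · subst h
    rw [Fm, gl_zero, nT, Nat.card_eq_one_iff_unique.2]; simp
    refine ⟨⟨fun a b => Subtype.ext (Subsingleton.elim _ _)⟩, ⟨⟨(1, 1, 1), ⟨Subsingleton.elim _ _, isUnit_one, Subsingleton.elim _ _, Subsingleton.elim _ _, rfl, fun _ => ⟨1, Subsingleton.elim _ _⟩⟩, ?_⟩⟩⟩
    simp
  · rw [Fm, nT, Nat.card_eq_zero.2]; simp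
    left
    refine ⟨fun ⟨⟨Θ, α, β⟩, ⟨h1, h2, h3, h4, h5, h6⟩, h7⟩ => ?_⟩
    obtain ⟨j, hj⟩ := h6 trivial
    have hu : IsUnit ((Θ * α)^j) := (h2.mul (isUnit_of_rank_add h7)).pow j
    rw [hj] at hu
    have : Nonempty (Fin m) := ⟨⟨0, by omega⟩⟩
    exact not_isUnit_zero hu

/-- total normalized count -/
noncomputable def Et (ε ε' η : F) (nil : Prop) (m : ℕ) : ℝ :=
  Nat.card {P : Matrix (Fin m) (Fin m) F × Matrix (Fin m) (Fin m) F × Matrix (Fin m) (Fin m) F // isT ε ε' η nil P.1 P.2.1 P.2.2} / gl F m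

theorem Et_sum (ε ε' η : F) (nil : Prop) (m : ℕ) : ∑ k ∈ Finset.range (m+1), Fm ε ε' η nil m k = Et ε ε' η nil m := by
  simp only [Fm]
  rw [← Finset.sum_div, Et]
  congr 1
  rw [card_fiber_range (fun P : {P : Matrix (Fin m) (Fin m) F × Matrix (Fin m) (Fin m) F × Matrix (Fin m) (Fin m) F // isT ε ε' η nil P.1 P.2.1 P.2.2} => m - P.1.2.1.rank) m (by intro x; omega)]
  push_cast
  refine Finset.sum_congr rfl fun k hk => ?_
  congr 1
  rw [nT]
  refine Nat.card_congr ((Equiv.subtypeSubtypeEquivSubtypeInter _ (fun P : Matrix (Fin m) (Fin m) F × Matrix (Fin m) (Fin m) F × Matrix (Fin m) (Fin m) F => m - P.2.1.rank = k)).trans (Equiv.subtypeEquivRight fun P => and_congr_right fun _ => ?_)).symm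
  have := P.2.1.rank_le_card_width
  simp at this hk ⊢
  omega

theorem Et_swap (ε ε' η : F) (m : ℕ) : Et ε ε' η False m = Et ε η ε' False m := by
  rw [Et, Et]
  congr 2
  refine Nat.card_congr (Equiv.subtypeEquiv (Equiv.prodCongr (Equiv.refl _) (Equiv.prodComm _ _)) ?_)
  rintro ⟨Θ, α, β⟩
  simp only [isT, Equiv.prodCongr_apply, Prod.map, Equiv.refl_apply, Equiv.prodComm_apply, Prod.swap]
  constructor
  · rintro ⟨h1, h2, h3, h4, h5, h6⟩; exact ⟨h1, h2, h4, h3, h5.symm, fun h => h.elim⟩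
  · rintro ⟨h1, h2, h3, h4, h5, h6⟩; exact ⟨h1, h2, h4, h3, h5.symm, fun h => h.elim⟩

section
variable {R : Type} [CommRing R] [Algebra ℝ R]

theorem GS_compare (h2 : (2:F) ≠ 0) {N : ℕ} {x : R} (hx : x^(N+1) = 0) (M : ℕ) : ∀ b, N + 1 ≤ b + 2*M →
    GG N x (Fm (-1:F) 1 (-1) False) (x^b) = GG N x (Fm (-1:F) 1 1 False) (x^b) * ∏ i ∈ Finset.range M, (1 - x^(2*(b+2*i+1))) := by
  induction M with
  | zero =>
    intro b hb
    rw [pow_zero_of_lt hx (by omega), GG_zero, GG_zero]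
    simp [Fm_SS']
  | succ M ih =>
    intro b hb
    rw [GS_rec h2 hx, GS'_rec h2 hx, show x^b*x*x = x^(b+2) by ring, ih (b+2) (by omega), Finset.prod_range_succ']
    have : ∏ i ∈ Finset.range M, (1 - x^(2*(b+2+2*i+1))) = ∏ i ∈ Finset.range M, (1 - x^(2*(b+2*(i+1)+1))) := by
      refine Finset.prod_congr rfl fun i _ => ?_
      ring
    rw [this]
    ring

theorem GP_prod (h2 : (2:F) ≠ 0) {N : ℕ} {x : R} (hx : x^(N+1) = 0) (M : ℕ) : ∀ b, N + 1 ≤ b + M →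
    GG N x (Fm (-1:F) (-1) 1 True) (x^b) = ∏ i ∈ Finset.range M, ev N (Wc (Fintype.card F)) (x^(b+i+1)) := by
  induction M with
  | zero =>
    intro b hb
    rw [pow_zero_of_lt hx (by omega), GG_zero]
    simp [Fm_nil_zero]
  | succ M ih =>
    intro b hb
    rw [GP_rec h2 hx, show x^b*x = x^(b+1) by ring, ih (b+1) (by omega), Finset.prod_range_succ', mul_comm]
    congr 1
    refine Finset.prod_congr rfl fun i _ => ?_
    congr 2; ring

/-- Key relation 1 -/
theorem E_S (h2 : (2:F) ≠ 0) {N : ℕ} {x : R} (hx : x^(N+1) = 0) :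
    ∑ m ∈ Finset.range (N+1), Et (-1:F) (-1) 1 False m • x^m =
      (∑ m ∈ Finset.range (N+1), Et (-1:F) 1 1 False m • x^m) * ∏ i ∈ Finset.range (N+1), (1 - x^(2*(2*i+1))) := by
  have := GS_compare h2 hx (N+1) 0 (by omega)
  rw [pow_zero, GG_one _ _ (fun m k h => Fm_lt _ _ _ _ h), GG_one _ _ (fun m k h => Fm_lt _ _ _ _ h)] at this
  simp only [Et_sum, zero_add] at this
  rw [← this]
  refine Finset.sum_congr rfl fun m _ => ?_
  rw [Et_swap]

theorem P_prod (h2 : (2:F) ≠ 0) {N : ℕ} {x : R} (hx : x^(N+1) = 0) :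
    ∑ m ∈ Finset.range (N+1), Et (-1:F) (-1) 1 True m • x^m = ∏ i ∈ Finset.range (N+1), ev N (Wc (Fintype.card F)) (x^(i+1)) := by
  have := GP_prod (F := F) h2 hx (N+1) 0 (by omega)
  rw [pow_zero, GG_one _ _ (fun m k h => Fm_lt _ _ _ _ h)] at this
  simpa only [Et_sum, zero_add] using this
end
end FF

open Matrix
set_option linter.all false

namespace FF
variable {F : Type} [Field F] [Fintype F]
variable {n m : Type} [Fintype n] [DecidableEq n] [Fintype m] [DecidableEq m]

/-- balanced triples `(X, ω, β)` -/
def isB (f : Polynomial F) (X w b : Matrix n n F) : Prop :=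
  wᵀ = -w ∧ IsUnit w ∧ bᵀ = b ∧ Xᵀ * w = w * X ∧ Xᵀ * b = b * X ∧ IsNilpotent (Polynomial.aeval X f)

noncomputable def nB (f : Polynomial F) (n : Type) [Fintype n] [DecidableEq n] : ℕ :=
  Nat.card {P : Matrix n n F × Matrix n n F × Matrix n n F // isB f P.1 P.2.1 P.2.2}

theorem isB_reindex (f : Polynomial F) (e : n ≃ m) (X w b : Matrix n n F) :
    isB f X w b ↔ isB f (Matrix.reindex e e X) (Matrix.reindex e e w) (Matrix.reindex e e b) := by
  have hm : ∀ A B : Matrix n n F, Matrix.reindex e e (A * B) = Matrix.reindex e e A * Matrix.reindex e e B := by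
    intro A B; exact (Matrix.reindexAlgEquiv F F e).map_mul A B
  have hneg : ∀ A : Matrix n n F, Matrix.reindex e e (-A) = - Matrix.reindex e e A := fun A => rfl
  have hn : ∀ A : Matrix n n F, IsNilpotent (Matrix.reindex e e A) ↔ IsNilpotent A := by
    intro A
    exact IsNilpotent.map_iff (f := (Matrix.reindexAlgEquiv F F e)) (Matrix.reindexAlgEquiv F F e).injective
  have hu : IsUnit (Matrix.reindex e e w) ↔ IsUnit w := Matrix.isUnit_submatrix_equiv _ _
  have ha : Polynomial.aeval (Matrix.reindex e e X) f = Matrix.reindex e e (Polynomial.aeval X f) :=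
    Polynomial.aeval_algHom_apply (Matrix.reindexAlgEquiv F F e).toAlgHom X f
  simp only [isB, transpose_reindex, ← hm, ← hneg, (Matrix.reindex e e).injective.eq_iff, ha, hn, hu]

theorem nB_reindex (f : Polynomial F) (e : n ≃ m) : nB f n = nB f m := by
  refine Nat.card_congr (Equiv.subtypeEquiv ((Matrix.reindex e e).prodCongr ((Matrix.reindex e e).prodCongr (Matrix.reindex e e))) ?_)
  rintro ⟨Θ, α, β⟩
  simp only [Equiv.prodCongr_apply, Prod.map]
  rw [isB_reindex f e]

theorem isT_B_aux {Θ α : Matrix n n F} (h1 : Θᵀ = -Θ) (h2 : IsUnit Θ) : (Θ⁻¹)ᵀ = -Θ⁻¹ ∧ IsUnit (Θ⁻¹) ∧ Θ⁻¹ * Θ = 1 ∧ Θ * Θ⁻¹ = 1 := by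
  have d := (Matrix.isUnit_iff_isUnit_det _).1 h2
  refine ⟨?_, ?_, nonsing_inv_mul _ d, mul_nonsing_inv _ d⟩
  · rw [transpose_nonsing_inv, h1]
    apply Matrix.inv_eq_left_inv
    rw [neg_mul_neg, nonsing_inv_mul _ d]
  · exact (Matrix.isUnit_nonsing_inv_iff).2 h2

theorem nT_nB (nil : Prop) (f : Polynomial F) (hf : ∀ X : Matrix n n F, IsNilpotent (Polynomial.aeval X f) ↔ (nil → IsNilpotent X)) :
    Nat.card {P : Matrix n n F × Matrix n n F × Matrix n n F // isT (-1:F) (-1) 1 nil P.1 P.2.1 P.2.2} = nB f n := by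
  rw [nB]
  have key : ∀ Θ α β : Matrix n n F, isT (-1:F) (-1) 1 nil Θ α β → isB f (Θ * α) Θ⁻¹ β := by
    rintro Θ α β ⟨h1, h2, h3, h4, h5, h6⟩
    simp only [neg_smul, one_smul] at h1 h3 h4
    obtain ⟨k1, k2, k3, k4⟩ := isT_B_aux (α := α) h1 h2
    refine ⟨k1, k2, h4, ?_, ?_, (hf _).2 h6⟩
    · rw [transpose_mul, h1, h3, neg_mul_neg, mul_assoc, k4, mul_one, ← mul_assoc, k3, one_mul]
    · rw [transpose_mul, h1, h3, neg_mul_neg, h5, mul_assoc]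
  have key2 : ∀ X w b : Matrix n n F, isB f X w b → isT (-1:F) (-1) 1 nil w⁻¹ (w * X) b := by
    rintro X w b ⟨h1, h2, h3, h4, h5, h6⟩
    obtain ⟨k1, k2, k3, k4⟩ := isT_B_aux (α := X) h1 h2
    refine ⟨by simpa using k1, k2, ?_, by simpa using h3, ?_, ?_⟩
    · rw [transpose_mul, h1, ← h4]; simp
    · rw [← h4, mul_assoc Xᵀ, k4, mul_one, h5, h4, mul_assoc, ← mul_assoc w⁻¹, k3, one_mul]
    · rw [← mul_assoc, k3, one_mul]
      exact (hf _).1 h6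
  refine Nat.card_congr ⟨fun P => ⟨(P.1.1 * P.1.2.1, P.1.1⁻¹, P.1.2.2), key _ _ _ P.2⟩, fun P => ⟨(P.1.2.1⁻¹, P.1.2.1 * P.1.1, P.1.2.2), key2 _ _ _ P.2⟩, ?_, ?_⟩
  · rintro ⟨⟨Θ, α, β⟩, h⟩
    have d := (Matrix.isUnit_iff_isUnit_det _).1 h.2.1
    refine Subtype.ext (Prod.ext ?_ (Prod.ext ?_ rfl))
    · exact nonsing_inv_nonsing_inv _ d
    · show Θ⁻¹ * (Θ * α) = α
      rw [← mul_assoc, nonsing_inv_mul _ d, one_mul]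
  · rintro ⟨⟨Θ, α, β⟩, h⟩
    have d := (Matrix.isUnit_iff_isUnit_det _).1 h.2.1
    refine Subtype.ext (Prod.ext ?_ (Prod.ext ?_ rfl))
    · show α⁻¹ * (α * Θ) = Θ
      rw [← mul_assoc, nonsing_inv_mul _ d, one_mul]
    · exact nonsing_inv_nonsing_inv _ d

theorem aeval_conj (g : GL n F) (X : Matrix n n F) (f : Polynomial F) :
    Polynomial.aeval (((g⁻¹ : GL n F) : Matrix n n F) * X * (g : Matrix n n F)) f = ((g⁻¹ : GL n F) : Matrix n n F) * Polynomial.aeval X f * (g : Matrix n n F) := by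
  have hgi : (g : Matrix n n F) * ((g⁻¹ : GL n F) : Matrix n n F) = 1 := by rw [← Units.val_mul]; simp
  have hig : ((g⁻¹ : GL n F) : Matrix n n F) * (g : Matrix n n F) = 1 := by rw [← Units.val_mul]; simp
  generalize ((g⁻¹ : GL n F) : Matrix n n F) = H at *
  generalize (g : Matrix n n F) = G at *
  induction f using Polynomial.induction_on' with
  | add p q hp hq => simp [hp, hq, mul_add, add_mul]
  | monomial k a =>
    have : ∀ k : ℕ, (H * X * G)^k = H * X^k * G := by
      intro k
      induction k with
      | zero => simp [hig]
      | succ k ih =>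
        rw [pow_succ, ih, pow_succ]
        calc H * X^k * G * (H * X * G) = H * X^k * (G * H) * X * G := by simp only [mul_assoc]
          _ = _ := by rw [hgi]; simp only [mul_assoc, one_mul]
    rw [Polynomial.aeval_monomial, Polynomial.aeval_monomial, this]
    simp [Algebra.algebraMap_eq_smul_one]

theorem isB_act {f : Polynomial F} (g : GL n F) {X w b : Matrix n n F} (h : isB f X w b) :
    isB f (((g⁻¹ : GL n F) : Matrix n n F) * X * (g : Matrix n n F)) ((g : Matrix n n F)ᵀ * w * (g : Matrix n n F)) ((g : Matrix n n F)ᵀ * b * (g : Matrix n n F)) := by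
  obtain ⟨h1, h2, h3, h4, h5, h6⟩ := h
  have hgi : (g : Matrix n n F) * ((g⁻¹ : GL n F) : Matrix n n F) = 1 := by rw [← Units.val_mul]; simp
  have hig : ((g⁻¹ : GL n F) : Matrix n n F) * (g : Matrix n n F) = 1 := by rw [← Units.val_mul]; simp
  have hGu : IsUnit (g : Matrix n n F) := g.isUnit
  have ha := aeval_conj g X f
  generalize hH : ((g⁻¹ : GL n F) : Matrix n n F) = H at *
  generalize hG : (g : Matrix n n F) = G at *
  have hgit : Hᵀ * Gᵀ = 1 := by rw [← transpose_mul, hgi]; simp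
  have hb : ∀ w, Xᵀ * w = w * X → (H * X * G)ᵀ * (Gᵀ * w * G) = Gᵀ * w * G * (H * X * G) := by
    intro w hw
    calc _ = Gᵀ * Xᵀ * (Hᵀ * Gᵀ) * w * G := by simp only [transpose_mul, mul_assoc]
      _ = Gᵀ * (Xᵀ * w) * G := by rw [hgit]; simp only [mul_assoc, one_mul]
      _ = Gᵀ * w * (G * H) * X * G := by rw [hw, hgi]; simp only [mul_assoc, one_mul]
      _ = _ := by simp only [mul_assoc]
  refine ⟨?_, ((Matrix.isUnit_transpose _).2 hGu |>.mul h2).mul hGu, ?_, hb _ h4, hb _ h5, ?_⟩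
  · simp [transpose_mul, h1, mul_assoc]
  · simp [transpose_mul, h3, mul_assoc]
  · rw [ha, mul_assoc]
    apply nilp_comm
    rw [mul_assoc, hgi, mul_one]
    exact h6

/-- action on triples -/
noncomputable def actB (g : GL n F) : (Matrix n n F × Matrix n n F × Matrix n n F) ≃ (Matrix n n F × Matrix n n F × Matrix n n F) :=
  have hgi : ∀ g : GL n F, (g : Matrix n n F) * ((g⁻¹ : GL n F) : Matrix n n F) = 1 := fun g => by rw [← Units.val_mul]; simp
  have hig : ∀ g : GL n F, ((g⁻¹ : GL n F) : Matrix n n F) * (g : Matrix n n F) = 1 := fun g => by rw [← Units.val_mul]; simp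
  have hgit : ∀ g : GL n F, ((g⁻¹ : GL n F) : Matrix n n F)ᵀ * (g : Matrix n n F)ᵀ = 1 := fun g => by rw [← transpose_mul, hgi]; simp
  have higt : ∀ g : GL n F, (g : Matrix n n F)ᵀ * ((g⁻¹ : GL n F) : Matrix n n F)ᵀ = 1 := fun g => by rw [← transpose_mul, hig]; simp
  { toFun := fun P => (((g⁻¹ : GL n F) : Matrix n n F) * P.1 * (g : Matrix n n F),
      (g : Matrix n n F)ᵀ * P.2.1 * (g : Matrix n n F), (g : Matrix n n F)ᵀ * P.2.2 * (g : Matrix n n F))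
    invFun := fun P => ((g : Matrix n n F) * P.1 * ((g⁻¹ : GL n F) : Matrix n n F),
      ((g⁻¹ : GL n F) : Matrix n n F)ᵀ * P.2.1 * ((g⁻¹ : GL n F) : Matrix n n F), ((g⁻¹ : GL n F) : Matrix n n F)ᵀ * P.2.2 * ((g⁻¹ : GL n F) : Matrix n n F))
    left_inv := by
      rintro ⟨Θ, α, β⟩
      refine (Prod.ext ?_ (Prod.ext ?_ ?_))
      · simp only [Matrix.mul_assoc, hgi, Matrix.mul_one]
        rw [← Matrix.mul_assoc, hgi, Matrix.one_mul]
      · simp only [Matrix.mul_assoc, hgi, Matrix.mul_one]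
        rw [← Matrix.mul_assoc, hgit, Matrix.one_mul]
      · simp only [Matrix.mul_assoc, hgi, Matrix.mul_one]
        rw [← Matrix.mul_assoc, hgit, Matrix.one_mul]
    right_inv := by
      rintro ⟨Θ, α, β⟩
      refine (Prod.ext ?_ (Prod.ext ?_ ?_))
      · simp only [Matrix.mul_assoc, hig, Matrix.mul_one]
        rw [← Matrix.mul_assoc, hig, Matrix.one_mul]
      · simp only [Matrix.mul_assoc, hig, Matrix.mul_one]
        rw [← Matrix.mul_assoc, higt, Matrix.one_mul]
      · simp only [Matrix.mul_assoc, hig, Matrix.mul_one]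
        rw [← Matrix.mul_assoc, higt, Matrix.one_mul] }

theorem isB_act_iff {f : Polynomial F} (g : GL n F) (P : Matrix n n F × Matrix n n F × Matrix n n F) :
    isB f (actB g P).1 (actB g P).2.1 (actB g P).2.2 ↔ isB f P.1 P.2.1 P.2.2 := by
  constructor
  · intro h
    have h1 := isB_act g⁻¹ h
    have h2 := (actB g).symm_apply_apply P
    rw [inv_inv] at h1
    rw [← h2]
    exact h1
  · intro h; exact isB_act g h

theorem nB_nf (f h : Polynomial F) (D : Matrix n n F) :
    Nat.card {P : Matrix n n F × Matrix n n F × Matrix n n F // isB f P.1 P.2.1 P.2.2 ∧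
        ∃ g : GL n F, ((g⁻¹ : GL n F) : Matrix n n F) * Polynomial.aeval P.1 h * (g : Matrix n n F) = D} *
      Nat.card {g : GL n F // (g : Matrix n n F) * D = D * (g : Matrix n n F)} =
    Nat.card (GL n F) * Nat.card {P : Matrix n n F × Matrix n n F × Matrix n n F // isB f P.1 P.2.1 P.2.2 ∧ Polynomial.aeval P.1 h = D} := by
  have hgi : ∀ g : GL n F, (g : Matrix n n F) * ((g⁻¹ : GL n F) : Matrix n n F) = 1 := fun g => by rw [← Units.val_mul]; simp
  have hig : ∀ g : GL n F, ((g⁻¹ : GL n F) : Matrix n n F) * (g : Matrix n n F) = 1 := fun g => by rw [← Units.val_mul]; simp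
  set Y := {P : Matrix n n F × Matrix n n F × Matrix n n F // isB f P.1 P.2.1 P.2.2 ∧
        ∃ g : GL n F, ((g⁻¹ : GL n F) : Matrix n n F) * Polynomial.aeval P.1 h * (g : Matrix n n F) = D} with hY
  have hinv : ∀ (g : GL n F) (P : Matrix n n F × Matrix n n F × Matrix n n F), (isB f P.1 P.2.1 P.2.2 ∧
        ∃ g : GL n F, ((g⁻¹ : GL n F) : Matrix n n F) * Polynomial.aeval P.1 h * (g : Matrix n n F) = D) ↔ (isB f (actB g P).1 (actB g P).2.1 (actB g P).2.2 ∧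
        ∃ g' : GL n F, ((g'⁻¹ : GL n F) : Matrix n n F) * Polynomial.aeval (actB g P).1 h * (g' : Matrix n n F) = D) := by
    intro g P
    rw [isB_act_iff]
    refine and_congr_right fun _ => ?_
    have e : Polynomial.aeval (actB g P).1 h = ((g⁻¹ : GL n F) : Matrix n n F) * Polynomial.aeval P.1 h * (g : Matrix n n F) := aeval_conj g P.1 h
    rw [e]
    constructor
    · rintro ⟨a, ha⟩
      refine ⟨g⁻¹ * a, ?_⟩
      rw [← ha, _root_.mul_inv_rev, inv_inv, Units.val_mul, Units.val_mul]
      calc _ = ((a⁻¹ : GL n F) : Matrix n n F) * ((g : Matrix n n F) * ((g⁻¹ : GL n F) : Matrix n n F)) * Polynomial.aeval P.1 h * ((g : Matrix n n F) * ((g⁻¹ : GL n F) : Matrix n n F)) * (a : Matrix n n F) := by simp only [mul_assoc]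
        _ = _ := by rw [hgi]; simp only [mul_assoc, one_mul]
    · rintro ⟨a, ha⟩
      refine ⟨g * a, ?_⟩
      rw [← ha, _root_.mul_inv_rev, Units.val_mul, Units.val_mul]
      simp only [mul_assoc]
  have := card_avg (G := GL n F) (X := Y) (Y := Y) (fun g => (actB g).subtypeEquiv (hinv g)) (fun P => Polynomial.aeval P.1.1 h = D)
    (Nat.card {g : GL n F // (g : Matrix n n F) * D = D * (g : Matrix n n F)}) ?_
  · rw [this]
    congr 1
    refine Nat.card_congr ((Equiv.subtypeSubtypeEquivSubtypeInter _ (fun P : Matrix n n F × Matrix n n F × Matrix n n F => Polynomial.aeval P.1 h = D)).trans (Equiv.subtypeEquivRight fun P => ?_))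
    constructor
    · rintro ⟨⟨h1, _⟩, h2⟩; exact ⟨h1, h2⟩
    · rintro ⟨h1, h2⟩; exact ⟨⟨h1, 1, by simpa using h2⟩, h2⟩
  · rintro ⟨P, hP, a, ha⟩
    refine Nat.card_congr (Equiv.subtypeEquiv (Equiv.mulLeft a⁻¹) ?_)
    intro g
    have e : Polynomial.aeval ((((actB g).subtypeEquiv (hinv g)) ⟨P, hP, a, ha⟩ : Y).1.1) h = ((g⁻¹ : GL n F) : Matrix n n F) * Polynomial.aeval P.1 h * (g : Matrix n n F) := aeval_conj g P.1 h
    rw [e]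
    simp only [Equiv.coe_mulLeft, Units.val_mul]
    have hP' : Polynomial.aeval P.1 h = (a : Matrix n n F) * D * ((a⁻¹ : GL n F) : Matrix n n F) := by
      rw [← ha]
      calc _ = ((a : Matrix n n F) * ((a⁻¹ : GL n F) : Matrix n n F)) * Polynomial.aeval P.1 h * ((a : Matrix n n F) * ((a⁻¹ : GL n F) : Matrix n n F)) := by rw [hgi]; simp
        _ = _ := by simp only [mul_assoc]
    rw [hP']
    constructor
    · intro h1
      conv_lhs => rw [← h1]
      conv_rhs => rw [← one_mul D, mul_assoc, ← mul_assoc D, ← hig a]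
      calc _ = ((a⁻¹ : GL n F) : Matrix n n F) * ((g : Matrix n n F) * ((g⁻¹ : GL n F) : Matrix n n F)) * (a : Matrix n n F) * D * ((a⁻¹ : GL n F) : Matrix n n F) * (g : Matrix n n F) := by simp only [mul_assoc]
        _ = _ := by rw [hgi]; simp only [mul_assoc, one_mul, mul_one]
    · intro h1
      calc _ = ((g⁻¹ : GL n F) : Matrix n n F) * (a : Matrix n n F) * (D * (((a⁻¹ : GL n F) : Matrix n n F) * (g : Matrix n n F))) := by simp only [mul_assoc]
        _ = ((g⁻¹ : GL n F) : Matrix n n F) * ((a : Matrix n n F) * ((a⁻¹ : GL n F) : Matrix n n F)) * (g : Matrix n n F) * D := by rw [← h1]; simp only [mul_assoc]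
        _ = D := by rw [hgi, mul_one, hig, one_mul]

end FF

open Matrix
set_option linter.all false

namespace FF
variable {F : Type} [Field F] [Fintype F]
variable {n m : Type} [Fintype n] [DecidableEq n] [Fintype m] [DecidableEq m]

theorem nilp_pow {F : Type} [Field F] {A : Matrix n n F} (h : IsNilpotent A) {M : ℕ} (hM : Fintype.card n ≤ M) : A ^ M = 0 := by
  have h1 := (Matrix.isNilpotent_charpoly_sub_pow_of_isNilpotent h).eq_zero
  have h2 := Matrix.aeval_self_charpoly A
  rw [sub_eq_zero.1 h1] at h2
  simp at h2
  exact pow_eq_zero_of_le hM h2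

theorem aeval_bal {X w : Matrix n n F} (h : Xᵀ * w = w * X) (f : Polynomial F) :
    (Polynomial.aeval X f)ᵀ * w = w * Polynomial.aeval X f := by
  induction f using Polynomial.induction_on' with
  | add p q hp hq => simp [hp, hq, mul_add, add_mul]
  | monomial k a =>
    have : ∀ k : ℕ, (X^k)ᵀ * w = w * X^k := by
      intro k
      induction k with
      | zero => simp
      | succ k ih => rw [pow_succ', transpose_mul, mul_assoc, h, ← mul_assoc, ih, mul_assoc, ← pow_succ, ← pow_succ']
    rw [Polynomial.aeval_monomial]
    simp only [Algebra.algebraMap_eq_smul_one, smul_mul_assoc, one_mul, transpose_smul, this, mul_smul_comm]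

section blocks
variable {a b : ℕ}

theorem aeval_blocks (X : Matrix (Fin a) (Fin a) F) (Y : Matrix (Fin b) (Fin b) F) (f : Polynomial F) :
    Polynomial.aeval (fromBlocks X 0 0 Y) f = fromBlocks (Polynomial.aeval X f) 0 0 (Polynomial.aeval Y f) := by
  induction f using Polynomial.induction_on' with
  | add p q hp hq => simp [hp, hq, fromBlocks_add]
  | monomial k a =>
    have : ∀ k : ℕ, (fromBlocks X 0 0 Y)^k = fromBlocks (X^k) 0 0 (Y^k) := by
      intro k
      induction k with
      | zero => simp [fromBlocks_one]
      | succ k ih => rw [pow_succ, ih, fromBlocks_multiply]; simp [pow_succ]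
    rw [Polynomial.aeval_monomial, this]
    simp [Algebra.algebraMap_eq_smul_one, fromBlocks_smul]

theorem comm_D (M : Matrix (Fin a ⊕ Fin b) (Fin a ⊕ Fin b) F) (h : M * fromBlocks 1 0 0 0 = fromBlocks 1 0 0 0 * M) :
    M = fromBlocks M.toBlocks₁₁ 0 0 M.toBlocks₂₂ := by
  rw [← fromBlocks_toBlocks M, fromBlocks_multiply, fromBlocks_multiply, fromBlocks_inj] at h
  simp at h
  conv_lhs => rw [← fromBlocks_toBlocks M, h.2, ← h.1]

theorem card_cent_D : Nat.card {g : GL (Fin a ⊕ Fin b) F // (g : Matrix (Fin a ⊕ Fin b) (Fin a ⊕ Fin b) F) * fromBlocks 1 0 0 0 = fromBlocks 1 0 0 0 * (g : Matrix (Fin a ⊕ Fin b) (Fin a ⊕ Fin b) F)} = gl F a * gl F b := by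
  rw [gl, gl, ← Nat.card_prod, Nat.card_congr ((glEquiv (Fin a)).prodCongr (glEquiv (F := F) (Fin b)))]
  refine (Nat.card_congr (Equiv.subtypeEquiv (q := fun g : {M : Matrix (Fin a ⊕ Fin b) (Fin a ⊕ Fin b) F // IsUnit M} => g.1 * fromBlocks 1 0 0 0 = fromBlocks 1 0 0 0 * g.1) (glEquiv (F := F) (Fin a ⊕ Fin b)) (fun g => Iff.rfl))).trans ?_
  symm
  have hu : ∀ (A : Matrix (Fin a) (Fin a) F) (B : Matrix (Fin b) (Fin b) F), IsUnit (fromBlocks A 0 0 B) ↔ IsUnit A ∧ IsUnit B := by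
    intro A B
    rw [Matrix.isUnit_fromBlocks_zero₁₂]
  refine Nat.card_congr (Equiv.ofBijective (fun P => ⟨⟨fromBlocks P.1.1 0 0 P.2.1, (hu _ _).2 ⟨P.1.2, P.2.2⟩⟩, ?_⟩) ⟨?_, ?_⟩)
  · simp [fromBlocks_multiply]
  · rintro ⟨⟨A, hA⟩, ⟨B, hB⟩⟩ ⟨⟨A', hA'⟩, ⟨B', hB'⟩⟩ h
    simp only [Subtype.mk.injEq, fromBlocks_inj] at h
    obtain ⟨rfl, -, -, rfl⟩ := h
    rfl
  · rintro ⟨⟨M, hM⟩, h⟩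
    have e := comm_D M h
    rw [e, hu] at hM
    exact ⟨(⟨_, hM.1⟩, ⟨_, hM.2⟩), Subtype.ext (Subtype.ext e.symm)⟩

theorem idem_nf (p : Matrix (Fin a ⊕ Fin b) (Fin a ⊕ Fin b) F) (hp : p * p = p) :
    (∃ g : GL (Fin a ⊕ Fin b) F, ((g⁻¹ : GL (Fin a ⊕ Fin b) F) : Matrix (Fin a ⊕ Fin b) (Fin a ⊕ Fin b) F) * p * (g : Matrix (Fin a ⊕ Fin b) (Fin a ⊕ Fin b) F) = fromBlocks 1 0 0 0) ↔ p.rank = a := by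
  have hgi : ∀ g : GL (Fin a ⊕ Fin b) F, (g : Matrix (Fin a ⊕ Fin b) (Fin a ⊕ Fin b) F) * ((g⁻¹ : GL (Fin a ⊕ Fin b) F) : Matrix (Fin a ⊕ Fin b) (Fin a ⊕ Fin b) F) = 1 := fun g => by rw [← Units.val_mul]; simp
  have hig : ∀ g : GL (Fin a ⊕ Fin b) F, ((g⁻¹ : GL (Fin a ⊕ Fin b) F) : Matrix (Fin a ⊕ Fin b) (Fin a ⊕ Fin b) F) * (g : Matrix (Fin a ⊕ Fin b) (Fin a ⊕ Fin b) F) = 1 := fun g => by rw [← Units.val_mul]; simp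
  constructor
  · rintro ⟨g, hg⟩
    have h1 := rank_mul_eq_left_of_isUnit_det (g : Matrix (Fin a ⊕ Fin b) (Fin a ⊕ Fin b) F) (((g⁻¹ : GL (Fin a ⊕ Fin b) F) : Matrix (Fin a ⊕ Fin b) (Fin a ⊕ Fin b) F) * p) ((Matrix.isUnit_iff_isUnit_det _).1 g.isUnit)
    rw [rank_mul_eq_right_of_isUnit_det _ _ ((Matrix.isUnit_iff_isUnit_det _).1 (g⁻¹).isUnit), hg] at h1
    rw [← h1]
    have h2 : (fromBlocks 1 0 0 0 : Matrix (Fin a ⊕ Fin b) (Fin a ⊕ Fin b) F) = fromRows (1 : Matrix (Fin a) (Fin a) F) (0 : Matrix (Fin b) (Fin a) F) * fromCols (1 : Matrix (Fin a) (Fin a) F) 0 := by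
      rw [fromRows_mul_fromCols]; simp
    have h3 : fromCols (1 : Matrix (Fin a) (Fin a) F) (0 : Matrix (Fin a) (Fin b) F) * fromRows (1 : Matrix (Fin a) (Fin a) F) (0 : Matrix (Fin b) (Fin a) F) = 1 := by
      rw [fromCols_mul_fromRows]; simp
    apply le_antisymm
    · rw [h2]
      refine (rank_mul_le_right _ _).trans ((rank_le_card_height _).trans (by simp))
    · have h4 : fromCols (1 : Matrix (Fin a) (Fin a) F) (0 : Matrix (Fin a) (Fin b) F) * (fromBlocks 1 0 0 0 : Matrix (Fin a ⊕ Fin b) (Fin a ⊕ Fin b) F) * fromRows (1 : Matrix (Fin a) (Fin a) F) (0 : Matrix (Fin b) (Fin a) F) = 1 := by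
        rw [h2, ← Matrix.mul_assoc, h3, Matrix.one_mul, h3]
      have h5 := congrArg Matrix.rank h4
      rw [rank_one, Fintype.card_fin] at h5
      calc a = _ := h5.symm
        _ ≤ _ := (rank_mul_le_left _ _).trans (rank_mul_le_right _ _)
  · intro h
    obtain ⟨g, Y, hg, hY⟩ := exists_adapt p h
    obtain ⟨Y', hY'⟩ : ∃ Y', Y' = ((g⁻¹ : GL (Fin a ⊕ Fin b) F) : Matrix (Fin a ⊕ Fin b) (Fin a ⊕ Fin b) F) * Y := ⟨_, rfl⟩
    set p' := ((g⁻¹ : GL (Fin a ⊕ Fin b) F) : Matrix (Fin a ⊕ Fin b) (Fin a ⊕ Fin b) F) * p * (g : Matrix (Fin a ⊕ Fin b) (Fin a ⊕ Fin b) F) with hp'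
    have h1 : p' = fromCols Y' 0 := by
      rw [hp', mul_assoc, hg, mul_fromCols, hY']; simp
    have h2 : p' * p' = p' := by
      calc p' * p' = ((g⁻¹ : GL (Fin a ⊕ Fin b) F) : Matrix (Fin a ⊕ Fin b) (Fin a ⊕ Fin b) F) * p * ((g : Matrix (Fin a ⊕ Fin b) (Fin a ⊕ Fin b) F) * ((g⁻¹ : GL (Fin a ⊕ Fin b) F) : Matrix (Fin a ⊕ Fin b) (Fin a ⊕ Fin b) F)) * p * (g : Matrix (Fin a ⊕ Fin b) (Fin a ⊕ Fin b) F) := by rw [hp']; simp only [mul_assoc]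
        _ = ((g⁻¹ : GL (Fin a ⊕ Fin b) F) : Matrix (Fin a ⊕ Fin b) (Fin a ⊕ Fin b) F) * (p * p) * (g : Matrix (Fin a ⊕ Fin b) (Fin a ⊕ Fin b) F) := by rw [hgi]; simp only [mul_assoc, mul_one, one_mul]
        _ = p' := by rw [hp]
    have hY'inj : Function.Injective Y'.mulVec := by
      intro u v huv
      apply hY
      have : (g : Matrix (Fin a ⊕ Fin b) (Fin a ⊕ Fin b) F) * Y' = Y := by rw [hY', ← Matrix.mul_assoc, hgi, Matrix.one_mul]
      rw [← this, ← mulVec_mulVec, ← mulVec_mulVec, huv]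
    rw [← fromRows_toRows Y'] at h1
    rw [← fromRows_toRows Y'] at hY'inj
    generalize Y'.toRows₁ = A at *
    generalize Y'.toRows₂ = C at *
    have h3 : p' = fromBlocks A 0 C 0 := by
      rw [h1]; ext i j; rcases i with i | i <;> rcases j with j | j <;> rfl
    rw [h3, fromBlocks_multiply, fromBlocks_inj] at h2
    simp at h2
    have hA : A = 1 := by
      have h4 : fromRows A C * A = fromRows A C * (1 : Matrix (Fin a) (Fin a) F) := by
        rw [fromRows_mul, h2.1, h2.2, Matrix.mul_one]
      ext i j
      have h5 := hY'inj (a₁ := A.mulVec (Pi.single j 1)) (a₂ := (1 : Matrix (Fin a) (Fin a) F).mulVec (Pi.single j 1)) (by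
        show (fromRows A C).mulVec (A.mulVec _) = (fromRows A C).mulVec (Matrix.mulVec 1 _)
        rw [mulVec_mulVec, mulVec_mulVec, h4])
      simpa using congrFun h5 i
    subst hA
    let U : GL (Fin a ⊕ Fin b) F := ⟨fromBlocks 1 0 C 1, fromBlocks 1 0 (-C) 1, by simp [fromBlocks_multiply, fromBlocks_one], by simp [fromBlocks_multiply, fromBlocks_one]⟩
    refine ⟨g * U, ?_⟩
    rw [_root_.mul_inv_rev, Units.val_mul, Units.val_mul]
    calc _ = ((U⁻¹ : GL (Fin a ⊕ Fin b) F) : Matrix (Fin a ⊕ Fin b) (Fin a ⊕ Fin b) F) * p' * (U : Matrix (Fin a ⊕ Fin b) (Fin a ⊕ Fin b) F) := by rw [hp']; simp only [mul_assoc]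
      _ = fromBlocks 1 0 (-C) 1 * p' * fromBlocks 1 0 C 1 := rfl
      _ = _ := by rw [h3]; simp [fromBlocks_multiply]

variable {f g u v : Polynomial F} {M : ℕ}

theorem isB_blocks (huv : u * f^M + v * g^M = 1) (ha : a ≤ M) (hb : b ≤ M) (hab : a + b ≤ M) (X w β : Matrix (Fin a) (Fin a) F) (Y z γ : Matrix (Fin b) (Fin b) F) :
    (isB (f*g) (fromBlocks X 0 0 Y) (fromBlocks w 0 0 z) (fromBlocks β 0 0 γ) ∧ Polynomial.aeval (fromBlocks X 0 0 Y) (v * g^M) = fromBlocks 1 0 0 0) ↔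
      (isB f X w β ∧ isB g Y z γ) := by
  have hn : IsNilpotent (Polynomial.aeval (fromBlocks X 0 0 Y) (f*g)) ∧ Polynomial.aeval (fromBlocks X 0 0 Y) (v * g^M) = fromBlocks 1 0 0 0 ↔
      IsNilpotent (Polynomial.aeval X f) ∧ IsNilpotent (Polynomial.aeval Y g) := by
    rw [aeval_blocks, aeval_blocks, fromBlocks_inj]
    constructor
    · rintro ⟨h1, h2, -, -, h3⟩
      have h4 := nilp_pow h1 (M := M) (by simpa using hab)
      rw [← aeval_blocks, ← map_pow, aeval_blocks, ← fromBlocks_zero, fromBlocks_inj] at h4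
      constructor
      · refine ⟨M, ?_⟩
        calc (Polynomial.aeval X f)^M = (Polynomial.aeval X f)^M * Polynomial.aeval X (v * g^M) := by rw [h2, mul_one]
          _ = Polynomial.aeval X (v * (f*g)^M) := by rw [← map_pow, ← map_mul]; congr 1; ring
          _ = 0 := by rw [map_mul, h4.1, mul_zero]
      · refine ⟨M, ?_⟩
        calc (Polynomial.aeval Y g)^M = Polynomial.aeval Y (g^M * (v * g^M)) + Polynomial.aeval Y (u * (f*g)^M) := by rw [← map_pow, ← map_add]; congr 1; linear_combination -g^M * huv
          _ = 0 := by rw [map_mul, map_mul _ u, h4.2.2.2, h3]; simp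
    · rintro ⟨h1, h2⟩
      have h3 := nilp_pow h1 (M := M) (by simpa using ha)
      have h4 := nilp_pow h2 (M := M) (by simpa using hb)
      rw [← map_pow] at h3 h4
      refine ⟨⟨M, ?_⟩, ?_, rfl, rfl, ?_⟩
      · rw [← aeval_blocks, ← map_pow, aeval_blocks, mul_pow, map_mul, map_mul, h3, h4]
        simp [fromBlocks_zero]
      · rw [show v * g^M = 1 - u * f^M by rw [← huv]; ring, map_sub, map_mul, h3]; simp
      · rw [map_mul, h4, mul_zero]
  have hu : IsUnit (fromBlocks w 0 0 z) ↔ IsUnit w ∧ IsUnit z := by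
    rw [Matrix.isUnit_fromBlocks_zero₁₂]
  simp only [isB, and_assoc, hn, hu, fromBlocks_transpose, fromBlocks_multiply, fromBlocks_neg, fromBlocks_inj]
  simp
  tauto

theorem nB_blocks (huv : u * f^M + v * g^M = 1) (ha : a ≤ M) (hb : b ≤ M) (hab : a + b ≤ M) :
    Nat.card {P : Matrix (Fin a ⊕ Fin b) (Fin a ⊕ Fin b) F × Matrix (Fin a ⊕ Fin b) (Fin a ⊕ Fin b) F × Matrix (Fin a ⊕ Fin b) (Fin a ⊕ Fin b) F // isB (f*g) P.1 P.2.1 P.2.2 ∧ Polynomial.aeval P.1 (v * g^M) = fromBlocks 1 0 0 0} = nB f (Fin a) * nB g (Fin b) := by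
  rw [nB, nB, ← Nat.card_prod]
  symm
  refine Nat.card_congr (Equiv.ofBijective (fun P => ⟨(fromBlocks P.1.1.1 0 0 P.2.1.1, fromBlocks P.1.1.2.1 0 0 P.2.1.2.1, fromBlocks P.1.1.2.2 0 0 P.2.1.2.2), (isB_blocks huv ha hb hab _ _ _ _ _ _).2 ⟨P.1.2, P.2.2⟩⟩) ⟨?_, ?_⟩)
  · rintro ⟨⟨⟨X, w, β⟩, h⟩, ⟨⟨Y, z, γ⟩, k⟩⟩ ⟨⟨⟨X', w', β'⟩, h'⟩, ⟨⟨Y', z', γ'⟩, k'⟩⟩ e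
    simp only [Subtype.mk.injEq, fromBlocks_inj, Prod.mk.injEq] at e
    obtain ⟨⟨rfl, -, -, rfl⟩, ⟨rfl, -, -, rfl⟩, ⟨rfl, -, -, rfl⟩⟩ := e
    rfl
  · rintro ⟨⟨X, w, β⟩, h⟩
    have hD : (fromBlocks 1 0 0 0 : Matrix (Fin a ⊕ Fin b) (Fin a ⊕ Fin b) F)ᵀ = fromBlocks 1 0 0 0 := by simp [fromBlocks_transpose]
    have hX := comm_D X (by 
      have hc := ((Polynomial.commute_X (v * g^M)).map (Polynomial.aeval X)).eq
      rw [Polynomial.aeval_X] at hc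
      have h2 : Polynomial.aeval X (v * g^M) = fromBlocks 1 0 0 0 := h.2
      rw [h2] at hc
      exact hc)
    have hw := comm_D w (by
      have := aeval_bal h.1.2.2.2.1 (v * g^M)
      rw [h.2, hD] at this
      exact this.symm)
    have hβ := comm_D β (by
      have := aeval_bal h.1.2.2.2.2.1 (v * g^M)
      rw [h.2, hD] at this
      exact this.symm)
    have h' := h
    simp only at h'
    rw [hX, hw, hβ, isB_blocks huv ha hb hab] at h'
    refine ⟨(⟨(_, _, _), h'.1⟩, ⟨(_, _, _), h'.2⟩), Subtype.ext (Prod.ext hX.symm (Prod.ext hw.symm hβ.symm))⟩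

end blocks

/-- normalized counts -/
noncomputable def eB (f : Polynomial F) (m : ℕ) : ℝ := nB f (Fin m) / gl F m

theorem eB_mul {f g : Polynomial F} (hfg : IsCoprime f g) (m : ℕ) :
    eB (f*g) m = ∑ p ∈ Finset.HasAntidiagonal.antidiagonal m, eB f p.1 * eB g p.2 := by
  have g0 (i : ℕ) : (gl F i : ℝ) ≠ 0 := by exact_mod_cast (gl_pos i).ne'
  obtain ⟨u, v, huv⟩ := hfg.pow (m := m) (n := m)
  set h := v * g^m with hh
  have key : ∀ a b, a + b = m → (Nat.card {P : Matrix (Fin m) (Fin m) F × Matrix (Fin m) (Fin m) F × Matrix (Fin m) (Fin m) F // isB (f*g) P.1 P.2.1 P.2.2 ∧ (Polynomial.aeval P.1 h).rank = a} : ℝ) = gl F m * (eB f a * eB g b) := by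
    intro a b hab
    have e1 : Nat.card {P : Matrix (Fin m) (Fin m) F × Matrix (Fin m) (Fin m) F × Matrix (Fin m) (Fin m) F // isB (f*g) P.1 P.2.1 P.2.2 ∧ (Polynomial.aeval P.1 h).rank = a} =
        Nat.card {P : Matrix (Fin a ⊕ Fin b) (Fin a ⊕ Fin b) F × Matrix (Fin a ⊕ Fin b) (Fin a ⊕ Fin b) F × Matrix (Fin a ⊕ Fin b) (Fin a ⊕ Fin b) F // isB (f*g) P.1 P.2.1 P.2.2 ∧ ∃ g : GL (Fin a ⊕ Fin b) F, ((g⁻¹ : GL (Fin a ⊕ Fin b) F) : Matrix (Fin a ⊕ Fin b) (Fin a ⊕ Fin b) F) * Polynomial.aeval P.1 h * (g : Matrix (Fin a ⊕ Fin b) (Fin a ⊕ Fin b) F) = fromBlocks 1 0 0 0} := by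
      have e : Fin m ≃ Fin a ⊕ Fin b := (finCongr hab.symm).trans finSumFinEquiv.symm
      refine Nat.card_congr (Equiv.subtypeEquiv ((Matrix.reindex e e).prodCongr ((Matrix.reindex e e).prodCongr (Matrix.reindex e e))) ?_)
      rintro ⟨X, w, β⟩
      simp only [Equiv.prodCongr_apply, Prod.map]
      rw [isB_reindex _ e]
      refine and_congr_right fun hB => ?_
      rw [idem_nf]
      · have ha : Polynomial.aeval (Matrix.reindex e e X) h = Matrix.reindex e e (Polynomial.aeval X h) :=
          Polynomial.aeval_algHom_apply (Matrix.reindexAlgEquiv F F e).toAlgHom X h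
        rw [ha, rank_reindex]
      · have h0 := nilp_pow hB.2.2.2.2.2 (M := m) (by simp [hab])
        rw [← map_mul, show h * h = h - (u * v) * (f*g)^m by linear_combination h * huv, map_sub, map_mul _ (u*v), map_pow, h0]
        simp
    rw [e1]
    have e2 := nB_nf (f*g) h (fromBlocks 1 0 0 0 : Matrix (Fin a ⊕ Fin b) (Fin a ⊕ Fin b) F)
    rw [card_cent_D, nB_blocks huv (by omega) (by omega) (by omega), card_gl_sum, hab] at e2
    have e3 := congrArg (Nat.cast (R := ℝ)) e2
    simp only [Nat.cast_mul] at e3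
    rw [eB, eB]
    have := g0 a; have := g0 b
    field_simp
    linear_combination e3
  rw [eB, nB, card_fiber_range (fun P : {P : Matrix (Fin m) (Fin m) F × Matrix (Fin m) (Fin m) F × Matrix (Fin m) (Fin m) F // isB (f*g) P.1 P.2.1 P.2.2} => (Polynomial.aeval P.1.1 h).rank) m (fun P => by simpa using (Polynomial.aeval P.1.1 h).rank_le_card_width)]
  rw [Finset.Nat.sum_antidiagonal_eq_sum_range_succ (fun i j => eB f i * eB g j)]
  rw [Nat.cast_sum, Finset.sum_div]
  refine Finset.sum_congr rfl fun a ha => ?_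
  rw [div_eq_iff (g0 m), Nat.card_congr (Equiv.subtypeSubtypeEquivSubtypeInter _ (fun P : Matrix (Fin m) (Fin m) F × Matrix (Fin m) (Fin m) F × Matrix (Fin m) (Fin m) F => (Polynomial.aeval P.1 h).rank = a)), key a (m - a) (by simp at ha; omega)]
  ring

end FF

open Matrix
set_option linter.all false

namespace FF
variable {F : Type} [Field F] [Fintype F]

theorem eB_one (m : ℕ) : eB (1 : Polynomial F) m = if m = 0 then 1 else 0 := by
  split_ifs with h
  · subst h
    rw [eB, gl_zero]
    have : nB (1 : Polynomial F) (Fin 0) = 1 := by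
      rw [nB, Nat.card_eq_one_iff_unique]
      refine ⟨⟨fun a b => Subtype.ext (Subsingleton.elim _ _)⟩, ⟨⟨(0, 0, 0), ?_⟩⟩⟩
      exact ⟨Subsingleton.elim _ _, ⟨1, Subsingleton.elim _ _⟩, Subsingleton.elim _ _, Subsingleton.elim _ _, Subsingleton.elim _ _, ⟨1, Subsingleton.elim _ _⟩⟩
    rw [this]; simp
  · rw [eB]
    have : nB (1 : Polynomial F) (Fin m) = 0 := by
      rw [nB]
      have : Nonempty (Fin m) := ⟨⟨0, by omega⟩⟩
      have : IsEmpty {P : Matrix (Fin m) (Fin m) F × Matrix (Fin m) (Fin m) F × Matrix (Fin m) (Fin m) F // isB (1 : Polynomial F) P.1 P.2.1 P.2.2} := by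
        refine ⟨fun P => ?_⟩
        have := P.2.2.2.2.2.2
        rw [map_one] at this
        exact not_isNilpotent_one this
      simp
    rw [this]; simp

variable {R : Type} [CommRing R] [Algebra ℝ R]

theorem genB_prod {N : ℕ} {x : R} (hx : x^(N+1) = 0) (S : Finset (Polynomial F))
    (hS : ∀ a ∈ S, ∀ b ∈ S, a ≠ b → IsCoprime a b) :
    ∑ m ∈ Finset.range (N+1), eB (∏ φ ∈ S, φ) m • x^m = ∏ φ ∈ S, ∑ m ∈ Finset.range (N+1), eB φ m • x^m := by
  classical
  induction S using Finset.induction_on with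
  | empty =>
    simp only [Finset.prod_empty, eB_one]
    rw [Finset.sum_eq_single_of_mem 0 (by simp)]
    · simp
    · intro b _ hb; simp [hb]
  | insert a S ha ih =>
    rw [Finset.prod_insert ha, Finset.prod_insert ha, ← ih (fun b hb c hc => hS b (by simp [hb]) c (by simp [hc]))]
    have hc : IsCoprime a (∏ φ ∈ S, φ) := by
      refine IsCoprime.prod_right fun b hb => hS a (by simp) b (by simp [hb]) ?_
      rintro rfl; exact ha hb
    have := conv_trunc hx (fun i => eB a i • (1:R)) (fun i => eB (∏ φ ∈ S, φ) i • (1:R))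
    simp only [smul_mul_assoc, one_mul] at this
    rw [mul_comm (∑ m ∈ Finset.range (N+1), eB a m • x^m), ← this]
    refine Finset.sum_congr rfl fun m _ => ?_
    rw [eB_mul hc, Finset.sum_smul, Finset.mul_sum]
    refine Finset.sum_congr rfl fun p _ => ?_
    simp [smul_smul]

theorem PR_finite (F : Type) [Field F] [Fintype F] (N : ℕ) : {φ : Polynomial F | φ.Monic ∧ Irreducible φ ∧ φ.natDegree ≤ N}.Finite := by
  apply Set.Finite.of_finite_image (f := fun φ => fun i : Fin (N+1) => φ.coeff i) (Set.toFinite _)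
  rintro φ ⟨_, _, h1⟩ ψ ⟨_, _, h2⟩ h
  ext i
  by_cases hi : i < N + 1
  · exact congrFun h ⟨i, hi⟩
  · rw [Polynomial.coeff_eq_zero_of_natDegree_lt (by omega), Polynomial.coeff_eq_zero_of_natDegree_lt (by omega)]

noncomputable def PR (F : Type) [Field F] [Fintype F] (N : ℕ) : Finset (Polynomial F) := (PR_finite F N).toFinset

theorem mem_PR {N : ℕ} {φ : Polynomial F} : φ ∈ PR F N ↔ φ.Monic ∧ Irreducible φ ∧ φ.natDegree ≤ N := by
  simp [PR]

theorem PR_coprime {N : ℕ} : ∀ a ∈ PR F N, ∀ b ∈ PR F N, a ≠ b → IsCoprime a b := by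
  intro a ha b hb hab
  rw [mem_PR] at ha hb
  rcases (EuclideanDomain.dvd_or_coprime a b ha.2.1).symm with h | h
  · exact h
  · exact absurd (Polynomial.eq_of_monic_of_associated ha.1 hb.1 ((ha.2.1.dvd_irreducible_iff_associated hb.2.1).1 h)) hab

theorem dvd_pow_of_irred (f p : Polynomial F) (hp : p ≠ 0) (h : ∀ r, Irreducible r → r ∣ p → r ∣ f) : ∃ k, p ∣ f^k := by
  induction p using WfDvdMonoid.induction_on_irreducible with
  | zero => exact absurd rfl hp
  | unit u hu => exact ⟨0, by simpa using hu.dvd⟩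
  | mul a i ha hi ih =>
    obtain ⟨k, hk⟩ := ih ha (fun r hr hra => h r hr (hra.mul_left _))
    exact ⟨k+1, by rw [pow_succ']; exact mul_dvd_mul (h i hi (dvd_mul_right _ _)) hk⟩

theorem aeval_PR_nilp {N m : ℕ} (hm : m ≤ N) (X : Matrix (Fin m) (Fin m) F) : IsNilpotent (Polynomial.aeval X (∏ φ ∈ PR F N, φ)) := by
  classical
  obtain ⟨k, hk⟩ := dvd_pow_of_irred (∏ φ ∈ PR F N, φ) X.charpoly X.charpoly_monic.ne_zero (by
    intro r hr hd
    have hr0 := hr.ne_zero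
    have h1 : normalize r ∈ PR F N := by
      rw [mem_PR]
      refine ⟨Polynomial.monic_normalize hr0, (associated_normalize r).irreducible hr, ?_⟩
      have h2 := Polynomial.natDegree_le_of_dvd ((normalize_associated r).dvd.trans hd) X.charpoly_monic.ne_zero
      rw [Matrix.charpoly_natDegree_eq_dim, Fintype.card_fin] at h2
      exact h2.trans hm
    exact (associated_normalize r).dvd.trans (Finset.dvd_prod_of_mem (fun φ => φ) h1))
  refine ⟨k, ?_⟩
  obtain ⟨c, hc⟩ := hk
  rw [← map_pow, hc, map_mul, Matrix.aeval_self_charpoly, zero_mul]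

theorem Et_False {N m : ℕ} (hm : m ≤ N) : Et (-1:F) (-1) 1 False m = eB (∏ φ ∈ PR F N, φ) m := by
  rw [Et, eB, nT_nB False (∏ φ ∈ PR F N, φ)]
  intro X
  simp [aeval_PR_nilp hm X]

theorem Et_True (m : ℕ) : Et (-1:F) (-1) 1 True m = eB (Polynomial.X : Polynomial F) m := by
  rw [Et, eB, nT_nB True Polynomial.X]
  intro X
  simp

theorem gen_False {N : ℕ} {x : R} (hx : x^(N+1) = 0) :
    ∑ m ∈ Finset.range (N+1), Et (-1:F) (-1) 1 False m • x^m = ∏ φ ∈ PR F N, ∑ m ∈ Finset.range (N+1), eB φ m • x^m := by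
  rw [← genB_prod hx _ PR_coprime]
  refine Finset.sum_congr rfl fun m hm => ?_
  rw [Et_False (by simp at hm; omega)]

end FF

open Matrix
set_option linter.all false

namespace FF
variable {F : Type} [Field F] [Fintype F]

theorem aeval_pow_card {F : Type} [Field F] [Fintype F] {A : Type} [Ring A] [Algebra F A] (f : Polynomial F) (k : ℕ) (a : A) :
    Polynomial.aeval (a^(Fintype.card F^k)) f = (Polynomial.aeval a f)^(Fintype.card F^k) := by
  induction k with
  | zero => simp
  | succ k ih => rw [pow_succ, pow_mul, ← Polynomial.expand_aeval, FiniteField.expand_card, map_pow, ih, ← pow_mul]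

section tower
variable {K : Type} [Field K] [Fintype K] [Algebra F K] {ι : Type} [Fintype ι] [DecidableEq ι] (b : Module.Basis ι F K)
variable {n : Type} [Fintype n] [DecidableEq n]

/-- restriction of scalars -/
noncomputable def Phi (n : Type) [Fintype n] [DecidableEq n] : Matrix n n K →ₐ[F] Matrix (n × ι) (n × ι) F :=
  (Matrix.compAlgEquiv n ι F F).toAlgHom.comp (Algebra.leftMulMatrix b).mapMatrix

theorem Phi_apply (M : Matrix n n K) (i j : n) (a c : ι) : Phi b n M (i, a) (j, c) = Algebra.leftMulMatrix b (M i j) a c := rfl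

theorem Phi_inj : Function.Injective (Phi b n) := by
  intro M N h
  ext i j
  apply Algebra.leftMulMatrix_injective b
  ext a c
  rw [← Phi_apply, ← Phi_apply, h]

noncomputable def Lam (n : Type) [Fintype n] [DecidableEq n] : Matrix (n × ι) (n × ι) F :=
  Matrix.compRingEquiv n ι F (Matrix.scalar n (Algebra.traceMatrix F b))

theorem Lam_unit : IsUnit (Lam b n) := by
  have h1 : IsUnit (Algebra.traceMatrix F b) := by
    rw [Matrix.isUnit_iff_isUnit_det, isUnit_iff_ne_zero, Algebra.traceMatrix_of_basis]
    have : FiniteDimensional F K := b.finiteDimensional_of_finite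
    exact det_traceForm_ne_zero b
  exact (h1.map (Matrix.scalar n)).map (Matrix.compRingEquiv n ι F)

theorem tr_bal (y : K) : (Algebra.leftMulMatrix b y)ᵀ * Algebra.traceMatrix F b = Algebra.traceMatrix F b * Algebra.leftMulMatrix b y := by
  have h : ∀ i j, (Algebra.traceMatrix F b * Algebra.leftMulMatrix b y) i j = Algebra.trace F K (y * b i * b j) := by
    intro i j
    rw [Matrix.mul_apply]
    conv_rhs => rw [show y * b i * b j = b i * (y * b j) by ring, ← b.sum_repr (y * b j), Finset.mul_sum, map_sum]
    refine Finset.sum_congr rfl fun k _ => ?_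
    rw [Algebra.traceMatrix_apply, Algebra.traceForm_apply, Algebra.leftMulMatrix_eq_repr_mul, mul_smul_comm, map_smul, smul_eq_mul, mul_comm]
  have hs : (Algebra.traceMatrix F b)ᵀ = Algebra.traceMatrix F b := by
    ext i j
    rw [transpose_apply, Algebra.traceMatrix_apply, Algebra.traceMatrix_apply, Algebra.traceForm_apply, Algebra.traceForm_apply, mul_comm]
  ext i j
  have e : (Algebra.leftMulMatrix b y)ᵀ * Algebra.traceMatrix F b = (Algebra.traceMatrix F b * Algebra.leftMulMatrix b y)ᵀ := by
    rw [transpose_mul, hs]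
  rw [e, transpose_apply, h, h]
  congr 1; ring

theorem Lam_symm : (Lam b n)ᵀ = Lam b n := by
  ext ⟨i, a⟩ ⟨j, c⟩
  show (Matrix.scalar n (Algebra.traceMatrix F b)) j i c a = (Matrix.scalar n (Algebra.traceMatrix F b)) i j a c
  by_cases h : i = j
  · subst h
    simp [Algebra.traceMatrix_apply, Algebra.traceForm_apply, mul_comm]
  · have h' : j ≠ i := fun e => h e.symm
    simp [Matrix.scalar_apply, Matrix.diagonal_apply, h, h']

theorem Phi_bal (M : Matrix n n K) : (Phi b n M)ᵀ * Lam b n = Lam b n * Phi b n Mᵀ := by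
  have h1 : (Phi b n M)ᵀ = Matrix.compRingEquiv n ι F (Matrix.of fun i j => (Algebra.leftMulMatrix b (M j i))ᵀ) := rfl
  have h2 : Phi b n Mᵀ = Matrix.compRingEquiv n ι F (Matrix.of fun i j => Algebra.leftMulMatrix b (M j i)) := rfl
  rw [h1, h2, Lam, ← map_mul, ← map_mul]
  congr 1
  ext i j : 1
  rw [Matrix.scalar_apply, Matrix.mul_diagonal, Matrix.diagonal_mul]
  simp only [Matrix.of_apply]
  exact tr_bal b _

variable {θ : K} (hθ : ∀ y : K, ∃ p : Polynomial F, y = Polynomial.aeval θ p)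

end tower
end FF

open Matrix
set_option linter.all false

namespace FF
variable {F : Type} [Field F] [Fintype F]
variable {K : Type} [Field K] [Fintype K] [Algebra F K] {ι : Type} [Fintype ι] [DecidableEq ι] (b : Module.Basis ι F K)
variable {n : Type} [Fintype n] [DecidableEq n]

/-- the standard matrix with minimal polynomial that of θ -/
noncomputable def sig (n : Type) [Fintype n] [DecidableEq n] (θ : K) : Matrix (n × ι) (n × ι) F := Phi b n (Matrix.scalar n θ)

theorem Phi_comm (θ : K) (M : Matrix n n K) : Phi b n M * sig b n θ = sig b n θ * Phi b n M := by
  rw [sig, ← map_mul, ← map_mul]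
  congr 1
  exact ((Matrix.scalar_commute θ (fun r => mul_comm _ _) M).eq).symm

theorem comm_leftMul {θ : K} (hθ : ∀ y : K, ∃ p : Polynomial F, y = Polynomial.aeval θ p) (A : Matrix ι ι F)
    (h : A * Algebra.leftMulMatrix b θ = Algebra.leftMulMatrix b θ * A) : ∃ y : K, A = Algebra.leftMulMatrix b y := by
  set f := Matrix.toLin b b A with hf
  have h1 : f * Algebra.lmul F K θ = Algebra.lmul F K θ * f := by
    apply (LinearMap.toMatrix b b).injective
    rw [LinearMap.toMatrix_mul, LinearMap.toMatrix_mul, hf, LinearMap.toMatrix_toLin]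
    exact h
  have h2 : ∀ p : Polynomial F, f * Algebra.lmul F K (Polynomial.aeval θ p) = Algebra.lmul F K (Polynomial.aeval θ p) * f := by
    intro p
    induction p using Polynomial.induction_on' with
    | add p q hp hq => simp only [map_add, mul_add, add_mul, hp, hq]
    | monomial k a =>
      have : ∀ k : ℕ, f * Algebra.lmul F K (θ^k) = Algebra.lmul F K (θ^k) * f := by
        intro k
        rw [map_pow]
        exact (Commute.pow_right h1 k).eq
      rw [Polynomial.aeval_monomial, ← Algebra.smul_def, map_smul, mul_smul_comm, this, smul_mul_assoc]
  refine ⟨f 1, ?_⟩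
  have h3 : f = Algebra.lmul F K (f 1) := by
    ext y
    obtain ⟨p, rfl⟩ := hθ y
    have := LinearMap.congr_fun (h2 p) 1
    simp only [Module.End.mul_apply, Algebra.coe_lmul_eq_mul, LinearMap.mul_apply', mul_one] at this
    rw [this]
    simp [mul_comm]
  rw [Algebra.leftMulMatrix_apply, ← h3, hf, LinearMap.toMatrix_toLin]

theorem comm_sig {θ : K} (hθ : ∀ y : K, ∃ p : Polynomial F, y = Polynomial.aeval θ p) (X : Matrix (n × ι) (n × ι) F)
    (h : X * sig b n θ = sig b n θ * X) : ∃ M : Matrix n n K, X = Phi b n M := by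
  obtain ⟨Y, rfl⟩ := (Matrix.compRingEquiv n ι F).surjective X
  have e : sig b n θ = Matrix.compRingEquiv n ι F (Matrix.scalar n (Algebra.leftMulMatrix b θ)) := by
    show Matrix.compRingEquiv n ι F ((Algebra.leftMulMatrix b).mapMatrix (Matrix.scalar n θ)) = _
    congr 1
    ext i j : 1
    simp only [AlgHom.mapMatrix_apply, Matrix.map_apply, Matrix.scalar_apply, Matrix.diagonal_apply]
    split_ifs <;> simp
  rw [e, ← map_mul, ← map_mul] at h
  have h1 := (Matrix.compRingEquiv n ι F).injective h
  have h2 : ∀ i j, ∃ y : K, Y i j = Algebra.leftMulMatrix b y := by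
    intro i j
    apply comm_leftMul b hθ
    have := congrFun (congrFun h1 i) j
    rwa [Matrix.scalar_apply, Matrix.mul_diagonal, Matrix.diagonal_mul] at this
  choose M hM using h2
  refine ⟨Matrix.of M, ?_⟩
  show _ = Matrix.compRingEquiv n ι F ((Algebra.leftMulMatrix b).mapMatrix (Matrix.of M))
  congr 1
  ext i j : 1
  exact hM i j

theorem Phi_unit {θ : K} (hθ : ∀ y : K, ∃ p : Polynomial F, y = Polynomial.aeval θ p) (M : Matrix n n K) :
    IsUnit (Phi b n M) ↔ IsUnit M := by
  refine ⟨fun h => ?_, fun h => h.map (Phi b n)⟩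
  obtain ⟨u, hu⟩ := h
  have hc : Commute (u : Matrix (n × ι) (n × ι) F) (sig b n θ) := by rw [hu]; exact Phi_comm b θ M
  obtain ⟨N, hN⟩ := comm_sig b hθ _ (hc.units_inv_left).eq
  have h1 : M * N = 1 := by
    apply Phi_inj b
    rw [map_mul, ← hu, ← hN, map_one, Units.mul_inv]
  exact IsUnit.of_mul_eq_one N h1

theorem card_cent_sig {θ : K} (hθ : ∀ y : K, ∃ p : Polynomial F, y = Polynomial.aeval θ p) :
    Nat.card {g : GL (n × ι) F // (g : Matrix (n × ι) (n × ι) F) * sig b n θ = sig b n θ * (g : Matrix (n × ι) (n × ι) F)} = Nat.card (GL n K) := by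
  rw [Nat.card_congr (glEquiv (F := K) n)]
  refine (Nat.card_congr (Equiv.subtypeEquiv (q := fun g : {M : Matrix (n × ι) (n × ι) F // IsUnit M} => g.1 * sig b n θ = sig b n θ * g.1) (glEquiv (F := F) (n × ι)) (fun g => Iff.rfl))).trans ?_
  symm
  refine Nat.card_congr (Equiv.ofBijective (fun P => ⟨⟨Phi b n P.1, (Phi_unit b hθ _).2 P.2⟩, Phi_comm b θ _⟩) ⟨?_, ?_⟩)
  · intro P Q h
    simp only [Subtype.mk.injEq] at h
    exact Subtype.ext (Phi_inj b h)
  · rintro ⟨⟨M, hM⟩, h⟩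
    obtain ⟨N, rfl⟩ := comm_sig b hθ M h
    exact ⟨⟨N, (Phi_unit b hθ _).1 hM⟩, rfl⟩

theorem isB_Phi {φ : Polynomial F} {θ : K} (hθ : ∀ y : K, ∃ p : Polynomial F, y = Polynomial.aeval θ p) (hφ : Polynomial.aeval θ φ = 0)
    {k : ℕ} (hk : Fintype.card n ≤ Fintype.card K^k) {d : ℕ} (hd : Fintype.card K = Fintype.card F^d) (t Ω B : Matrix n n K) :
    (isB φ (Phi b n (Matrix.scalar n θ + t)) (Lam b n * Phi b n Ω) (Lam b n * Phi b n B) ∧ Polynomial.aeval (Phi b n (Matrix.scalar n θ + t)) (Polynomial.X^(Fintype.card K^k) : Polynomial F) = sig b n θ) ↔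
      isB Polynomial.X t Ω B := by
  have hL := Lam_unit b (n := n)
  have inj : ∀ M N : Matrix n n K, Lam b n * Phi b n M = Lam b n * Phi b n N ↔ M = N := by
    intro M N
    rw [hL.mul_right_inj, (Phi_inj b).eq_iff]
  have hT : ∀ M : Matrix n n K, (Lam b n * Phi b n M)ᵀ = Lam b n * Phi b n Mᵀ := by
    intro M
    rw [transpose_mul, Lam_symm, Phi_bal]
  have hb : ∀ Ω : Matrix n n K, ((Phi b n (Matrix.scalar n θ + t))ᵀ * (Lam b n * Phi b n Ω) = Lam b n * Phi b n Ω * Phi b n (Matrix.scalar n θ + t)) ↔ tᵀ * Ω = Ω * t := by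
    intro Ω
    rw [← mul_assoc, Phi_bal, mul_assoc, mul_assoc, ← map_mul, ← map_mul, inj, transpose_add, add_mul, mul_add]
    have h1 : (Matrix.scalar n θ)ᵀ = Matrix.scalar n θ := by simp [Matrix.scalar_apply]
    rw [h1, (Matrix.scalar_commute θ (fun r => mul_comm _ _) Ω).eq, add_right_inj]
  have hpow : (Matrix.scalar n θ + t)^(Fintype.card K^k) = Matrix.scalar n θ + t^(Fintype.card K^k) := by
    have := aeval_pow_card (Polynomial.X - Polynomial.C θ) k (Matrix.scalar n θ + t)
    have e : ∀ M : Matrix n n K, Polynomial.aeval M (Polynomial.X - Polynomial.C θ) = M - Matrix.scalar n θ := by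
      intro M; simp; rfl
    rw [e, e, add_sub_cancel_left] at this
    rw [← this]; abel
  have hnil : IsNilpotent (Polynomial.aeval (Phi b n (Matrix.scalar n θ + t)) φ) ∧ Polynomial.aeval (Phi b n (Matrix.scalar n θ + t)) (Polynomial.X^(Fintype.card K^k) : Polynomial F) = sig b n θ ↔ IsNilpotent t := by
    have e1 : Polynomial.aeval (Phi b n (Matrix.scalar n θ + t)) (Polynomial.X^(Fintype.card K^k) : Polynomial F) = sig b n θ ↔ t^(Fintype.card K^k) = 0 := by
      rw [map_pow, Polynomial.aeval_X, ← map_pow, sig, (Phi_inj b).eq_iff, hpow, add_eq_left]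
    rw [e1]
    constructor
    · rintro ⟨_, h⟩; exact ⟨_, h⟩
    · intro h
      have h0 := nilp_pow h hk
      refine ⟨⟨Fintype.card K^k, ?_⟩, h0⟩
      rw [hd, ← pow_mul, ← aeval_pow_card, pow_mul, ← hd, ← map_pow, hpow, h0, add_zero, Polynomial.aeval_algHom_apply]
      have : Polynomial.aeval (Matrix.scalar n θ) φ = Matrix.scalar n (Polynomial.aeval θ φ) := by
        exact Polynomial.aeval_algHom_apply (Matrix.scalarAlgHom n F : K →ₐ[F] Matrix n n K) θ φ
      rw [this, hφ, map_zero, map_zero]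
  have hu : IsUnit (Lam b n * Phi b n Ω) ↔ IsUnit Ω := by
    rw [← Phi_unit b hθ]
    obtain ⟨u, hu⟩ := hL
    rw [← hu, Units.isUnit_units_mul]
  simp only [isB, and_assoc, hnil, hu, hb, hT, ← map_neg, ← mul_neg, inj, Polynomial.aeval_X]

theorem card_isB_sig {φ : Polynomial F} {θ : K} (hθ : ∀ y : K, ∃ p : Polynomial F, y = Polynomial.aeval θ p) (hφ : Polynomial.aeval θ φ = 0)
    {k : ℕ} (hk : Fintype.card n ≤ Fintype.card K^k) {d : ℕ} (hd : Fintype.card K = Fintype.card F^d) :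
    Nat.card {P : Matrix (n × ι) (n × ι) F × Matrix (n × ι) (n × ι) F × Matrix (n × ι) (n × ι) F // isB φ P.1 P.2.1 P.2.2 ∧ Polynomial.aeval P.1 (Polynomial.X^(Fintype.card K^k) : Polynomial F) = sig b n θ} = nB (Polynomial.X : Polynomial K) n := by
  have hL := Lam_unit b (n := n)
  rw [nB]
  symm
  refine Nat.card_congr (Equiv.ofBijective (fun P => ⟨(Phi b n (Matrix.scalar n θ + P.1.1), Lam b n * Phi b n P.1.2.1, Lam b n * Phi b n P.1.2.2), (isB_Phi b hθ hφ hk hd _ _ _).2 P.2⟩) ⟨?_, ?_⟩)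
  · rintro ⟨⟨X, w, β⟩, h⟩ ⟨⟨X', w', β'⟩, h'⟩ e
    simp only [Subtype.mk.injEq, Prod.mk.injEq, hL.mul_right_inj, (Phi_inj b).eq_iff, add_right_inj] at e
    obtain ⟨rfl, rfl, rfl⟩ := e
    rfl
  · rintro ⟨⟨X, w, β⟩, h⟩
    have hX : X * sig b n θ = sig b n θ * X := by
      have h2 : Polynomial.aeval X (Polynomial.X^(Fintype.card K^k) : Polynomial F) = sig b n θ := h.2
      rw [← h2, map_pow, Polynomial.aeval_X]
      exact (Commute.self_pow X _).eq
    have hw : ∀ w : Matrix (n × ι) (n × ι) F, Xᵀ * w = w * X → ∃ Ω, w = Lam b n * Phi b n Ω := by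
      intro w hw
      have h1 := aeval_bal hw (Polynomial.X^(Fintype.card K^k))
      rw [h.2] at h1
      obtain ⟨u, hu⟩ := hL
      obtain ⟨w', rfl⟩ : ∃ w', w = (u : Matrix (n × ι) (n × ι) F) * w' := ⟨(u⁻¹ : (Matrix (n × ι) (n × ι) F)ˣ) * w, by rw [← mul_assoc, Units.mul_inv, one_mul]⟩
      have h2 : (sig b n θ)ᵀ * u = u * sig b n θ := by
        rw [hu, sig, Phi_bal]
        congr 2
        simp [Matrix.scalar_apply]
      rw [← mul_assoc, h2, mul_assoc, mul_assoc, Units.mul_right_inj] at h1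
      obtain ⟨Ω, hΩ⟩ := comm_sig b hθ w' h1.symm
      exact ⟨Ω, by rw [hΩ, hu]⟩
    obtain ⟨T, hT⟩ := comm_sig b hθ X hX
    obtain ⟨Ω, hΩ⟩ := hw w h.1.2.2.2.1
    obtain ⟨B, hB⟩ := hw β h.1.2.2.2.2.1
    have hT' : T = Matrix.scalar n θ + (T - Matrix.scalar n θ) := by abel
    rw [hT'] at hT
    have h' := h
    simp only at h'
    rw [hT, hΩ, hB, isB_Phi b hθ hφ hk hd] at h'
    exact ⟨⟨(_, _, _), h'⟩, Subtype.ext (Prod.ext hT.symm (Prod.ext hΩ.symm hB.symm))⟩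

end FF

open Matrix
set_option linter.all false

namespace FF
variable {F : Type} [Field F] [Fintype F]

section
variable {φ : Polynomial F} [hφ : Fact (Irreducible φ)] {ι : Type} [Fintype ι] [DecidableEq ι] (b : Module.Basis ι F (AdjoinRoot φ))

theorem exists_tower_basis {V : Type} [AddCommGroup V] [Module F V] [FiniteDimensional F V] (σ : Module.End F V)
    (hσ : Polynomial.aeval σ φ = 0) : ∃ r : ℕ, ∃ e : Module.Basis (Fin r × ι) F V,
      ∀ j i, σ (e (j, i)) = ∑ k, Algebra.leftMulMatrix b (AdjoinRoot.root φ) k i • e (j, k) := by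
  let ρ : AdjoinRoot φ →+* Module.End F V := Ideal.Quotient.lift (Ideal.span {φ}) (Polynomial.aeval σ : Polynomial F →ₐ[F] Module.End F V).toRingHom (by
    intro a ha
    rw [Ideal.mem_span_singleton] at ha
    obtain ⟨c, rfl⟩ := ha
    show Polynomial.aeval σ (φ * c) = 0
    rw [map_mul, hσ, zero_mul])
  have hρ : ∀ p : Polynomial F, ρ (AdjoinRoot.mk φ p) = Polynomial.aeval σ p := fun p => rfl
  letI : Module (AdjoinRoot φ) V := Module.compHom V ρ
  have hsm : ∀ (y : AdjoinRoot φ) (v : V), y • v = ρ y v := fun y v => rfl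
  haveI : IsScalarTower F (AdjoinRoot φ) V := by
    refine ⟨fun a y v => ?_⟩
    rw [hsm, hsm, Algebra.smul_def, map_mul]
    have : ρ (algebraMap F (AdjoinRoot φ) a) = Polynomial.aeval σ (Polynomial.C a) := hρ (Polynomial.C a)
    rw [this, Polynomial.aeval_C]
    rfl
  haveI : Module.Finite (AdjoinRoot φ) V := Module.Finite.of_restrictScalars_finite F (AdjoinRoot φ) V
  let c := Module.finBasis (AdjoinRoot φ) V
  refine ⟨_, b.smulTower' c, ?_⟩
  intro j i
  have h1 : ∀ v, σ v = AdjoinRoot.root φ • v := by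
    intro v
    rw [hsm]
    have : ρ (AdjoinRoot.root φ) = Polynomial.aeval σ (Polynomial.X) := hρ _
    rw [this, Polynomial.aeval_X]
  rw [h1]
  simp only [Module.Basis.smulTower'_apply]
  rw [← mul_smul]
  conv_lhs => rw [← b.sum_repr (AdjoinRoot.root φ * b i), Finset.sum_smul]
  refine Finset.sum_congr rfl fun k _ => ?_
  rw [Algebra.leftMulMatrix_eq_repr_mul, smul_assoc]

theorem dvd_of_root {ι : Type} [Fintype ι] [DecidableEq ι] (b : Module.Basis ι F (AdjoinRoot φ)) {m : ℕ} (σ : Matrix (Fin m) (Fin m) F) (hσ : Polynomial.aeval σ φ = 0) : Fintype.card ι ∣ m := by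
  have h : Polynomial.aeval (Matrix.toLinAlgEquiv' σ) φ = 0 := by
    rw [show Matrix.toLinAlgEquiv' σ = (Matrix.toLinAlgEquiv' (R := F) (n := Fin m)).toAlgHom σ from rfl, Polynomial.aeval_algHom_apply, hσ, map_zero]
  obtain ⟨r, e, _⟩ := exists_tower_basis b _ h
  have := Module.finrank_eq_card_basis e
  simp at this
  exact ⟨r, by rw [this, mul_comm]⟩

theorem conj_sig {n : Type} [Fintype n] [DecidableEq n] (σ : Matrix (n × ι) (n × ι) F) (hσ : Polynomial.aeval σ φ = 0) :
    ∃ g : GL (n × ι) F, ((g⁻¹ : GL (n × ι) F) : Matrix (n × ι) (n × ι) F) * σ * (g : Matrix (n × ι) (n × ι) F) = sig b n (AdjoinRoot.root φ) := by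
  have h : Polynomial.aeval (Matrix.toLinAlgEquiv' σ) φ = 0 := by
    rw [show Matrix.toLinAlgEquiv' σ = (Matrix.toLinAlgEquiv' (R := F) (n := n × ι)).toAlgHom σ from rfl, Polynomial.aeval_algHom_apply, hσ, map_zero]
  obtain ⟨r, e, he⟩ := exists_tower_basis b _ h
  have h1 := Module.finrank_eq_card_basis e
  simp at h1
  have hι : Nonempty ι := b.index_nonempty
  have h2 : Fintype.card n = r := h1.resolve_right Fintype.card_ne_zero
  let E : Fin r ≃ n := Fintype.equivOfCardEq (by simp [h2])
  let e' := e.reindex (E.prodCongr (Equiv.refl ι))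
  have he' : ∀ j i, σ *ᵥ (e' (j, i)) = ∑ k, Algebra.leftMulMatrix b (AdjoinRoot.root φ) k i • e' (j, k) := by
    intro j i
    have := he (E.symm j) i
    simpa [e'] using this
  let G : Matrix (n × ι) (n × ι) F := Matrix.of fun x y => e' y x
  have hG : IsUnit G := by
    rw [← Matrix.linearIndependent_cols_iff_isUnit]
    exact e'.linearIndependent
  obtain ⟨g, hg⟩ := hG
  refine ⟨g, ?_⟩
  have h3 : σ * G = G * sig b n (AdjoinRoot.root φ) := by
    ext x ⟨j, i⟩
    have h4 := congrFun (he' j i) x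
    have h5 : (σ * G) x (j, i) = (σ *ᵥ (e' (j, i))) x := rfl
    rw [h5, h4, Matrix.mul_apply, Fintype.sum_prod_type, Finset.sum_eq_single j]
    · simp only [Finset.sum_apply, Pi.smul_apply, smul_eq_mul, sig, Phi_apply]
      refine Finset.sum_congr rfl fun k _ => ?_
      simp [G, mul_comm]
    · intro j' _ hj'
      simp [sig, Phi_apply, Matrix.scalar_apply, Matrix.diagonal_apply, hj']
    · simp
  rw [hg, mul_assoc, h3, ← hg, ← mul_assoc, ← Units.val_mul, inv_mul_cancel, Units.val_one, one_mul]

theorem eB_local [Fintype (AdjoinRoot φ)] (m : ℕ) : eB φ m = if φ.natDegree ∣ m then eB (Polynomial.X : Polynomial (AdjoinRoot φ)) (m / φ.natDegree) else 0 := by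
  have hne := hφ.out.ne_zero
  let b : Module.Basis (Fin φ.natDegree) F (AdjoinRoot φ) := (AdjoinRoot.powerBasis hne).basis
  have hd : Fintype.card (AdjoinRoot φ) = Fintype.card F ^ φ.natDegree := by
    rw [Module.card_fintype b, Fintype.card_fin]
  have hd0 : 0 < φ.natDegree := hφ.out.natDegree_pos
  have hθ : ∀ y : AdjoinRoot φ, ∃ p : Polynomial F, y = Polynomial.aeval (AdjoinRoot.root φ) p := by
    intro y
    obtain ⟨p, rfl⟩ := AdjoinRoot.mk_surjective y
    exact ⟨p, by rw [AdjoinRoot.aeval_eq]⟩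
  have hφ0 : Polynomial.aeval (AdjoinRoot.root φ) φ = 0 := by rw [AdjoinRoot.aeval_eq, AdjoinRoot.mk_self]
  have hbig : ∀ m : ℕ, m ≤ Fintype.card (AdjoinRoot φ)^m := fun m => (Nat.lt_pow_self (Fintype.one_lt_card)).le
  have hroot : ∀ (N : Type) [Fintype N] [DecidableEq N] (X : Matrix N N F) (k : ℕ), Fintype.card N ≤ Fintype.card (AdjoinRoot φ)^k → IsNilpotent (Polynomial.aeval X φ) → Polynomial.aeval (Polynomial.aeval X (Polynomial.X^(Fintype.card (AdjoinRoot φ)^k) : Polynomial F)) φ = 0 := by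
    intro N _ _ X k hk hn
    rw [map_pow, Polynomial.aeval_X, hd, ← pow_mul, aeval_pow_card, pow_mul, ← hd]
    exact nilp_pow hn hk
  split_ifs with hdm
  · obtain ⟨n, rfl⟩ := hdm
    rw [Nat.mul_div_cancel_left _ hd0]
    set k := φ.natDegree * n with hk
    have h1 := nB_nf φ (Polynomial.X^(Fintype.card (AdjoinRoot φ)^k)) (sig b (Fin n) (AdjoinRoot.root φ))
    rw [card_cent_sig b hθ, card_isB_sig b hθ hφ0 (by
      rw [Fintype.card_fin]; exact (Nat.le_mul_of_pos_left n hd0).trans (hbig k)) hd] at h1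
    have h2 : Nat.card {P : Matrix (Fin n × Fin φ.natDegree) (Fin n × Fin φ.natDegree) F × Matrix (Fin n × Fin φ.natDegree) (Fin n × Fin φ.natDegree) F × Matrix (Fin n × Fin φ.natDegree) (Fin n × Fin φ.natDegree) F // isB φ P.1 P.2.1 P.2.2 ∧
        ∃ g : GL (Fin n × Fin φ.natDegree) F, ((g⁻¹ : GL (Fin n × Fin φ.natDegree) F) : Matrix (Fin n × Fin φ.natDegree) (Fin n × Fin φ.natDegree) F) * Polynomial.aeval P.1 (Polynomial.X^(Fintype.card (AdjoinRoot φ)^k) : Polynomial F) * (g : Matrix (Fin n × Fin φ.natDegree) (Fin n × Fin φ.natDegree) F) = sig b (Fin n) (AdjoinRoot.root φ)} = nB φ (Fin k) := by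
      have e : Fin n × Fin φ.natDegree ≃ Fin k := Fintype.equivOfCardEq (by simp [hk, mul_comm])
      rw [← nB_reindex φ e, nB]
      refine Nat.card_congr (Equiv.subtypeEquivRight fun P => ?_)
      refine and_iff_left_of_imp fun hP => conj_sig b _ ?_
      exact hroot _ _ _ (by simp; rw [mul_comm]; exact hbig k) hP.2.2.2.2.2
    have e : Fin n × Fin φ.natDegree ≃ Fin k := Fintype.equivOfCardEq (by simp [hk, mul_comm])
    rw [h2, card_gl_equiv e] at h1
    have g1 : (gl (AdjoinRoot φ) n : ℝ) ≠ 0 := by exact_mod_cast (gl_pos n).ne'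
    have g2 : (gl F k : ℝ) ≠ 0 := by exact_mod_cast (gl_pos k).ne'
    rw [eB, eB, div_eq_div_iff g2 g1]
    have h3 : nB φ (Fin k) * gl (AdjoinRoot φ) n = gl F k * nB (Polynomial.X : Polynomial (AdjoinRoot φ)) (Fin n) := h1
    rw [mul_comm (nB (Polynomial.X : Polynomial (AdjoinRoot φ)) (Fin n) : ℝ)]
    exact_mod_cast h3
  · rw [eB]
    have : IsEmpty {P : Matrix (Fin m) (Fin m) F × Matrix (Fin m) (Fin m) F × Matrix (Fin m) (Fin m) F // isB φ P.1 P.2.1 P.2.2} := by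
      refine ⟨fun P => hdm ?_⟩
      have := dvd_of_root b _ (hroot _ P.1.1 m (by simpa using hbig m) P.2.2.2.2.2.2)
      simpa using this
    rw [nB, Nat.card_of_isEmpty]
    simp
end
end FF

open Matrix
set_option linter.all false

namespace FF
variable {F : Type} [Field F] [Fintype F]

section euler

/-- monic polynomials of degree `k` with prime factors in `S` -/
def CSet (S : Finset (Polynomial F)) (k : ℕ) : Set (Polynomial F) :=
  {f | f.Monic ∧ f.natDegree = k ∧ ∀ r : Polynomial F, r.Monic → Irreducible r → r ∣ f → r ∈ S}

theorem degle_finite (F : Type) [Field F] [Fintype F] (N : ℕ) : {φ : Polynomial F | φ.natDegree ≤ N}.Finite := by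
  apply Set.Finite.of_finite_image (f := fun φ => fun i : Fin (N+1) => φ.coeff i) (Set.toFinite _)
  rintro φ h1 ψ h2 h
  have h1 : φ.natDegree ≤ N := h1
  have h2 : ψ.natDegree ≤ N := h2
  ext i
  by_cases hi : i < N + 1
  · exact congrFun h ⟨i, hi⟩
  · rw [Polynomial.coeff_eq_zero_of_natDegree_lt (by omega), Polynomial.coeff_eq_zero_of_natDegree_lt (by omega)]

theorem CSet_finite (S : Finset (Polynomial F)) (k : ℕ) : (CSet S k).Finite :=
  (degle_finite F k).subset fun f hf => hf.2.1.le

theorem CSet_empty (k : ℕ) : (CSet (∅ : Finset (Polynomial F)) k).ncard = if k = 0 then 1 else 0 := by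
  classical
  split_ifs with h
  · subst h
    rw [Set.ncard_eq_one]
    refine ⟨1, ?_⟩
    ext f
    constructor
    · rintro ⟨h1, h2, h3⟩
      exact (h1.natDegree_eq_zero).1 h2
    · rintro rfl
      refine ⟨Polynomial.monic_one, by simp, fun r _ hr hd => ?_⟩
      exact absurd (isUnit_of_dvd_one hd) hr.not_isUnit
  · rw [Set.ncard_eq_zero (CSet_finite _ _)]
    ext f
    simp only [Set.mem_empty_iff_false, iff_false]
    rintro ⟨h1, h2, h3⟩
    have hu : ¬ IsUnit f := by
      intro hu
      have := Polynomial.natDegree_eq_zero_of_isUnit hu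
      omega
    obtain ⟨r, hr, hd⟩ := WfDvdMonoid.exists_irreducible_factor hu h1.ne_zero
    have := h3 (normalize r) (Polynomial.monic_normalize hr.ne_zero) ((associated_normalize r).irreducible hr) ((normalize_associated r).dvd.trans hd)
    simp at this

theorem CSet_PR {N k : ℕ} (hk : k ≤ N) : (CSet (PR F N) k).ncard = Fintype.card F ^ k := by
  have h1 : CSet (PR F N) k = {p : Polynomial F | p.Monic ∧ p.natDegree = k} := by
    ext f
    constructor
    · rintro ⟨h1, h2, h3⟩; exact ⟨h1, h2⟩
    · rintro ⟨h1, h2⟩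
      refine ⟨h1, h2, fun r hm hr hd => mem_PR.2 ⟨hm, hr, ?_⟩⟩
      exact (Polynomial.natDegree_le_of_dvd hd h1.ne_zero).trans (h2.le.trans hk)
  rw [h1, ← Nat.card_coe_set_eq]
  refine (Nat.card_congr ((Polynomial.monicEquivDegreeLT k).trans (Polynomial.degreeLTEquiv F k).toEquiv)).trans ?_
  simp

theorem CSet_insert [DecidableEq (Polynomial F)] {S : Finset (Polynomial F)} {φ : Polynomial F} (hm : φ.Monic) (hi : Irreducible φ) (hS : φ ∉ S) (k : ℕ) :
    (CSet (insert φ S) k).ncard = (CSet S k).ncard + if φ.natDegree ≤ k then (CSet (insert φ S) (k - φ.natDegree)).ncard else 0 := by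
  have h1 : CSet (insert φ S) k = CSet S k ∪ {f ∈ CSet (insert φ S) k | φ ∣ f} := by
    ext f
    constructor
    · intro hf
      by_cases hd : φ ∣ f
      · exact Or.inr ⟨hf, hd⟩
      · refine Or.inl ⟨hf.1, hf.2.1, fun r hr1 hr2 hr3 => ?_⟩
        rcases Finset.mem_insert.1 (hf.2.2 r hr1 hr2 hr3) with rfl | h
        · exact absurd hr3 hd
        · exact h
    · rintro (hf | hf)
      · exact ⟨hf.1, hf.2.1, fun r a b c => Finset.mem_insert_of_mem (hf.2.2 r a b c)⟩
      · exact hf.1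
  have h2 : Disjoint (CSet S k) {f ∈ CSet (insert φ S) k | φ ∣ f} := by
    rw [Set.disjoint_left]
    rintro f hf ⟨-, hd⟩
    exact hS (hf.2.2 φ hm hi hd)
  rw [congrArg Set.ncard h1, Set.ncard_union_eq h2 (CSet_finite _ _) ((CSet_finite _ _).subset (Set.sep_subset _ _))]
  congr 1
  split_ifs with hk
  · have h3 : {f ∈ CSet (insert φ S) k | φ ∣ f} = (fun g => φ * g) '' CSet (insert φ S) (k - φ.natDegree) := by
      ext f
      constructor
      · rintro ⟨hf, g, rfl⟩
        have hg : g.Monic := hm.of_mul_monic_left hf.1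
        refine ⟨g, ⟨hg, ?_, fun r a b c => hf.2.2 r a b (c.mul_left _)⟩, rfl⟩
        have := hf.2.1
        rw [hm.natDegree_mul hg] at this
        omega
      · rintro ⟨g, hg, rfl⟩
        refine ⟨⟨hm.mul hg.1, ?_, fun r a b c => ?_⟩, dvd_mul_right _ _⟩
        · rw [hm.natDegree_mul hg.1, hg.2.1]; omega
        · rcases b.prime.dvd_or_dvd c with h | h
          · rw [Polynomial.eq_of_monic_of_associated a hm ((b.dvd_irreducible_iff_associated hi).1 h)]
            exact Finset.mem_insert_self _ _
          · exact hg.2.2 r a b h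
    rw [h3, Set.ncard_image_of_injective _ (mul_right_injective₀ hi.ne_zero)]
  · rw [Set.ncard_eq_zero ((CSet_finite _ _).subset (Set.sep_subset _ _))]
    ext f
    simp only [Set.mem_empty_iff_false, iff_false]
    rintro ⟨hf, hd⟩
    have := Polynomial.natDegree_le_of_dvd hd hf.1.ne_zero
    rw [hf.2.1] at this
    exact hk this

variable {R : Type} [CommRing R] [Algebra ℝ R]

theorem euler_aux {N : ℕ} {u : R} (hu : u^(N+1) = 0) (S : Finset (Polynomial F)) (hS : ∀ φ ∈ S, φ.Monic ∧ Irreducible φ) :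
    (∑ k ∈ Finset.range (N+1), ((CSet S k).ncard : R) * u^k) * ∏ φ ∈ S, (1 - u^φ.natDegree) = 1 := by
  classical
  induction S using Finset.induction_on with
  | empty =>
    simp only [Finset.prod_empty, CSet_empty, mul_one]
    rw [Finset.sum_eq_single_of_mem 0 (by simp)]
    · simp
    · intro b _ hb; simp [hb]
  | insert φ S hφ ih =>
    rw [Finset.prod_insert hφ, ← mul_assoc]
    refine Eq.trans ?_ (ih (fun ψ hψ => hS ψ (Finset.mem_insert_of_mem hψ)))
    congr 1
    have hh := hS φ (Finset.mem_insert_self _ _)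
    have h1 : ∑ k ∈ Finset.range (N+1), ((CSet (insert φ S) k).ncard : R) * u^k =
        ∑ k ∈ Finset.range (N+1), ((CSet S k).ncard : R) * u^k + ∑ k ∈ Finset.range (N+1), (if φ.natDegree ≤ k then ((CSet (insert φ S) (k - φ.natDegree)).ncard : R) else 0) * u^k := by
      rw [← Finset.sum_add_distrib]
      refine Finset.sum_congr rfl fun k _ => ?_
      rw [CSet_insert hh.1 hh.2 hφ k, ← add_mul]
      push_cast
      rfl
    have h2 : ∑ k ∈ Finset.range (N+1), (if φ.natDegree ≤ k then ((CSet (insert φ S) (k - φ.natDegree)).ncard : R) else 0) * u^k = (∑ k ∈ Finset.range (N+1), ((CSet (insert φ S) k).ncard : R) * u^k) * u^φ.natDegree := by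
      have e1 : ∑ k ∈ Finset.range (N+1), (if φ.natDegree ≤ k then ((CSet (insert φ S) (k - φ.natDegree)).ncard : R) else 0) * u^k =
          ∑ k ∈ Finset.range (φ.natDegree + (N+1)), (if φ.natDegree ≤ k then ((CSet (insert φ S) (k - φ.natDegree)).ncard : R) else 0) * u^k := by
        apply Finset.sum_subset
        · intro i; simp; omega
        · intro i _ hi
          rw [pow_zero_of_lt hu (by simp at hi; omega), mul_zero]
      rw [e1, Finset.sum_range_add, Finset.sum_eq_zero, zero_add, Finset.sum_mul]
      · refine Finset.sum_congr rfl fun k _ => ?_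
        simp [pow_add]; ring
      · intro i hi
        rw [if_neg (by simp at hi; omega), zero_mul]
    rw [h2] at h1
    linear_combination h1

theorem euler {N : ℕ} {u : R} (hu : u^(N+1) = 0) :
    ∏ φ ∈ PR F N, (1 - u^φ.natDegree) = 1 - (Fintype.card F : ℝ) • u := by
  have h1 := euler_aux (F := F) hu (PR F N) (fun φ h => ⟨(mem_PR.1 h).1, (mem_PR.1 h).2.1⟩)
  have h2 : (∑ k ∈ Finset.range (N+1), ((CSet (PR F N) k).ncard : R) * u^k) = ∑ k ∈ Finset.range (N+1), ((Fintype.card F : R) * u)^k := by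
    refine Finset.sum_congr rfl fun k hk => ?_
    rw [CSet_PR (by simp at hk; omega), mul_pow]; push_cast; rfl
  rw [h2] at h1
  have h3 := geom_sum_mul ((Fintype.card F : R) * u) (N+1)
  rw [mul_pow, hu, mul_zero] at h3
  have h4 : (Fintype.card F : ℝ) • u = (Fintype.card F : R) * u := by
    rw [Algebra.smul_def]; simp
  rw [h4]
  generalize ∑ k ∈ Finset.range (N+1), ((Fintype.card F : R) * u)^k = G at *
  generalize ∏ φ ∈ PR F N, (1 - u^φ.natDegree) = P at *
  linear_combination (1 - (Fintype.card F : R) * u) * h1 + P * h3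

end euler
end FF

open Matrix
set_option linter.all false

namespace FF
variable {F : Type} [Field F] [Fintype F]

noncomputable def Vc (Q : ℝ) : ℕ → ℝ
  | 0 => 1
  | 1 => 0
  | (l+2) => Q * Vc Q l / (1 - (Q⁻¹)^(l+2))

abbrev R0 (N : ℕ) : Type := Polynomial ℝ ⧸ Ideal.span {(Polynomial.X^(N+1) : Polynomial ℝ)}

noncomputable def rX (N : ℕ) : R0 N := Ideal.Quotient.mk _ Polynomial.X

theorem rX_pow (N : ℕ) : (rX N)^(N+1) = 0 := by
  rw [rX, ← map_pow, Ideal.Quotient.eq_zero_iff_mem]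
  exact Ideal.mem_span_singleton_self _

theorem aeval_rX (N : ℕ) (f : Polynomial ℝ) : Polynomial.aeval (rX N) f = Ideal.Quotient.mk _ f := by
  have := Polynomial.aeval_algHom_apply (Ideal.Quotient.mkₐ ℝ (Ideal.span {(Polynomial.X^(N+1) : Polynomial ℝ)})) Polynomial.X f
  rw [Polynomial.aeval_X_left_apply] at this
  exact this

theorem R0_coeff {N : ℕ} {f g : Polynomial ℝ} (h : Polynomial.aeval (rX N) f = Polynomial.aeval (rX N) g) {l : ℕ} (hl : l ≤ N) : f.coeff l = g.coeff l := by
  rw [aeval_rX, aeval_rX, Ideal.Quotient.eq, Ideal.mem_span_singleton, Polynomial.X_pow_dvd_iff] at h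
  have := h l (by omega)
  rw [Polynomial.coeff_sub] at this
  linarith

section
variable {R : Type} [CommRing R] [Algebra ℝ R]

theorem aeval_trunc {N : ℕ} {y : R} (hy : y^(N+1) = 0) (f : Polynomial ℝ) : Polynomial.aeval y f = ev N f.coeff y := by
  rw [ev, Polynomial.aeval_eq_sum_range' (n := N + 1 + (f.natDegree+1)) (by omega), Finset.sum_range_add, add_eq_left]
  refine Finset.sum_eq_zero fun i _ => ?_
  rw [pow_add, hy, zero_mul, smul_zero]

theorem aeval_ev {N : ℕ} (w : ℕ → ℝ) (f : Polynomial ℝ) (y : R) : Polynomial.aeval y (ev N w f) = ev N w (Polynomial.aeval y f) := by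
  simp [ev, map_sum, map_smul, map_pow]

theorem ev_congr {N : ℕ} {w w' : ℕ → ℝ} (h : ∀ l ≤ N, w l = w' l) (y : R) : ev N w y = ev N w' y := by
  refine Finset.sum_congr rfl fun l hl => ?_
  rw [h l (by simp at hl; omega)]

theorem pow_npow_zero {N d : ℕ} {y : R} (hd : 0 < d) (hy : y^(N+1) = 0) : (y^d)^(N+1) = 0 := by
  rw [← pow_mul]; exact pow_zero_of_lt hy (by nlinarith)

noncomputable def pp (F : Type) [Field F] [Fintype F] (N : ℕ) : Polynomial ℝ :=
  ∏ φ ∈ PR F N, ev N (Wc ((Fintype.card F : ℝ)^φ.natDegree)) (Polynomial.X^φ.natDegree)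

theorem aeval_pp (N : ℕ) (y : R) : Polynomial.aeval y (pp F N) = ∏ φ ∈ PR F N, ev N (Wc ((Fintype.card F : ℝ)^φ.natDegree)) (y^φ.natDegree) := by
  rw [pp, map_prod]
  simp only [aeval_ev, map_pow, Polynomial.aeval_X]

theorem q1 (F : Type) [Field F] [Fintype F] : (1:ℝ) < Fintype.card F := by exact_mod_cast Fintype.one_lt_card

theorem pp_fun {N : ℕ} {y : R} (hy : y^(N+1) = 0) : Polynomial.aeval ((Fintype.card F : ℝ)⁻¹ • y) (pp F N) = Polynomial.aeval y (pp F N) * (1 - (Fintype.card F : ℝ) • y^2) := by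
  have h0 := euler (F := F) (u := y^2) (pow_npow_zero (by omega) hy)
  rw [aeval_pp, aeval_pp, ← h0, ← Finset.prod_mul_distrib]
  refine Finset.prod_congr rfl fun φ hφ => ?_
  have hd : 0 < φ.natDegree := (mem_PR.1 hφ).2.1.natDegree_pos
  rw [smul_pow, inv_pow, Wc_fun (pow_npow_zero hd hy) (one_lt_pow₀ (q1 F) hd.ne'), ← pow_mul, ← pow_mul, mul_comm 2]

theorem pp_fun' {N : ℕ} {y : R} (hy : y^(N+1) = 0) :
    Polynomial.aeval y ((pp F N).comp (Polynomial.C (Fintype.card F : ℝ)⁻¹ * Polynomial.X)) = Polynomial.aeval y (pp F N - Polynomial.C (Fintype.card F : ℝ) * pp F N * Polynomial.X^2) := by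
  have h := pp_fun (F := F) hy
  rw [Polynomial.aeval_comp]
  rw [Algebra.smul_def, Algebra.smul_def] at h
  simp only [map_mul, map_sub, Polynomial.aeval_C, Polynomial.aeval_X, map_pow]
  rw [h]; ring

theorem pp_coeff {N l : ℕ} (hl : l ≤ N) : (pp F N).coeff l = Vc (Fintype.card F) l := by
  have hq := q1 F
  set Q : ℝ := (Fintype.card F : ℝ) with hQ
  have h : Polynomial.aeval (rX N) ((pp F N).comp (Polynomial.C Q⁻¹ * Polynomial.X)) = Polynomial.aeval (rX N) (pp F N - Polynomial.C Q * pp F N * Polynomial.X^2) := pp_fun' (rX_pow N)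
  have key : ∀ l ≤ N, (pp F N).coeff l * (Q⁻¹)^l = (pp F N).coeff l - if 2 ≤ l then Q * (pp F N).coeff (l-2) else 0 := by
    intro l hl
    have := R0_coeff h hl
    rw [Polynomial.comp_C_mul_X_coeff, Polynomial.coeff_sub, Polynomial.coeff_mul_X_pow', Polynomial.coeff_C_mul] at this
    exact this
  have hlt : ∀ l, 0 < l → 1 - (Q⁻¹)^l ≠ 0 := by
    intro l hl
    have : (Q⁻¹)^l < 1 := pow_lt_one₀ (by positivity) (inv_lt_one_of_one_lt₀ hq) hl.ne'
    linarith
  induction l using Nat.strong_induction_on with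
  | _ l ih =>
    match l, hl, ih with
    | 0, _, _ =>
      rw [Vc, Polynomial.coeff_zero_eq_eval_zero, pp, Polynomial.eval_prod]
      refine Finset.prod_eq_one fun φ hφ => ?_
      have hd : 0 < φ.natDegree := (mem_PR.1 hφ).2.1.natDegree_pos
      rw [ev, Polynomial.eval_finset_sum, Finset.sum_eq_single_of_mem 0 (by simp)]
      · simp [Wc]
      · intro b _ hb
        simp [hb, hd.ne']
    | 1, hl, _ =>
      have := key 1 hl
      simp at this
      rw [Vc]
      have h3 := hlt 1 one_pos
      have h4 : (pp F N).coeff 1 * (1 - Q⁻¹^1) = 0 := by rw [pow_one]; linarith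
      exact (mul_eq_zero.1 h4).resolve_right h3
    | (l+2), hl, ih =>
      have := key (l+2) hl
      rw [if_pos (by omega), Nat.add_sub_cancel, ih l (by omega) (by omega)] at this
      rw [Vc, eq_div_iff (hlt _ (by omega))]
      linarith

theorem PV {N : ℕ} {y : R} (hy : y^(N+1) = 0) : ∏ φ ∈ PR F N, ev N (Wc ((Fintype.card F : ℝ)^φ.natDegree)) (y^φ.natDegree) = ev N (Vc (Fintype.card F)) y := by
  rw [← aeval_pp, aeval_trunc hy]
  exact ev_congr (fun l hl => pp_coeff hl) y

theorem local_gen (h2 : (2:F) ≠ 0) {N : ℕ} {x : R} (hx : x^(N+1) = 0) {φ : Polynomial F} (hφ : Irreducible φ) :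
    ∑ m ∈ Finset.range (N+1), eB φ m • x^m = ∏ i ∈ Finset.range (N+1), ev N (Wc ((Fintype.card F : ℝ)^φ.natDegree)) ((x^(i+1))^φ.natDegree) := by
  have hd : 0 < φ.natDegree := hφ.natDegree_pos
  haveI : Fact (Irreducible φ) := ⟨hφ⟩
  let b : Module.Basis (Fin φ.natDegree) F (AdjoinRoot φ) := (AdjoinRoot.powerBasis hφ.ne_zero).basis
  haveI : FiniteDimensional F (AdjoinRoot φ) := b.finiteDimensional_of_finite
  haveI : Finite (AdjoinRoot φ) := Module.finite_of_finite F
  letI : Fintype (AdjoinRoot φ) := Fintype.ofFinite _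
  have hc : Fintype.card (AdjoinRoot φ) = Fintype.card F ^ φ.natDegree := by
    rw [Module.card_fintype b, Fintype.card_fin]
  have h2' : (2 : AdjoinRoot φ) ≠ 0 := by
    have h3 : algebraMap F (AdjoinRoot φ) 2 ≠ 0 := (map_ne_zero_iff _ (algebraMap F (AdjoinRoot φ)).injective).2 h2
    rwa [map_ofNat] at h3
  have h := P_prod h2' (pow_npow_zero hd hx)
  simp only [Et_True] at h
  rw [hc] at h
  push_cast at h
  have h3 : ∀ i, (x^(i+1))^φ.natDegree = (x^φ.natDegree)^(i+1) := fun i => by rw [← pow_mul, ← pow_mul, mul_comm]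
  simp only [h3]
  rw [← h]
  have e1 : ∑ m ∈ Finset.range (N+1), eB φ m • x^m = ∑ m ∈ Finset.range (φ.natDegree * (N+1)), eB φ m • x^m := by
    apply Finset.sum_subset
    · intro i; simp; intro hi; nlinarith
    · intro i _ hi
      rw [pow_zero_of_lt hx (by simp at hi; omega), smul_zero]
  rw [e1]
  symm
  apply Finset.sum_of_injOn (fun m => φ.natDegree * m)
  · intro a _ c _ hac
    exact Nat.eq_of_mul_eq_mul_left hd hac
  · intro a ha
    simp only [Finset.coe_range, Set.mem_Iio] at ha ⊢
    exact (Nat.mul_lt_mul_left hd).2 ha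
  · intro m hm hm2
    rw [eB_local, if_neg, zero_smul]
    rintro ⟨c, rfl⟩
    apply hm2
    refine ⟨c, ?_, rfl⟩
    simp only [Finset.coe_range, Set.mem_Iio, Finset.mem_range] at hm ⊢
    exact (Nat.mul_lt_mul_left hd).1 hm
  · intro m _
    rw [eB_local (φ := φ), if_pos (dvd_mul_right _ _), Nat.mul_div_cancel_left _ hd, pow_mul]

theorem main_gen (h2 : (2:F) ≠ 0) {N : ℕ} {x : R} (hx : x^(N+1) = 0) :
    (∑ m ∈ Finset.range (N+1), Et (-1:F) 1 1 False m • x^m) * ∏ i ∈ Finset.range (N+1), (1 - x^(2*(2*i+1))) =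
      ∏ i ∈ Finset.range (N+1), ev N (Vc (Fintype.card F)) (x^(i+1)) := by
  rw [← E_S h2 hx, gen_False hx, Finset.prod_congr rfl (fun φ hφ => local_gen h2 hx (mem_PR.1 hφ).2.1), Finset.prod_comm]
  refine Finset.prod_congr rfl fun i _ => ?_
  exact PV (pow_npow_zero (by omega) hx)

end
end FF

open Matrix
set_option linter.all false

namespace FF
variable {F : Type} [Field F] [Fintype F]

theorem J_sq (n : ℕ) : sympJ F n * sympJ F n = -1 := by
  rw [sympJ, fromBlocks_multiply]
  simp [← fromBlocks_one, fromBlocks_neg]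

theorem J_unit (n : ℕ) : IsUnit (sympJ F n) := by
  have h : sympJ F n * (-sympJ F n) = 1 := by rw [Matrix.mul_neg, J_sq, neg_neg]
  have h' : (-sympJ F n) * sympJ F n = 1 := by rw [Matrix.neg_mul, J_sq, neg_neg]
  exact ⟨⟨_, _, h, h'⟩, rfl⟩

theorem J_tr (n : ℕ) : (sympJ F n)ᵀ = - sympJ F n := by
  rw [sympJ, fromBlocks_transpose, fromBlocks_neg]; simp

/-- reindexing function -/
def fJ (n : ℕ) : Fin (n+1) ⊕ Fin (n+1) → (Fin 1 ⊕ Fin 1) ⊕ (Fin n ⊕ Fin n) :=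
  Sum.elim (Fin.cases (Sum.inl (Sum.inl 0)) (fun i => Sum.inr (Sum.inl i))) (Fin.cases (Sum.inl (Sum.inr 0)) (fun i => Sum.inr (Sum.inr i)))

theorem J_succ (n : ℕ) : (fromBlocks (sympJ F 1) 0 0 (sympJ F n)).submatrix (fJ n) (fJ n) = sympJ F (n+1) := by
  ext i j
  rcases i with i | i <;> rcases j with j | j <;> refine Fin.cases ?_ (fun i => ?_) i <;> refine Fin.cases ?_ (fun j => ?_) j <;>
    simp [fJ, sympJ, Matrix.one_apply, Fin.succ_inj, (Fin.succ_ne_zero _).symm]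

theorem exists_symp (h2 : (2:F) ≠ 0) (n : ℕ) : ∀ (m : Type) [Fintype m] [DecidableEq m] (hc : Fintype.card m = 2 * n)
    (Θ : Matrix m m F) (hs : Θᵀ = (-1:F) • Θ) (hu : IsUnit Θ), ∃ P : Matrix m (Fin n ⊕ Fin n) F, Pᵀ * Θ * P = sympJ F n := by
  induction n with
  | zero =>
    intro m _ _ hc Θ hs hu
    exact ⟨0, Subsingleton.elim _ _⟩
  | succ n ih =>
    intro m _ _ hc Θ hs hu
    have hsk : ∀ i j, Θ j i = - Θ i j := fun i j => by
      have := congrFun (congrFun hs i) j; simpa using this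
    have hdiag : ∀ i, Θ i i = 0 := fun i => by
      have h3 : (2:F) * Θ i i = 0 := by linear_combination hsk i i
      simpa [h2] using h3
    obtain ⟨a⟩ : Nonempty m := Fintype.card_pos_iff.1 (by omega)
    obtain ⟨b, hb⟩ : ∃ b, Θ a b ≠ 0 := by
      by_contra hcon
      push Not at hcon
      have h4 : IsUnit Θᵀ := (Matrix.isUnit_transpose _).2 hu
      have h3 := Matrix.mulVec_injective_iff_isUnit.2 h4
      have h5 : Pi.single a (1:F) = (0 : m → F) := by
        apply h3
        ext j
        simp [hcon]
      have := congrFun h5 a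
      simp at this
    have hab : a ≠ b := fun h => hb (by rw [← h]; exact hdiag a)
    have hba : b ≠ a := hab.symm
    let κ := {x : m // x ≠ a ∧ x ≠ b}
    have hκ : Fintype.card κ = 2 * n := by
      have : Fintype.card κ = (Finset.univ.erase a |>.erase b).card := by
        rw [Fintype.card_subtype]; congr 1; ext x; simp [and_comm]
      rw [this, Finset.card_erase_of_mem (by simp [hba]), Finset.card_erase_of_mem (by simp), Finset.card_univ]; omega
    obtain ⟨P0, hl, hr⟩ : ∃ P0 : Matrix m (Fin 1 ⊕ Fin 1) F, (∀ i j, P0 i (Sum.inl j) = if i = a then (1:F) else 0) ∧ (∀ i j, P0 i (Sum.inr j) = if i = b then (Θ a b)⁻¹ else 0) :=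
      ⟨fun i j => Sum.elim (fun _ => if i = a then (1:F) else 0) (fun _ => if i = b then (Θ a b)⁻¹ else 0) j, fun _ _ => rfl, fun _ _ => rfl⟩
    have hP0 : P0ᵀ * Θ * P0 = sympJ F 1 := by
      ext i j
      rcases i with i | i <;> rcases j with j | j <;> rw [Matrix.mul_assoc] <;>
        simp [Matrix.mul_apply, hl, hr, sympJ, hdiag, hsk a b, hb, Subsingleton.elim i j]
    obtain ⟨K, hK⟩ : ∃ K : Matrix m κ F, ∀ i x, K i x = if i = x.1 then 1 else 0 := ⟨fun i x => if i = x.1 then 1 else 0, fun _ _ => rfl⟩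
    let Q : Matrix m κ F := K + P0 * (sympJ F 1 * (P0ᵀ * Θ * K))
    have hQ : P0ᵀ * Θ * Q = 0 := by
      have : P0ᵀ * Θ * Q = P0ᵀ * Θ * K + (P0ᵀ * Θ * P0) * (sympJ F 1 * (P0ᵀ * Θ * K)) := by
        simp only [Q, Matrix.mul_add, Matrix.mul_assoc]
      rw [this, hP0, ← Matrix.mul_assoc (sympJ F 1) (sympJ F 1), J_sq]; simp
    have hQt : Qᵀ * Θ * P0 = 0 := by
      have h3 : (Qᵀ * Θ * P0)ᵀ = 0 := by
        rw [transpose_mul, transpose_mul, transpose_transpose, hs, smul_mul, Matrix.mul_smul, ← Matrix.mul_assoc, hQ, smul_zero]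
      rw [← transpose_transpose (Qᵀ * Θ * P0), h3, transpose_zero]
    have hΘ's : (Qᵀ * Θ * Q)ᵀ = (-1:F) • (Qᵀ * Θ * Q) := by
      simp only [transpose_mul, transpose_transpose, hs, smul_mul, Matrix.mul_smul, ← Matrix.mul_assoc]
    have hΘ'u : IsUnit (Qᵀ * Θ * Q) := by
      apply inj_isUnit
      intro y y' hy
      rw [← sub_eq_zero, ← Matrix.mulVec_sub] at hy
      rw [← sub_eq_zero]
      set z := y - y' with hz
      set w := Θ *ᵥ (Q *ᵥ z) with hw
      have e1 : Qᵀ *ᵥ w = 0 := by rw [hw, mulVec_mulVec, mulVec_mulVec]; exact hy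
      have e2 : P0ᵀ *ᵥ w = 0 := by rw [hw, mulVec_mulVec, mulVec_mulVec, hQ, zero_mulVec]
      have e3 : Kᵀ *ᵥ w = 0 := by
        have : Qᵀ *ᵥ w = Kᵀ *ᵥ w + (sympJ F 1 * (P0ᵀ * Θ * K))ᵀ *ᵥ (P0ᵀ *ᵥ w) := by
          simp only [Q, transpose_add, add_mulVec, transpose_mul, mulVec_mulVec]
        rw [e1, e2, mulVec_zero, add_zero] at this
        exact this.symm
      have e4 : w = 0 := by
        ext i
        by_cases hia : i = a
        · have := congrFun e2 (Sum.inl 0)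
          simpa [hl, hr, mulVec, dotProduct, hia] using this
        by_cases hib : i = b
        · have := congrFun e2 (Sum.inr 0)
          simpa [hl, hr, mulVec, dotProduct, hib, hb] using this
        · have := congrFun e3 ⟨i, hia, hib⟩
          simpa [hK, mulVec, dotProduct] using this
      have e5 : Q *ᵥ z = 0 := Matrix.mulVec_injective_iff_isUnit.2 hu (by simpa [hw] using e4)
      ext x
      have e6 := congrFun e5 x.1
      have e7 : (Q *ᵥ z) x.1 = z x + (P0 *ᵥ ((sympJ F 1 * (P0ᵀ * Θ * K)) *ᵥ z)) x.1 := by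
        simp only [Q, add_mulVec, Pi.add_apply, mulVec_mulVec]
        congr 1
        simp [hK, mulVec, dotProduct, Subtype.ext_iff.symm]
      have e8 : ∀ v, (P0 *ᵥ v) x.1 = 0 := by
        intro v
        simp [mulVec, dotProduct, hl, hr, x.2.1, x.2.2]
      rw [e7, e8] at e6
      simpa using e6
    obtain ⟨P', hP'⟩ := ih κ hκ _ hΘ's hΘ'u
    refine ⟨(fromCols P0 (Q * P')).submatrix id (fJ n), ?_⟩
    rw [← J_succ, transpose_submatrix]
    have h9 : (fromCols P0 (Q * P'))ᵀ * Θ * fromCols P0 (Q * P') = fromBlocks (sympJ F 1) 0 0 (sympJ F n) := by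
      rw [transpose_fromCols, fromRows_mul, fromRows_mul_fromCols, hP0, ← Matrix.mul_assoc, hQ, transpose_mul, Matrix.zero_mul]
      congr 1
      · rw [Matrix.mul_assoc, Matrix.mul_assoc, ← Matrix.mul_assoc Qᵀ, hQt, Matrix.mul_zero]
      · rw [← hP']; simp only [Matrix.mul_assoc]
    rw [← h9]
    ext i j
    generalize fromCols P0 (Q * P') = Y
    simp [Matrix.mul_apply]

theorem exists_symp' (h2 : (2:F) ≠ 0) (n : ℕ) (Θ : Matrix (Fin n ⊕ Fin n) (Fin n ⊕ Fin n) F) (hs : Θᵀ = (-1:F) • Θ) (hu : IsUnit Θ) :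
    ∃ P : Matrix (Fin n ⊕ Fin n) (Fin n ⊕ Fin n) F, IsUnit P ∧ Pᵀ * Θ * P = sympJ F n := by
  obtain ⟨P, hP⟩ := exists_symp h2 n _ (by simp; ring) Θ hs hu
  refine ⟨P, ?_, hP⟩
  apply inj_isUnit
  intro x y hxy
  apply Matrix.mulVec_injective_iff_isUnit.2 (J_unit (F := F) n)
  rw [← hP]
  simp only [← mulVec_mulVec] at hxy ⊢
  rw [hxy]

theorem fib_count (h2 : (2:F) ≠ 0) (n : ℕ) (Θ : Matrix (Fin n ⊕ Fin n) (Fin n ⊕ Fin n) F) (hs : Θᵀ = (-1:F) • Θ) (hu : IsUnit Θ) :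
    Nat.card {R : Matrix (Fin n ⊕ Fin n) (Fin n ⊕ Fin n) F × Matrix (Fin n ⊕ Fin n) (Fin n ⊕ Fin n) F // isT (-1:F) 1 1 False Θ R.1 R.2} = spCommPairs F n := by
  obtain ⟨P, hPu, hP⟩ := exists_symp' h2 n Θ hs hu
  have hJ := J_unit (F := F) n
  have hPt : IsUnit Pᵀ := (Matrix.isUnit_transpose _).2 hPu
  have hPd := (Matrix.isUnit_iff_isUnit_det _).1 hPu
  have hRd := (Matrix.isUnit_iff_isUnit_det _).1 (hJ.mul hPt)
  have hJt := J_tr (F := F) n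
  have hJs := J_sq (F := F) n
  set J := sympJ F n with hJdef
  let ψ : Matrix (Fin n ⊕ Fin n) (Fin n ⊕ Fin n) F ≃ Matrix (Fin n ⊕ Fin n) (Fin n ⊕ Fin n) F :=
    { toFun := fun A => P * A * (J * Pᵀ)
      invFun := fun A => P⁻¹ * A * (J * Pᵀ)⁻¹
      left_inv := fun A => by
        show P⁻¹ * (P * A * (J * Pᵀ)) * (J * Pᵀ)⁻¹ = A
        rw [Matrix.mul_assoc P A, ← Matrix.mul_assoc P⁻¹ P, nonsing_inv_mul _ hPd, Matrix.one_mul, Matrix.mul_assoc A, mul_nonsing_inv _ hRd, Matrix.mul_one]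
      right_inv := fun A => by
        show P * (P⁻¹ * A * (J * Pᵀ)⁻¹) * (J * Pᵀ) = A
        rw [Matrix.mul_assoc P⁻¹ A, ← Matrix.mul_assoc P P⁻¹, mul_nonsing_inv _ hPd, Matrix.one_mul, Matrix.mul_assoc A, nonsing_inv_mul _ hRd, Matrix.mul_one] }
  have hcan : ∀ X Y : Matrix (Fin n ⊕ Fin n) (Fin n ⊕ Fin n) F, P * X * Pᵀ = P * Y * Pᵀ ↔ X = Y := by
    intro X Y
    rw [hPt.mul_left_inj, hPu.mul_right_inj]
  have hψ : ∀ A, ψ A = P * (A * J) * Pᵀ := fun A => by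
    show P * A * (J * Pᵀ) = _
    simp only [Matrix.mul_assoc]
  have hψs : ∀ A, (ψ A)ᵀ = (1:F) • ψ A ↔ A * J = (A * J)ᵀ := by
    intro A
    have : (ψ A)ᵀ = P * (A * J)ᵀ * Pᵀ := by rw [hψ, transpose_mul, transpose_mul, transpose_transpose, Matrix.mul_assoc]
    rw [this, hψ, one_smul, hcan, eq_comm]
  have hm : ∀ A B, ψ A * Θ * ψ B = P * (-(A * B * J)) * Pᵀ := by
    intro A B
    calc ψ A * Θ * ψ B = P * (A * J * (Pᵀ * Θ * P) * (B * J)) * Pᵀ := by simp only [hψ, Matrix.mul_assoc]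
      _ = P * (A * (J * J) * (B * J)) * Pᵀ := by rw [hP]; simp only [Matrix.mul_assoc]
      _ = _ := by rw [hJs]; simp [Matrix.mul_assoc]
  symm
  refine Nat.card_congr (Equiv.subtypeEquiv (ψ.prodCongr ψ) ?_)
  rintro ⟨A, B⟩
  simp only [Equiv.prodCongr_apply, Prod.map, isT, hψs, hm, hcan, hs, hu, neg_inj, false_imp_iff, and_true, true_and]
  rw [hJ.mul_left_inj]

theorem card_isT (h2 : (2:F) ≠ 0) (n : ℕ) :
    Nat.card {P : Matrix (Fin (n+n)) (Fin (n+n)) F × Matrix (Fin (n+n)) (Fin (n+n)) F × Matrix (Fin (n+n)) (Fin (n+n)) F // isT (-1:F) 1 1 False P.1 P.2.1 P.2.2}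
      = NSn (-1:F) (n+n) * spCommPairs F n := by
  have e1 : NSn (-1:F) (n+n) = Nat.card {M : Matrix (Fin n ⊕ Fin n) (Fin n ⊕ Fin n) F // Mᵀ = (-1:F) • M ∧ IsUnit M} := by
    refine Nat.card_congr (Equiv.subtypeEquiv (Matrix.reindex finSumFinEquiv.symm finSumFinEquiv.symm) ?_)
    intro M
    refine and_congr ?_ ?_
    · rw [transpose_reindex, ← (Matrix.reindex finSumFinEquiv.symm finSumFinEquiv.symm).injective.eq_iff]; rfl
    · exact (Matrix.isUnit_submatrix_equiv _ _).symm
  let e : Matrix (Fin (n+n)) (Fin (n+n)) F ≃ Matrix (Fin n ⊕ Fin n) (Fin n ⊕ Fin n) F := Matrix.reindex finSumFinEquiv.symm finSumFinEquiv.symm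
  rw [e1, Nat.card_congr (Equiv.subtypeEquiv (q := fun P : Matrix (Fin n ⊕ Fin n) (Fin n ⊕ Fin n) F × Matrix (Fin n ⊕ Fin n) (Fin n ⊕ Fin n) F × Matrix (Fin n ⊕ Fin n) (Fin n ⊕ Fin n) F => isT (-1:F) 1 1 False P.1 P.2.1 P.2.2) (e.prodCongr (e.prodCongr e)) (fun P => isT_reindex _ _ _ _ _ _ _ _))]
  have e2 : {P : Matrix (Fin n ⊕ Fin n) (Fin n ⊕ Fin n) F × Matrix (Fin n ⊕ Fin n) (Fin n ⊕ Fin n) F × Matrix (Fin n ⊕ Fin n) (Fin n ⊕ Fin n) F // isT (-1:F) 1 1 False P.1 P.2.1 P.2.2} ≃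
      (Θ : {M : Matrix (Fin n ⊕ Fin n) (Fin n ⊕ Fin n) F // Mᵀ = (-1:F) • M ∧ IsUnit M}) × {R : Matrix (Fin n ⊕ Fin n) (Fin n ⊕ Fin n) F × Matrix (Fin n ⊕ Fin n) (Fin n ⊕ Fin n) F // isT (-1:F) 1 1 False Θ.1 R.1 R.2} :=
    { toFun := fun P => ⟨⟨P.1.1, P.2.1, P.2.2.1⟩, ⟨P.1.2, P.2⟩⟩
      invFun := fun S => ⟨(S.1.1, S.2.1), S.2.2⟩
      left_inv := fun P => rfl
      right_inv := fun S => rfl }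
  haveI : Finite F := inferInstance
  letI : Fintype {M : Matrix (Fin n ⊕ Fin n) (Fin n ⊕ Fin n) F // Mᵀ = (-1:F) • M ∧ IsUnit M} := Fintype.ofFinite _
  rw [Nat.card_congr e2, Nat.card_sigma]
  simp only [fun Θ : {M : Matrix (Fin n ⊕ Fin n) (Fin n ⊕ Fin n) F // Mᵀ = (-1:F) • M ∧ IsUnit M} => fib_count h2 n Θ.1 Θ.2.1 Θ.2.2]
  rw [Finset.sum_const, smul_eq_mul, Finset.card_univ, Nat.card_eq_fintype_card]

theorem NS_one_even (n : ℕ) : NS (1:F) (n+n) = Fintype.card F ^ (2*n^2+n) := by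
  have h : ∀ l, (NS (1:F) l)^2 = Fintype.card F ^ (l*(l+1)) := by
    intro l
    induction l with
    | zero => simp [NS_zero]
    | succ l ih =>
      rw [NS_succ (by ring), NS_one_one, mul_pow, mul_pow, ih, ← pow_mul, ← pow_add, ← pow_add]
      congr 1; ring
  have := h (n+n)
  rw [show (n+n)*(n+n+1) = (2*n^2+n)*2 by ring, pow_mul] at this
  exact (Nat.pow_left_injective (n := 2) (by norm_num)) this

theorem Et_even (h2 : (2:F) ≠ 0) (n : ℕ) :
    Et (-1:F) 1 1 False (n+n) = spCommPairs F n * Wc (Fintype.card F) (n+n) / (Fintype.card F : ℝ)^(2*n^2+n) := by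
  rw [Et, card_isT h2, ← wt_Wc h2, wt, NS_one_even]
  have hq : (0:ℝ) < (Fintype.card F : ℝ) := q_pos (F := F)
  push_cast
  field_simp

end FF

open Matrix
set_option linter.all false

namespace FF

/-- nonnegative coefficients with sum `a` -/
def Good (f : PowerSeries ℝ) (a : ℝ) : Prop :=
  (∀ n, 0 ≤ PowerSeries.coeff n f) ∧ HasSum (fun n => PowerSeries.coeff n f) a

theorem Good.mul {f g : PowerSeries ℝ} {a b : ℝ} (hf : Good f a) (hg : Good g b) : Good (f * g) (a * b) := by
  refine ⟨fun n => ?_, ?_⟩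
  · rw [PowerSeries.coeff_mul]
    exact Finset.sum_nonneg fun p _ => mul_nonneg (hf.1 _) (hg.1 _)
  · have h1 : Summable fun n => ‖PowerSeries.coeff n f‖ := by
      simpa only [Real.norm_of_nonneg (hf.1 _)] using hf.2.summable
    have h2 : Summable fun n => ‖PowerSeries.coeff n g‖ := by
      simpa only [Real.norm_of_nonneg (hg.1 _)] using hg.2.summable
    have h3 := tsum_mul_tsum_eq_tsum_sum_antidiagonal_of_summable_norm h1 h2
    have h4 := (summable_norm_sum_mul_antidiagonal_of_summable_norm h1 h2).of_norm
    rw [hf.2.tsum_eq, hg.2.tsum_eq] at h3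
    rw [h3]
    simp only [PowerSeries.coeff_mul]
    exact h4.hasSum

theorem Good.one : Good 1 1 := by
  refine ⟨fun n => ?_, ?_⟩
  · rw [PowerSeries.coeff_one]; split_ifs <;> norm_num
  · simp only [PowerSeries.coeff_one]
    exact hasSum_ite_eq 0 (1:ℝ)

theorem Good.prod {f : ℕ → PowerSeries ℝ} {a : ℕ → ℝ} (N : ℕ) (h : ∀ i, Good (f i) (a i)) :
    Good (∏ i ∈ Finset.range N, f i) (∏ i ∈ Finset.range N, a i) := by
  induction N with
  | zero => simpa using Good.one
  | succ N ih => rw [Finset.prod_range_succ, Finset.prod_range_succ]; exact ih.mul (h N)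

theorem Good.le_mul {f g : PowerSeries ℝ} {a b : ℝ} (hf : Good f a) (hg : Good g b) (h0 : PowerSeries.coeff 0 g = 1) (k : ℕ) :
    PowerSeries.coeff k f ≤ PowerSeries.coeff k (f * g) := by
  rw [PowerSeries.coeff_mul]
  have h := Finset.single_le_sum (f := fun p : ℕ × ℕ => PowerSeries.coeff p.1 f * PowerSeries.coeff p.2 g) (s := Finset.HasAntidiagonal.antidiagonal k)
    (fun p _ => mul_nonneg (hf.1 _) (hg.1 _)) (a := (k, 0)) (by simp)
  simpa [h0] using h

/-- `v(X^d)` -/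
noncomputable def EE (v : ℕ → ℝ) (d : ℕ) : PowerSeries ℝ := PowerSeries.mk fun k => if d ∣ k then v (k / d) else 0

theorem EE_good {v : ℕ → ℝ} {d : ℕ} (hd : 0 < d) (h0 : ∀ l, 0 ≤ v l) {a : ℝ} (h : HasSum v a) : Good (EE v d) a := by
  refine ⟨fun n => ?_, ?_⟩
  · rw [EE, PowerSeries.coeff_mk]; split_ifs
    · exact h0 _
    · exact le_rfl
  · simp only [EE, PowerSeries.coeff_mk]
    have hi : Function.Injective (fun l : ℕ => d * l) := fun a b hab => Nat.eq_of_mul_eq_mul_left hd hab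
    rw [← hi.hasSum_iff]
    · convert h using 1
      ext l
      simp [Nat.mul_div_cancel_left _ hd]
    · intro k hk
      rw [if_neg]
      rintro ⟨l, rfl⟩
      exact hk ⟨l, rfl⟩

theorem EE_coeff_zero (v : ℕ → ℝ) (d : ℕ) : PowerSeries.coeff 0 (EE v d) = v 0 := by simp [EE]

theorem EE_geom (a : ℝ) {d : ℕ} (hd : 0 < d) : (1 - a • (PowerSeries.X : PowerSeries ℝ)^d) * EE (fun j => a^j) d = 1 := by
  ext k
  rw [sub_mul, one_mul, smul_mul_assoc, map_sub, PowerSeries.coeff_smul, PowerSeries.coeff_X_pow_mul', PowerSeries.coeff_one]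
  simp only [EE, PowerSeries.coeff_mk]
  by_cases hk : k = 0
  · subst hk; simp [hd.ne']
  rw [if_neg hk]
  by_cases hdk : d ∣ k
  · obtain ⟨l, rfl⟩ := hdk
    obtain ⟨l, rfl⟩ : ∃ l', l = l' + 1 := ⟨l - 1, by have : l ≠ 0 := by rintro rfl; simp at hk
                                                     omega⟩
    have h1 : d * (l+1) - d = d * l := by rw [Nat.mul_succ]; simp
    have h2 : d ≤ d * (l+1) := Nat.le_mul_of_pos_right _ (by omega)
    rw [if_pos (dvd_mul_right _ _), if_pos h2, h1, if_pos (dvd_mul_right _ _), Nat.mul_div_cancel_left _ hd, Nat.mul_div_cancel_left _ hd, pow_succ]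
    simp; ring
  · rw [if_neg hdk]
    split_ifs with h1 h2
    · exfalso; apply hdk
      have := (Nat.dvd_add_right (dvd_refl d)).2 h2
      rwa [Nat.add_sub_cancel' h1] at this
    · simp
    · simp

section
variable {R : Type} [CommRing R] [Algebra ℝ R]

/-- evaluation in a truncation -/
theorem EE_ev (φ : PowerSeries ℝ →ₐ[ℝ] R) {N : ℕ} (hφ : (φ PowerSeries.X)^(N+1) = 0) (v : ℕ → ℝ) {d : ℕ} (hd : 0 < d) :
    φ (EE v d) = ev N v (φ PowerSeries.X ^ d) := by
  have h1 : ev N v (φ PowerSeries.X ^ d) = φ (ev N v (PowerSeries.X ^ d)) := by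
    simp only [ev, map_sum, map_smul, map_pow]
  rw [h1, ← sub_eq_zero, ← map_sub]
  have h2 : (PowerSeries.X : PowerSeries ℝ)^(N+1) ∣ EE v d - ev N v (PowerSeries.X ^ d) := by
    rw [PowerSeries.X_pow_dvd_iff]
    intro k hk
    rw [map_sub, sub_eq_zero, EE, PowerSeries.coeff_mk, ev, map_sum]
    simp only [PowerSeries.coeff_smul, ← pow_mul, PowerSeries.coeff_X_pow, smul_eq_mul, mul_ite, mul_one, mul_zero]
    split_ifs with h
    · obtain ⟨l, rfl⟩ := h
      have hl : l < N + 1 := by nlinarith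
      rw [Finset.sum_eq_single_of_mem l (Finset.mem_range.2 hl)]
      · simp [Nat.mul_div_cancel_left _ hd]
      · intro b _ hb
        rw [if_neg]
        intro hh
        exact hb (Nat.eq_of_mul_eq_mul_left hd hh).symm
    · symm
      refine Finset.sum_eq_zero fun l _ => if_neg ?_
      rintro rfl
      exact h (dvd_mul_right _ _)
  obtain ⟨c, hc⟩ := h2
  rw [hc, map_mul, map_pow, hφ, zero_mul]

end

theorem sandwich {b : ℕ → ℝ} {h : ℕ → ℕ → ℝ} {Λ : ℕ → ℝ} {L : ℝ} (h0 : ∀ N k, 0 ≤ h N k) (hm : ∀ N k, h N k ≤ h (N+1) k)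
    (hs : ∀ N, HasSum (h N) (Λ N)) (hL : Filter.Tendsto Λ Filter.atTop (nhds L))
    (hb : ∀ n, b n = ∑ k ∈ Finset.range (2*n+1), h (2*n) k) : Filter.Tendsto b Filter.atTop (nhds L) := by
  have hmono : ∀ k, Monotone (fun N => h N k) := fun k => monotone_nat_of_le_succ (fun N => hm N k)
  have h2n : Filter.Tendsto (fun n : ℕ => 2 * n) Filter.atTop Filter.atTop := Filter.tendsto_atTop_mono (fun n => by show n ≤ 2 * n; omega) Filter.tendsto_id
  rw [tendsto_order]
  constructor
  · intro a ha
    obtain ⟨N, hN⟩ := ((tendsto_order.1 hL).1 a ha).exists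
    have h1 := (hs N).tendsto_sum_nat.comp (Filter.tendsto_atTop_mono (fun n : ℕ => (by omega : n ≤ 2*n+1)) Filter.tendsto_id)
    filter_upwards [(tendsto_order.1 h1).1 a hN, Filter.eventually_ge_atTop N] with n hn hNn
    rw [hb]
    refine hn.trans_le (Finset.sum_le_sum fun k _ => hmono k (by omega))
  · intro a ha
    filter_upwards [(tendsto_order.1 (hL.comp h2n)).2 a ha] with n hn
    rw [hb]
    exact (sum_le_hasSum _ (fun k _ => h0 _ _) (hs (2*n))).trans_lt hn

end FF

open Matrix
set_option linter.all false

namespace FF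

section
variable {Q : ℝ} (hQ : 2 ≤ Q)

theorem Vc_den (hQ : 2 ≤ Q) (l : ℕ) : 3/4 ≤ 1 - (Q⁻¹)^(l+2) := by
  have h1 : Q⁻¹ ≤ 1/2 := by rw [inv_le_comm₀ (by linarith) (by norm_num)]; norm_num; exact hQ
  have h0 : 0 ≤ Q⁻¹ := by positivity
  have h2 : (Q⁻¹)^(l+2) ≤ (Q⁻¹)^2 := pow_le_pow_of_le_one h0 (by linarith) (by omega)
  nlinarith

theorem Vc_nonneg (hQ : 2 ≤ Q) : ∀ l, 0 ≤ Vc Q l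
  | 0 => by simp [Vc]
  | 1 => by simp [Vc]
  | (l+2) => by
    rw [Vc]
    have h1 := Vc_nonneg hQ l
    have h2 := Vc_den hQ l
    exact div_nonneg (mul_nonneg (by linarith) h1) (by linarith)

theorem Vc_bound (hQ : 2 ≤ Q) {y : ℝ} (hy0 : 0 ≤ y) (hy : Q * y^2 ≤ 1/2) : ∀ l, Vc Q l * y^l ≤ (9/10)^l
  | 0 => by simp [Vc]
  | 1 => by simp [Vc]; norm_num
  | (l+2) => by
    have ih := Vc_bound hQ hy0 hy l
    have h2 := Vc_den hQ l
    have h3 : 0 ≤ Vc Q l * y^l := mul_nonneg (Vc_nonneg hQ l) (by positivity)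
    have h4 : Vc Q (l+2) * y^(l+2) = (Q * y^2) * (Vc Q l * y^l) / (1 - (Q⁻¹)^(l+2)) := by rw [Vc]; ring
    rw [h4, div_le_iff₀ (by linarith), pow_add]
    have h5 : (0:ℝ) ≤ (9/10)^l := by positivity
    have h6 : (Q * y^2) * (Vc Q l * y^l) ≤ 1/2 * (9/10)^l := by
      apply mul_le_mul hy ih h3 (by norm_num)
    nlinarith

theorem Vc_summable (hQ : 2 ≤ Q) {y : ℝ} (hy0 : 0 ≤ y) (hy : Q * y^2 ≤ 1/2) : Summable fun l => Vc Q l * y^l :=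
  Summable.of_nonneg_of_le (fun l => mul_nonneg (Vc_nonneg hQ l) (by positivity)) (Vc_bound hQ hy0 hy)
    (summable_geometric_of_lt_one (by norm_num) (by norm_num))

noncomputable def Vf (Q y : ℝ) : ℝ := ∑' l, Vc Q l * y^l

theorem Vc_rec (hQ : 2 ≤ Q) (l : ℕ) : Vc Q (l+2) - Vc Q (l+2) * (Q⁻¹)^(l+2) = Q * Vc Q l := by
  have h2 := Vc_den hQ l
  have h3 : 1 - (Q⁻¹)^(l+2) ≠ 0 := by linarith
  have h4 : Vc Q (l+2) * (1 - (Q⁻¹)^(l+2)) = Q * Vc Q l := by rw [Vc, div_mul_cancel₀ _ h3]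
  linear_combination h4

theorem Vf_rec (hQ : 2 ≤ Q) {y : ℝ} (hy0 : 0 ≤ y) (hy : Q * y^2 ≤ 1/2) : Vf Q y * (1 - Q * y^2) = Vf Q (Q⁻¹ * y) := by
  have hx0 : 0 < Q⁻¹ := by positivity
  have hx1 : Q⁻¹ ≤ 1 := inv_le_one_of_one_le₀ (by linarith)
  have hs := Vc_summable hQ hy0 hy
  have hs' : Summable fun l => Vc Q l * (Q⁻¹ * y)^l := by
    apply Vc_summable hQ (by positivity)
    have : (Q⁻¹ * y)^2 ≤ y^2 := by
      apply pow_le_pow_left₀ (by positivity); nlinarith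
    nlinarith
  have e1 : Vf Q y = 1 + ∑' l, Vc Q (l+2) * y^(l+2) := by
    rw [Vf, ← hs.sum_add_tsum_nat_add 2]
    simp [Finset.sum_range_succ, Vc]
  have e2 : Vf Q (Q⁻¹ * y) = 1 + ∑' l, Vc Q (l+2) * (Q⁻¹ * y)^(l+2) := by
    rw [Vf, ← hs'.sum_add_tsum_nat_add 2]
    simp [Finset.sum_range_succ, Vc]
  have s1 : Summable fun l => Vc Q (l+2) * y^(l+2) := (summable_nat_add_iff 2).2 hs
  have s2 : Summable fun l => Vc Q (l+2) * (Q⁻¹ * y)^(l+2) := (summable_nat_add_iff 2).2 hs'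
  have e3 : (∑' l, Vc Q (l+2) * y^(l+2)) - ∑' l, Vc Q (l+2) * (Q⁻¹ * y)^(l+2) = Vf Q y * (Q * y^2) := by
    rw [← s1.tsum_sub s2, Vf, ← tsum_mul_right]
    refine tsum_congr fun l => ?_
    have := Vc_rec hQ l
    rw [mul_pow]
    linear_combination y^(l+2) * this
  linear_combination e1 - e2 + e3

theorem Vf_ge_one (hQ : 2 ≤ Q) {y : ℝ} (hy0 : 0 ≤ y) (hy : Q * y^2 ≤ 1/2) : 1 ≤ Vf Q y := by
  have := (Vc_summable hQ hy0 hy).le_tsum 0 (fun l _ => mul_nonneg (Vc_nonneg hQ l) (by positivity))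
  simpa [Vc, Vf] using this

theorem Vf_le (hQ : 2 ≤ Q) {y s : ℝ} (hy0 : 0 ≤ y) (hy : Q * y^2 ≤ 1/2) (hs0 : 0 ≤ s) (hs1 : s ≤ 1) :
    Vf Q (s * y) - 1 ≤ s^2 * (Vf Q y - 1) := by
  have hs := Vc_summable hQ hy0 hy
  have hs' : Summable fun l => Vc Q l * (s * y)^l := by
    apply Vc_summable hQ (by positivity)
    have : (s * y)^2 ≤ y^2 := by
      apply pow_le_pow_left₀ (by positivity); nlinarith
    nlinarith
  have e1 : Vf Q y = 1 + ∑' l, Vc Q (l+2) * y^(l+2) := by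
    rw [Vf, ← hs.sum_add_tsum_nat_add 2]
    simp [Finset.sum_range_succ, Vc]
  have e2 : Vf Q (s * y) = 1 + ∑' l, Vc Q (l+2) * (s * y)^(l+2) := by
    rw [Vf, ← hs'.sum_add_tsum_nat_add 2]
    simp [Finset.sum_range_succ, Vc]
  have s1 : Summable fun l => Vc Q (l+2) * y^(l+2) := (summable_nat_add_iff 2).2 hs
  have s2 : Summable fun l => Vc Q (l+2) * (s * y)^(l+2) := (summable_nat_add_iff 2).2 hs'
  rw [e1, e2, add_sub_cancel_left, add_sub_cancel_left, ← tsum_mul_left]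
  refine s2.tsum_le_tsum (fun l => ?_) (s1.mul_left _)
  have h1 : 0 ≤ Vc Q (l+2) * y^(l+2) := mul_nonneg (Vc_nonneg hQ _) (by positivity)
  have h2 : s^(l+2) ≤ s^2 := pow_le_pow_of_le_one hs0 hs1 (by omega)
  calc Vc Q (l+2) * (s * y)^(l+2) = s^(l+2) * (Vc Q (l+2) * y^(l+2)) := by rw [mul_pow]; ring
    _ ≤ _ := mul_le_mul_of_nonneg_right h2 h1

end

/-! the numbers `om c a` -/
section
variable {Q c : ℝ}

/-- `om Q c a = w(x^(a+1))`, `c² = x = 1/Q` -/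
noncomputable def om (Q c : ℝ) (a : ℕ) : ℝ := Vf Q (c^(a+2))

theorem om_arg (hQ : 2 ≤ Q) (hc0 : 0 < c) (hc : c^2 = Q⁻¹) (a : ℕ) : Q * (c^(a+2))^2 = (Q⁻¹)^(a+1) := by
  have hQ0 : Q ≠ 0 := by linarith
  calc Q * (c^(a+2))^2 = Q * (c^2)^(a+2) := by ring
    _ = (Q * Q⁻¹) * Q⁻¹^(a+1) := by rw [hc]; ring
    _ = _ := by rw [mul_inv_cancel₀ hQ0, one_mul]

theorem x_le (hQ : 2 ≤ Q) : Q⁻¹ ≤ 1/2 := by rw [inv_le_comm₀ (by linarith) (by norm_num)]; norm_num; exact hQ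

theorem om_cond (hQ : 2 ≤ Q) (hc0 : 0 < c) (hc : c^2 = Q⁻¹) (a : ℕ) : Q * (c^(a+2))^2 ≤ 1/2 := by
  rw [om_arg hQ hc0 hc]
  have h0 : 0 ≤ Q⁻¹ := by positivity
  calc Q⁻¹^(a+1) ≤ Q⁻¹^1 := pow_le_pow_of_le_one h0 (by linarith [x_le hQ]) (by omega)
    _ ≤ _ := by rw [pow_one]; exact x_le hQ

theorem om_rec (hQ : 2 ≤ Q) (hc0 : 0 < c) (hc : c^2 = Q⁻¹) (a : ℕ) : om Q c a * (1 - (Q⁻¹)^(a+1)) = om Q c (a+2) := by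
  rw [om, ← om_arg hQ hc0 hc a, Vf_rec hQ (by positivity) (om_cond hQ hc0 hc a), om, ← hc]
  congr 1; ring

theorem om_ge (hQ : 2 ≤ Q) (hc0 : 0 < c) (hc : c^2 = Q⁻¹) (a : ℕ) : 1 ≤ om Q c a :=
  Vf_ge_one hQ (by positivity) (om_cond hQ hc0 hc a)

theorem om_le (hQ : 2 ≤ Q) (hc0 : 0 < c) (hc : c^2 = Q⁻¹) (a : ℕ) : om Q c a - 1 ≤ (Q⁻¹)^a * (om Q c 0 - 1) := by
  have hc1 : c ≤ 1 := by nlinarith [x_le hQ]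
  have := Vf_le hQ (y := c^2) (s := c^a) (by positivity) (om_cond hQ hc0 hc 0) (by positivity) (pow_le_one₀ hc0.le hc1)
  rw [om, om]
  rw [show c^(a+2) = c^a * c^2 by ring, ← hc, show (c^2)^a = (c^a)^2 by ring]
  exact this

theorem om_hasSum (hQ : 2 ≤ Q) (hc0 : 0 < c) (hc : c^2 = Q⁻¹) (a : ℕ) : HasSum (fun l => Vc Q l * (c^(a+2))^l) (om Q c a) :=
  (Vc_summable hQ (by positivity) (om_cond hQ hc0 hc a)).hasSum

end
end FF

open Matrix
set_option linter.all false

namespace FF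
variable {F : Type} [Field F] [Fintype F]

/-- rescaled generating function -/
noncomputable def BB (F : Type) [Field F] [Fintype F] (c : ℝ) : PowerSeries ℝ := EE (fun m => Et (-1:F) 1 1 False m * c^m) 1

noncomputable def UU (Q c : ℝ) (i : ℕ) : PowerSeries ℝ := EE (fun l => Vc Q l * (c^i)^l) i

noncomputable def GI (Q : ℝ) (i : ℕ) : PowerSeries ℝ := EE (fun j => ((Q⁻¹)^(2*i+1))^j) (2*(2*i+1))

noncomputable def WW (Q c : ℝ) : PowerSeries ℝ := EE (fun l => Vc Q l * (c^3)^l) 1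

noncomputable def HH (Q c : ℝ) (N : ℕ) : PowerSeries ℝ :=
  WW Q c * ((∏ i ∈ Finset.range N, UU Q c (i+2)) * ∏ i ∈ Finset.range (N+1), GI Q i)

theorem UU_one {Q c : ℝ} (hQ : 2 ≤ Q) (hc : c^2 = Q⁻¹) : (1 - (PowerSeries.X : PowerSeries ℝ)^2) * UU Q c 1 = WW Q c := by
  have hQ0 : Q ≠ 0 := by linarith
  ext k
  rw [sub_mul, one_mul, map_sub, PowerSeries.coeff_X_pow_mul']
  simp only [UU, WW, EE, PowerSeries.coeff_mk, one_dvd, if_true, Nat.div_one, pow_one]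
  match k with
  | 0 => simp
  | 1 => simp [Vc]
  | (k+2) =>
    rw [if_pos (by omega), Nat.add_sub_cancel]
    have h := Vc_rec hQ k
    have h1 : (c^3)^(k+2) = c^(k+2) * (Q⁻¹)^(k+2) := by rw [← hc]; ring
    have h2 : c^k = c^(k+2) * Q := by rw [pow_add, hc, mul_assoc, inv_mul_cancel₀ hQ0, mul_one]
    rw [h1, h2]
    linear_combination c^(k+2) * h

section
variable {R : Type} [CommRing R] [Algebra ℝ R]

theorem ev_scale (N : ℕ) (v : ℕ → ℝ) (s : ℝ) (y : R) : ev N (fun l => v l * s^l) y = ev N v (s • y) := by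
  simp only [ev, smul_pow, smul_smul]

theorem key_phi (h2 : (2:F) ≠ 0) {c : ℝ} (hQ : (2:ℝ) ≤ Fintype.card F) (hc : c^2 = (Fintype.card F : ℝ)⁻¹)
    (φ : PowerSeries ℝ →ₐ[ℝ] R) {N : ℕ} (hφ : (φ PowerSeries.X)^(N+1) = 0) :
    φ ((1 - PowerSeries.X^2) * BB F c) = φ (HH (Fintype.card F) c N) := by
  set Q : ℝ := (Fintype.card F : ℝ) with hQd
  set y := φ PowerSeries.X with hy
  have hx : (c • y)^(N+1) = 0 := by rw [smul_pow, hφ, smul_zero]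
  have hm := main_gen h2 hx
  have hB : φ (BB F c) = ∑ m ∈ Finset.range (N+1), Et (-1:F) 1 1 False m • (c • y)^m := by
    rw [BB, EE_ev φ hφ _ one_pos, ev_scale, ← hy, pow_one, ev]
  have hU : ∀ i, φ (UU Q c (i+1)) = ev N (Vc Q) ((c • y)^(i+1)) := by
    intro i
    rw [UU, EE_ev φ hφ _ (Nat.succ_pos i), ev_scale, smul_pow]
  have hG : ∀ i, (1 - (c • y)^(2*(2*i+1))) * φ (GI Q i) = 1 := by
    intro i
    have h := congrArg φ (EE_geom ((Q⁻¹)^(2*i+1)) (d := 2*(2*i+1)) (by omega))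
    rw [map_mul, map_sub, map_one, map_smul, map_pow, ← hy] at h
    rw [smul_pow, pow_mul c, hc]
    exact h
  have hGp : (∏ i ∈ Finset.range (N+1), (1 - (c • y)^(2*(2*i+1)))) * ∏ i ∈ Finset.range (N+1), φ (GI Q i) = 1 := by
    rw [← Finset.prod_mul_distrib]
    exact Finset.prod_eq_one fun i _ => hG i
  have hUp : ∏ i ∈ Finset.range (N+1), ev N (Vc Q) ((c • y)^(i+1)) = (∏ i ∈ Finset.range N, φ (UU Q c (i+2))) * φ (UU Q c 1) := by
    rw [Finset.prod_range_succ', ← hU 0]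
    congr 1
    exact Finset.prod_congr rfl fun i _ => (hU (i+1)).symm
  rw [← hB, hUp] at hm
  have hW := congrArg φ (UU_one hQ hc)
  rw [HH, map_mul, map_mul, ← hW, map_mul, map_mul, map_prod, map_prod]
  calc φ (1 - PowerSeries.X^2) * φ (BB F c)
      = φ (1 - PowerSeries.X^2) * (φ (BB F c) * ∏ i ∈ Finset.range (N+1), (1 - (c • y)^(2*(2*i+1)))) * ∏ i ∈ Finset.range (N+1), φ (GI Q i) := by
        rw [mul_assoc, mul_assoc (φ (BB F c)), hGp, mul_one]
    _ = _ := by rw [hm]; ring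

end

theorem key_coeff (h2 : (2:F) ≠ 0) {c : ℝ} (hQ : (2:ℝ) ≤ Fintype.card F) (hc : c^2 = (Fintype.card F : ℝ)⁻¹) {N k : ℕ} (hk : k ≤ N) :
    PowerSeries.coeff k ((1 - PowerSeries.X^2) * BB F c) = PowerSeries.coeff k (HH (Fintype.card F) c N) := by
  let I : Ideal (PowerSeries ℝ) := Ideal.span {PowerSeries.X^(N+1)}
  have h : Ideal.Quotient.mkₐ ℝ I ((1 - PowerSeries.X^2) * BB F c) = Ideal.Quotient.mkₐ ℝ I (HH (Fintype.card F) c N) := by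
    apply key_phi h2 hQ hc
    rw [← map_pow]
    exact Ideal.Quotient.eq_zero_iff_mem.2 (Ideal.mem_span_singleton_self _)
  have h' := Ideal.Quotient.eq.1 h
  rw [Ideal.mem_span_singleton, PowerSeries.X_pow_dvd_iff] at h'
  have := h' k (by omega)
  rw [map_sub] at this
  linarith

theorem NSn_odd (h2 : (2:F) ≠ 0) (n : ℕ) : NSn (-1:F) (2*n+1) = 0 := by
  induction n with
  | zero => exact NSn_one h2
  | succ n ih =>
    have := NSn_succ_succ h2 (2*n+1)
    rw [ih, mul_zero] at this
    exact (Nat.mul_eq_zero.1 this).resolve_right (gl_pos _).ne'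

theorem Et_odd (h2 : (2:F) ≠ 0) (n : ℕ) : Et (-1:F) 1 1 False (2*n+1) = 0 := by
  have h := NSn_odd h2 n
  rw [NSn, Finite.card_eq_zero_iff] at h
  rw [Et, div_eq_zero_iff]
  left
  rw [Nat.cast_eq_zero, Finite.card_eq_zero_iff]
  exact ⟨fun P => h.elim ⟨P.1.1, P.2.1, P.2.2.1⟩⟩

theorem BB_sum (h2 : (2:F) ≠ 0) (c : ℝ) (n : ℕ) :
    ∑ k ∈ Finset.range (2*n+1), PowerSeries.coeff k ((1 - PowerSeries.X^2) * BB F c) = Et (-1:F) 1 1 False (n+n) * (c^2)^n := by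
  have hB : ∀ k, PowerSeries.coeff k (BB F c) = Et (-1:F) 1 1 False k * c^k := fun k => by simp [BB, EE]
  have h2' : ∀ k, PowerSeries.coeff (k+2) ((1 - PowerSeries.X^2) * BB F c) = PowerSeries.coeff (k+2) (BB F c) - PowerSeries.coeff k (BB F c) := by
    intro k
    rw [sub_mul, one_mul, map_sub, PowerSeries.coeff_X_pow_mul', if_pos (by omega), Nat.add_sub_cancel]
  induction n with
  | zero => 
    simp [sub_mul, PowerSeries.coeff_X_pow_mul', BB, EE]
  | succ n ih =>
    rw [show 2*(n+1)+1 = 2*n+1+1+1 by ring, Finset.sum_range_succ, Finset.sum_range_succ, ih]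
    have e1 : PowerSeries.coeff (2*n+1) ((1 - PowerSeries.X^2) * BB F c) = 0 := by
      rcases n with _ | n
      · simp only [sub_mul, one_mul, map_sub, PowerSeries.coeff_X_pow_mul']
        rw [hB, Et_odd h2 0]; simp
      · rw [show 2*(n+1)+1 = 2*n+1+2 by ring, h2', hB, hB, Et_odd h2 n, show 2*n+1+2 = 2*(n+1)+1 by ring, Et_odd h2]; simp
    rw [e1, show 2*n+1+1 = 2*n+2 by ring, h2', hB, hB, show n+1+(n+1) = 2*n+2 by ring, show n + n = 2*n by ring]
    ring

end FF

open Matrix Filter Topology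
set_option linter.all false

namespace FF
variable {Q c : ℝ}

theorem HH_good (hQ : 2 ≤ Q) (hc0 : 0 < c) (hc : c^2 = Q⁻¹) (N : ℕ) :
    Good (HH Q c N) (om Q c 1 * ((∏ i ∈ Finset.range N, om Q c i) * ∏ i ∈ Finset.range (N+1), (1 - (Q⁻¹)^(2*i+1))⁻¹)) := by
  have hx0 : 0 < Q⁻¹ := by positivity
  have hx1 : Q⁻¹ < 1 := by linarith [x_le hQ]
  refine Good.mul ?_ (Good.mul (Good.prod _ fun i => ?_) (Good.prod _ fun i => ?_))
  · exact EE_good one_pos (fun l => mul_nonneg (Vc_nonneg hQ l) (by positivity)) (om_hasSum hQ hc0 hc 1)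
  · exact EE_good (by omega) (fun l => mul_nonneg (Vc_nonneg hQ l) (by positivity)) (om_hasSum hQ hc0 hc i)
  · exact EE_good (by omega) (fun l => by positivity) (hasSum_geometric_of_lt_one (by positivity) (pow_lt_one₀ hx0.le hx1 (by omega)))

theorem HH_mono (hQ : 2 ≤ Q) (hc0 : 0 < c) (hc : c^2 = Q⁻¹) (N k : ℕ) :
    PowerSeries.coeff k (HH Q c N) ≤ PowerSeries.coeff k (HH Q c (N+1)) := by
  have hx0 : 0 < Q⁻¹ := by positivity
  have hx1 : Q⁻¹ < 1 := by linarith [x_le hQ]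
  have e : HH Q c (N+1) = HH Q c N * (UU Q c (N+2) * GI Q (N+1)) := by
    rw [HH, HH, Finset.prod_range_succ, Finset.prod_range_succ _ (N+1)]; ring
  rw [e]
  have h1 : Good (UU Q c (N+2)) (om Q c N) := EE_good (by omega) (fun l => mul_nonneg (Vc_nonneg hQ l) (by positivity)) (om_hasSum hQ hc0 hc N)
  have h2 : Good (GI Q (N+1)) _ := EE_good (by omega) (fun l => by positivity) (hasSum_geometric_of_lt_one (by positivity) (pow_lt_one₀ hx0.le hx1 (by omega)))
  refine (HH_good hQ hc0 hc N).le_mul (h1.mul h2) ?_ k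
  rw [PowerSeries.coeff_mul, Finset.Nat.antidiagonal_zero, Finset.sum_singleton, UU, GI, EE_coeff_zero, EE_coeff_zero]
  simp [Vc]

theorem xp_lt (hQ : 2 ≤ Q) (i : ℕ) : (Q⁻¹)^(i+1) < 1 :=
  pow_lt_one₀ (by positivity) (by linarith [x_le hQ]) (by omega)

theorem om_tendsto (hQ : 2 ≤ Q) (hc0 : 0 < c) (hc : c^2 = Q⁻¹) : Tendsto (om Q c) atTop (𝓝 1) := by
  have hx0 : 0 < Q⁻¹ := by positivity
  have h1 : Tendsto (fun a : ℕ => 1 + (Q⁻¹)^a * (om Q c 0 - 1)) atTop (𝓝 (1 + 0 * (om Q c 0 - 1))) :=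
    tendsto_const_nhds.add ((tendsto_pow_atTop_nhds_zero_of_lt_one hx0.le (by linarith [x_le hQ])).mul_const _)
  rw [zero_mul, add_zero] at h1
  refine tendsto_of_tendsto_of_tendsto_of_le_of_le tendsto_const_nhds h1 (fun a => om_ge hQ hc0 hc a) (fun a => ?_)
  have := om_le hQ hc0 hc a
  show om Q c a ≤ _
  linarith

theorem Wc_om (hQ : 2 ≤ Q) (hc0 : 0 < c) (hc : c^2 = Q⁻¹) (n : ℕ) : Wc Q (2*n) * om Q c (2*n+1) = om Q c 1 := by
  induction n with
  | zero => simp [Wc]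
  | succ n ih =>
    rw [show 2*(n+1) = 2*n+2 by ring, Wc, show 2*n+2+1 = 2*n+1+2 by ring, ← om_rec hQ hc0 hc, ← ih]
    have : 1 - (Q⁻¹)^(2*n+2) ≠ 0 := by have := xp_lt hQ (2*n+1); intro h; linarith
    rw [show 2*n+1+1 = 2*n+2 by ring]
    rw [div_mul_eq_mul_div, div_eq_iff this]; ring

theorem Wc_tendsto (hQ : 2 ≤ Q) (hc0 : 0 < c) (hc : c^2 = Q⁻¹) : Tendsto (fun n => Wc Q (2*n)) atTop (𝓝 (om Q c 1)) := by
  have h : (fun n => Wc Q (2*n)) = fun n => om Q c 1 / om Q c (2*n+1) := by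
    ext n
    have := om_ge hQ hc0 hc (2*n+1)
    rw [eq_div_iff (by linarith), Wc_om hQ hc0 hc]
  rw [h]
  have h1 : Tendsto (fun n : ℕ => om Q c (2*n+1)) atTop (𝓝 1) :=
    (om_tendsto hQ hc0 hc).comp (tendsto_atTop_mono (fun n => by show n ≤ 2*n+1; omega) tendsto_id)
  have h2 := (tendsto_const_nhds (x := om Q c 1)).div h1 one_ne_zero
  rwa [div_one] at h2

theorem Wc_ne (hQ : 2 ≤ Q) (hc0 : 0 < c) (hc : c^2 = Q⁻¹) (n : ℕ) : Wc Q (2*n) ≠ 0 := by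
  intro h
  have h1 := Wc_om hQ hc0 hc n
  have h2 := om_ge hQ hc0 hc 1
  rw [h, zero_mul] at h1
  linarith

theorem odd_prod (hQ : 2 ≤ Q) (M : ℕ) :
    (∏ j ∈ Finset.range (2*M), (1 + (Q⁻¹)^(j+1))) * Wc Q (2*(2*M)) = (∏ i ∈ Finset.range M, (1 - (Q⁻¹)^(2*i+1))⁻¹) * Wc Q (2*M) := by
  induction M with
  | zero => simp
  | succ M ih =>
    have h1 : 1 - (Q⁻¹)^(2*M+1) ≠ 0 := by have := xp_lt hQ (2*M); intro h; linarith
    have h2 : 1 - (Q⁻¹)^(2*M+2) ≠ 0 := by have := xp_lt hQ (2*M+1); intro h; linarith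
    have h3 : 1 - (Q⁻¹)^(2*(2*M)+2) ≠ 0 := by have := xp_lt hQ (2*(2*M)+1); intro h; linarith
    have h4 : 1 - (Q⁻¹)^(2*(2*M)+2+2) ≠ 0 := by have := xp_lt hQ (2*(2*M)+3); intro h; linarith
    rw [Finset.prod_range_succ _ M, show 2*(2*(M+1)) = 2*(2*M)+2+2 by ring, show 2*(M+1) = 2*M+1+1 by ring, Finset.prod_range_succ, Finset.prod_range_succ, Wc, Wc, Wc]
    have e1 : 1 - (Q⁻¹)^(2*(2*M)+2) = (1 - (Q⁻¹)^(2*M+1)) * (1 + (Q⁻¹)^(2*M+1)) := by ring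
    have e2 : 1 - (Q⁻¹)^(2*(2*M)+2+2) = (1 - (Q⁻¹)^(2*M+2)) * (1 + (Q⁻¹)^(2*M+2)) := by ring
    have h5 : 1 + (Q⁻¹)^(2*M+1) ≠ 0 := fun h => h3 (by rw [e1, h, mul_zero])
    have h6 : 1 + (Q⁻¹)^(2*M+2) ≠ 0 := fun h => h4 (by rw [e2, h, mul_zero])
    rw [e1, e2, show 2*M+1+1 = 2*M+2 by ring]
    generalize Wc Q (2*(2*M)) = A at *
    generalize Wc Q (2*M) = B at *
    generalize (∏ j ∈ Finset.range (2*M), (1 + (Q⁻¹)^(j+1))) = C at *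
    generalize (∏ i ∈ Finset.range M, (1 - (Q⁻¹)^(2*i+1))⁻¹) = D at *
    generalize (Q⁻¹)^(2*M+1) = s at *
    generalize (Q⁻¹)^(2*M+2) = t at *
    clear e1 e2
    calc _ = (C * A) * (((1+s) / (1+s)) * ((1+t)/(1+t)) / ((1-s) * (1-t))) := by field_simp
      _ = _ := by rw [ih, div_self h5, div_self h6]; field_simp

/-- the exponents -/
noncomputable def dd (Q : ℝ) (j : ℕ) : ℝ := ((1 - (Q⁻¹)^(j+1))⁻¹)^((j+2)/2)

theorem dd_ge (hQ : 2 ≤ Q) (j : ℕ) : 1 ≤ dd Q j := by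
  have h1 := xp_lt hQ j
  have h2 : 0 < (Q⁻¹)^(j+1) := by positivity
  exact one_le_pow₀ ((one_le_inv₀ (by linarith)).2 (by linarith))

theorem om_prod (hQ : 2 ≤ Q) (hc0 : 0 < c) (hc : c^2 = Q⁻¹) (M : ℕ) :
    ∏ a ∈ Finset.range M, om Q c a = (∏ j ∈ Finset.range M, dd Q j) * (om Q c M ^ (M/2) * om Q c (M+1) ^ ((M+1)/2)) := by
  induction M with
  | zero => simp
  | succ M ih =>
    rw [Finset.prod_range_succ, ih, Finset.prod_range_succ]
    have h1 : 1 - (Q⁻¹)^(M+1) ≠ 0 := by have := xp_lt hQ M; intro h; linarith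
    have h2 : om Q c M = (1 - (Q⁻¹)^(M+1))⁻¹ * om Q c (M+2) := by
      rw [← om_rec hQ hc0 hc, inv_mul_eq_div, mul_div_cancel_right₀ _ h1]
    have h3 : om Q c M ^ (M/2) * om Q c M = dd Q M * om Q c (M+2)^((M+2)/2) := by
      rw [← pow_succ, show M/2+1 = (M+2)/2 by omega, h2, mul_pow, dd]
    rw [show M+1+1 = M+2 by ring]
    linear_combination (∏ j ∈ Finset.range M, dd Q j) * om Q c (M+1) ^ ((M+1)/2) * h3

theorem gg_tendsto (hQ : 2 ≤ Q) (hc0 : 0 < c) (hc : c^2 = Q⁻¹) : Tendsto (fun M => om Q c M ^ (M/2)) atTop (𝓝 1) := by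
  have hx0 : 0 < Q⁻¹ := by positivity
  have hx1 : Q⁻¹ < 1 := by linarith [x_le hQ]
  set K := om Q c 0 - 1 with hK
  have hK0 : 0 ≤ K := by have := om_ge hQ hc0 hc 0; linarith
  have h1 : Tendsto (fun M : ℕ => Real.exp ((M * (Q⁻¹)^M) * K)) atTop (𝓝 (Real.exp (0 * K))) :=
    (Real.continuous_exp.tendsto _).comp ((tendsto_self_mul_const_pow_of_lt_one hx0.le hx1).mul_const K)
  rw [zero_mul, Real.exp_zero] at h1
  refine tendsto_of_tendsto_of_tendsto_of_le_of_le tendsto_const_nhds h1 (fun M => one_le_pow₀ (om_ge hQ hc0 hc M)) (fun M => ?_)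
  have h2 : om Q c M ≤ Real.exp ((Q⁻¹)^M * K) := by
    have := om_le hQ hc0 hc M
    have h3 := Real.add_one_le_exp ((Q⁻¹)^M * K)
    linarith
  have h0 : 0 ≤ om Q c M := by linarith [om_ge hQ hc0 hc M]
  calc om Q c M ^ (M/2) ≤ (om Q c M)^M := pow_le_pow_right₀ (om_ge hQ hc0 hc M) (by omega)
    _ ≤ (Real.exp ((Q⁻¹)^M * K))^M := pow_le_pow_left₀ h0 h2 M
    _ = _ := by rw [← Real.exp_nat_mul]; congr 1; ring

theorem om_mult (hQ : 2 ≤ Q) (hc0 : 0 < c) (hc : c^2 = Q⁻¹) : Multipliable (om Q c) := by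
  have hx0 : 0 < Q⁻¹ := by positivity
  have hx1 : Q⁻¹ < 1 := by linarith [x_le hQ]
  have h1 : Summable fun a => om Q c a - 1 :=
    Summable.of_nonneg_of_le (fun a => by linarith [om_ge hQ hc0 hc a]) (om_le hQ hc0 hc) ((summable_geometric_of_lt_one hx0.le hx1).mul_right _)
  have := Real.multipliable_one_add_of_summable h1
  simpa using this

theorem pl_mult (hQ : 2 ≤ Q) : Multipliable (fun j : ℕ => 1 + (Q⁻¹)^(j+1)) := by
  have hx0 : 0 < Q⁻¹ := by positivity
  have hx1 : Q⁻¹ < 1 := by linarith [x_le hQ]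
  exact Real.multipliable_one_add_of_summable ((summable_nat_add_iff 1).2 (summable_geometric_of_lt_one hx0.le hx1))

theorem dd_tendsto (hQ : 2 ≤ Q) (hc0 : 0 < c) (hc : c^2 = Q⁻¹) :
    Tendsto (fun M => ∏ j ∈ Finset.range M, dd Q j) atTop (𝓝 (∏' a, om Q c a)) := by
  have h1 := gg_tendsto hQ hc0 hc
  have h2 := h1.mul (h1.comp (tendsto_add_atTop_nat 1))
  have h3 := (om_mult hQ hc0 hc).tendsto_prod_tprod_nat.div h2 (by norm_num)
  rw [mul_one, div_one] at h3
  refine h3.congr fun M => ?_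
  rw [Pi.div_apply, om_prod hQ hc0 hc]
  have ha := om_ge hQ hc0 hc M
  have hb := om_ge hQ hc0 hc (M+1)
  exact mul_div_cancel_right₀ _ (mul_pos (pow_pos (by linarith) _) (pow_pos (by linarith) _)).ne'

theorem sum_le_prod (g : ℕ → ℝ) (h : ∀ j, 1 ≤ g j) (M : ℕ) : ∑ j ∈ Finset.range M, (g j - 1) ≤ (∏ j ∈ Finset.range M, g j) - 1 := by
  induction M with
  | zero => simp
  | succ M ih =>
    rw [Finset.sum_range_succ, Finset.prod_range_succ]
    have h1 : 1 ≤ ∏ j ∈ Finset.range M, g j := Finset.one_le_prod fun j _ => h j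
    nlinarith [h M]

theorem dd_mult (hQ : 2 ≤ Q) (hc0 : 0 < c) (hc : c^2 = Q⁻¹) : Multipliable (dd Q) := by
  have h1 := dd_tendsto hQ hc0 hc
  obtain ⟨B, hB⟩ := h1.bddAbove_range
  have h2 : Summable fun j => dd Q j - 1 := by
    refine summable_of_sum_range_le (c := B - 1) (fun j => by linarith [dd_ge hQ j]) fun M => ?_
    refine (sum_le_prod _ (dd_ge hQ) M).trans ?_
    have := hB ⟨M, rfl⟩
    simp only at this
    linarith
  have := Real.multipliable_one_add_of_summable h2
  simpa using this

theorem final_prod (hQ : 2 ≤ Q) (hc0 : 0 < c) (hc : c^2 = Q⁻¹) :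
    Multipliable (fun j : ℕ => (1 + (Q⁻¹)^(j+1)) * dd Q j) ∧
      ∏' j : ℕ, (1 + (Q⁻¹)^(j+1)) * dd Q j = (∏' j : ℕ, (1 + (Q⁻¹)^(j+1))) * ∏' a, om Q c a := by
  refine ⟨(pl_mult hQ).mul (dd_mult hQ hc0 hc), ?_⟩
  rw [(pl_mult hQ).tprod_mul (dd_mult hQ hc0 hc)]
  congr 1
  exact tendsto_nhds_unique (dd_mult hQ hc0 hc).tendsto_prod_tprod_nat (dd_tendsto hQ hc0 hc)

theorem odd_tendsto (hQ : 2 ≤ Q) (hc0 : 0 < c) (hc : c^2 = Q⁻¹) :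
    Tendsto (fun M => ∏ i ∈ Finset.range M, (1 - (Q⁻¹)^(2*i+1))⁻¹) atTop (𝓝 (∏' j : ℕ, (1 + (Q⁻¹)^(j+1)))) := by
  have h2n : Tendsto (fun n : ℕ => 2 * n) atTop atTop := tendsto_atTop_mono (fun n => by show n ≤ 2 * n; omega) tendsto_id
  have hW := Wc_tendsto hQ hc0 hc
  have ho : om Q c 1 ≠ 0 := by linarith [om_ge hQ hc0 hc 1]
  have h1 := ((pl_mult hQ).tendsto_prod_tprod_nat.comp h2n).mul ((hW.comp h2n).div hW ho)
  rw [div_self ho, mul_one] at h1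
  refine h1.congr fun M => ?_
  have := odd_prod hQ M
  simp only [Function.comp, Pi.div_apply]
  rw [mul_div_assoc', this, mul_div_cancel_right₀ _ (Wc_ne hQ hc0 hc M)]

variable {F : Type} [Field F] [Fintype F]

theorem final_lim (h2 : (2:F) ≠ 0) (hQ : (2:ℝ) ≤ Fintype.card F) :
    Multipliable (fun j : ℕ => (1 + ((Fintype.card F : ℝ)⁻¹)^(j+1)) * dd (Fintype.card F) j) ∧
    Tendsto (fun n : ℕ => (spCommPairs F n : ℝ) / (Fintype.card F : ℝ)^(2*n^2+2*n)) atTop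
      (𝓝 (∏' j : ℕ, (1 + ((Fintype.card F : ℝ)⁻¹)^(j+1)) * dd (Fintype.card F) j)) := by
  set Q : ℝ := (Fintype.card F : ℝ) with hQd
  have hQ0 : 0 < Q := by linarith
  have hx0 : 0 < Q⁻¹ := by positivity
  obtain ⟨c, hc0, hc⟩ : ∃ c : ℝ, 0 < c ∧ c^2 = Q⁻¹ := ⟨Real.sqrt Q⁻¹, Real.sqrt_pos.2 hx0, Real.sq_sqrt hx0.le⟩
  obtain ⟨hm, hp⟩ := final_prod hQ hc0 hc
  refine ⟨hm, ?_⟩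
  rw [hp]
  have ho : om Q c 1 ≠ 0 := by linarith [om_ge hQ hc0 hc 1]
  have hb : Tendsto (fun n : ℕ => Et (-1:F) 1 1 False (n+n) * (c^2)^n) atTop (𝓝 (om Q c 1 * ((∏' a, om Q c a) * ∏' j : ℕ, (1 + (Q⁻¹)^(j+1))))) := by
    refine sandwich (h := fun N k => PowerSeries.coeff k (HH Q c N)) (fun N k => (HH_good hQ hc0 hc N).1 k) (HH_mono hQ hc0 hc) (fun N => (HH_good hQ hc0 hc N).2) ?_ ?_
    · exact tendsto_const_nhds.mul ((om_mult hQ hc0 hc).tendsto_prod_tprod_nat.mul ((odd_tendsto hQ hc0 hc).comp (tendsto_add_atTop_nat 1)))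
    · intro n
      rw [← BB_sum h2]
      refine Finset.sum_congr rfl fun k hk => ?_
      exact key_coeff h2 hQ hc (by simp at hk; omega)
  have hf := hb.div (Wc_tendsto hQ hc0 hc) ho
  rw [mul_div_cancel_left₀ _ ho, mul_comm] at hf
  refine hf.congr fun n => ?_
  have hW := Wc_ne hQ hc0 hc n
  rw [Pi.div_apply, Et_even h2, hc, ← two_mul, ← hQd, div_eq_iff hW, inv_pow, show 2*n^2+2*n = 2*n^2+n+n by ring, pow_add _ (2*n^2+n)]
  field_simp

end FF

theorem feit_fine_symplectic_asymptotics
    (q : ℕ) (hq : ∃ p m : ℕ, p.Prime ∧ 0 < m ∧ q = p ^ m) (hodd : Odd q)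
    (F : Type) [Field F] [Fintype F] (hF : Fintype.card F = q) :
    Multipliable (fun j : ℕ =>
      (1 + (q : ℝ) ^ (-(j : ℤ) - 1)) *
        ((1 - (q : ℝ) ^ (-(j : ℤ) - 1))⁻¹) ^ ((j + 2) / 2)) ∧
    Filter.Tendsto
      (fun n : ℕ => (spCommPairs F n : ℝ) / (q : ℝ) ^ (2 * n ^ 2 + 2 * n))
      Filter.atTop
      (nhds (∏' j : ℕ, (1 + (q : ℝ) ^ (-(j : ℤ) - 1)) *
        ((1 - (q : ℝ) ^ (-(j : ℤ) - 1))⁻¹) ^ ((j + 2) / 2))) := by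
  subst hF
  have h2 : (2:F) ≠ 0 := by
    intro h
    have hd : ringChar F ∣ 2 := ringChar.dvd (by exact_mod_cast h)
    have h3 : ringChar F = 2 := ((Nat.dvd_prime Nat.prime_two).1 hd).resolve_left (CharP.ringChar_ne_one)
    have h4 := FiniteField.even_card_of_char_two h3
    exact (Nat.not_even_iff_odd.2 hodd) (Nat.even_iff.2 h4)
  have hQ : (2:ℝ) ≤ Fintype.card F := by exact_mod_cast Fintype.one_lt_card (α := F)
  have e : ∀ j : ℕ, (Fintype.card F : ℝ)^(-(j:ℤ) - 1) = ((Fintype.card F : ℝ)⁻¹)^(j+1) := by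
    intro j
    rw [show -(j:ℤ) - 1 = -((j+1 : ℕ) : ℤ) by push_cast; ring, _root_.zpow_neg, zpow_natCast, inv_pow]
  simp only [e]
  exact FF.final_lim h2 hQ
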